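/- There is an absolute constant A such that for every odd prime q and every integer ℓ with 2 ≤ ℓ ≤ √(log q)/log log q, one has |(1/q) Σ_{k=0}^{q−1} C(k)^ℓ − M_C(ℓ)| ≤ A · q^{−1/(20 ℓ log ℓ)}, where M_C(ℓ) = C^ℓ Σ_{n₁,…,n_ℓ ≥ 1} b(n₁)⋯b(n_ℓ) B(n₁,…,n_ℓ). -/

import Mathlib

open scoped Classical Real
open Complex MeasureTheory

/-- The sawtooth function `ψ`. -/
noncomputable def saw (x : ℝ) : ℝ := if Int.fract x = 0 then 0 else Int.fract x - 1/2

/-- The Euler product `A_{q,χ}`. -/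
noncomputable def Aq (q : ℕ) (χ : DirichletCharacter ℂ q) : ℂ :=
  ∏' p : Nat.Primes, if (p : ℕ) ∣ q then 1 else
    1 - (1 - χ ((p : ℕ) : ZMod q)) ^ 2 / (((p : ℕ) : ℂ) - 1) ^ 2

/-- The quantity `C(k) = C(k; q)` (a real number; we take the real part of the
defining expression, which is real). -/
noncomputable def Cfun (q : ℕ) (k : ℤ) : ℝ :=
  if h : q = 0 then 0 else
    haveI : NeZero q := ⟨h⟩
    ((↑q.totient : ℂ)⁻¹ *
      ∑ χ ∈ Finset.univ.filter (fun χ : DirichletCharacter ℂ q => χ ≠ 1),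
        (starRingEnd ℂ) (χ ((k : ZMod q))) * DirichletCharacter.LFunction χ 0 *
          DirichletCharacter.LFunction χ 1 * Aq q χ).re

/-- The multiplicative function `a(n)`: `a(2) = -1/2`, `a(2^v) = 0` for `v ≥ 2`, and for odd
primes `p`, `a(p) = 2/(p(p-2))`, `a(p²) = -1/(p(p-2))`, `a(p^v) = 0` for `v ≥ 3`. -/
noncomputable def aCoef (n : ℕ) : ℝ :=
  if n = 0 then 0 else
    ∏ p ∈ n.primeFactors,
      if p = 2 then (if n.factorization 2 = 1 then (-1/2 : ℝ) else 0)
      else (if n.factorization p = 1 then 2 / (p * (p - 2) : ℝ)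
            else if n.factorization p = 2 then -1 / (p * (p - 2) : ℝ) else 0)

/-- `b(n) = ∑_{uv = n} a(u)/v`. -/
noncomputable def bCoef (n : ℕ) : ℝ := ∑ u ∈ n.divisors, aCoef u / ((n / u : ℕ) : ℝ)

/-- The constant `C = C_q = 2 ∏_{p odd prime, p ∤ q} (1 - 1/(p-1)²)`. -/
noncomputable def Cq (q : ℕ) : ℝ :=
  2 * ∏' p : Nat.Primes, if (p : ℕ) = 2 ∨ (p : ℕ) ∣ q then 1
    else 1 - 1 / ((p : ℝ) - 1) ^ 2

/-- The correlation `B(n₁, …, n_ℓ)` of sawtooth functions. -/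
noncomputable def Bcorr {l : ℕ} (n : Fin l → ℕ) : ℝ :=
  (1 / ∏ j, (n j : ℝ)) * ∫ x in (0 : ℝ)..(∏ j, (n j : ℝ)), ∏ j, saw (x / n j)

/-- `M_C(ℓ) = C^ℓ ∑_{n₁,…,n_ℓ ≥ 1} b(n₁)⋯b(n_ℓ) B(n₁,…,n_ℓ)`. -/
noncomputable def MC (q l : ℕ) : ℝ :=
  Cq q ^ l * ∑' n : Fin l → ℕ+, (∏ j, bCoef (n j)) * Bcorr (fun j => (n j : ℕ))

/-! ### Divisor sums and the coefficients `a` and `b` -/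

lemma card_divisors_mul_le (m n : ℕ) :
    (m * n).divisors.card ≤ m.divisors.card * n.divisors.card := by
  rw [Nat.divisors_mul]
  exact Finset.card_mul_le

lemma summable_divisors_pow (k : ℕ) {s : ℝ} (hs : 1 < s) :
    Summable fun n : ℕ => (n.divisors.card : ℝ) ^ k / (n : ℝ) ^ s := by
  induction k with
  | zero => simpa using (Real.summable_one_div_nat_rpow.mpr hs)
  | succ k ih =>
    set F : ℕ → ℝ := fun n => (n.divisors.card : ℝ) ^ k / (n : ℝ) ^ s with hF
    have hF0 : ∀ n, 0 ≤ F n := fun n => by positivity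
    have hprod : Summable fun x : ℕ × ℕ => F x.1 * F x.2 :=
      ih.mul_of_nonneg ih hF0 hF0
    have hinj : Function.Injective
        (fun x : (Σ n : ℕ, n.divisorsAntidiagonal) => (x.2 : ℕ × ℕ)) := by
      rintro ⟨n, ⟨x, hx⟩⟩ ⟨m, ⟨y, hy⟩⟩ h
      simp only at h
      subst h
      have h1 := (Nat.mem_divisorsAntidiagonal.mp hx).1
      have h2 := (Nat.mem_divisorsAntidiagonal.mp hy).1
      have : n = m := by omega
      subst this
      rfl
    have h1 := (hprod.comp_injective hinj).sigma
    refine h1.of_nonneg_of_le (fun n => by positivity) fun n => ?_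
    simp only [Function.comp_def]
    rw [tsum_fintype]
    rw [Finset.sum_coe_sort (n.divisorsAntidiagonal) (fun x : ℕ × ℕ => F x.1 * F x.2)]
    have h2 : ∀ x ∈ n.divisorsAntidiagonal,
        (n.divisors.card : ℝ) ^ k / (n : ℝ) ^ s ≤ F x.1 * F x.2 := by
      intro x hx
      have hxn := (Nat.mem_divisorsAntidiagonal.mp hx).1
      rw [hF, ← hxn]
      simp only
      rw [Nat.cast_mul, Real.mul_rpow (by positivity) (by positivity), div_mul_div_comm,
        ← mul_pow]
      gcongr
      exact_mod_cast card_divisors_mul_le _ _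
    refine le_trans ?_ (Finset.card_nsmul_le_sum _ _ _ h2)
    rw [nsmul_eq_mul, ← Nat.map_div_right_divisors, Finset.card_map]
    apply le_of_eq
    ring

lemma summable_of_fiber_subset {ι : Type*} {g : ι → ℝ} {h : ℕ → ℝ} (φ : ι → ℕ) (S : ℕ → Finset ι)
    (hg : ∀ i, 0 ≤ g i) (hh : ∀ r, 0 ≤ h r) (hS : ∀ i, g i ≠ 0 → i ∈ S (φ i))
    (hle : ∀ i, g i ≤ h (φ i)) (hsum : Summable fun r => ((S r).card : ℝ) * h r) :
    Summable g := by
  refine summable_of_sum_le (c := ∑' r, ((S r).card : ℝ) * h r) hg fun u => ?_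
  have h1 : ∑ i ∈ u, g i = ∑ r ∈ u.image φ, ∑ i ∈ u with φ i = r, g i :=
    (Finset.sum_fiberwise_of_maps_to (fun i hi => Finset.mem_image_of_mem φ hi) g).symm
  rw [h1]
  refine le_trans (Finset.sum_le_sum fun r _ => ?_)
    (hsum.sum_le_tsum (u.image φ) fun r _ => mul_nonneg (by positivity) (hh r))
  have h2 : ∑ i ∈ u with φ i = r, g i ≤ ∑ i ∈ S r with φ i = r, g i := by
    rw [← Finset.sum_filter_ne_zero]
    refine Finset.sum_le_sum_of_subset_of_nonneg ?_ fun i _ _ => hg i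
    intro i hi
    simp only [Finset.mem_filter] at hi ⊢
    exact ⟨hi.1.2 ▸ hS i hi.2, hi.1.2⟩
  refine h2.trans ?_
  have h3 : ∀ i ∈ (S r).filter (fun i => φ i = r), g i ≤ h r := by
    intro i hi
    simp only [Finset.mem_filter] at hi
    exact hi.2 ▸ hle i
  refine (Finset.sum_le_card_nsmul _ _ _ h3).trans ?_
  rw [nsmul_eq_mul]
  have := hh r
  gcongr
  exact Finset.filter_subset _ _

/-- The local factor `a(p ^ e)`. -/
noncomputable def aLocal (p e : ℕ) : ℝ :=
  if p = 2 then (if e = 1 then (-1/2 : ℝ) else 0)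
  else (if e = 1 then 2 / (p * (p - 2) : ℝ)
        else if e = 2 then -1 / (p * (p - 2) : ℝ) else 0)

lemma aCoef_eq {n : ℕ} (hn : n ≠ 0) :
    aCoef n = ∏ p ∈ n.primeFactors, aLocal p (n.factorization p) := by
  rw [aCoef, if_neg hn]
  refine Finset.prod_congr rfl fun p _ => ?_
  rw [aLocal]
  split_ifs with h1 <;> simp_all

lemma abs_aLocal_le {p e : ℕ} (hp : p.Prime) : |aLocal p e| ≤ ((e : ℝ) + 1) ^ 3 / (p : ℝ) ^ 2 := by
  rcases eq_or_ne p 2 with rfl | h2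
  · rw [aLocal, if_pos rfl]
    split_ifs with h
    · subst h; norm_num [abs_div]
    · simp; positivity
  have h3 : (3 : ℝ) ≤ p := by
    have := hp.two_le
    exact_mod_cast (by omega : 3 ≤ p)
  have hpp : (0 : ℝ) < p * (p - 2) := by nlinarith
  have key : 1 / ((p : ℝ) * (p - 2)) ≤ 3 / (p : ℝ) ^ 2 := by
    rw [div_le_div_iff₀ hpp (by positivity)]
    nlinarith
  rw [aLocal, if_neg h2]
  split_ifs with h h'
  · subst h
    rw [abs_of_nonneg (by positivity)]
    calc 2 / ((p : ℝ) * (p - 2)) = 2 * (1 / ((p : ℝ) * (p - 2))) := by ring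
      _ ≤ 2 * (3 / (p : ℝ) ^ 2) := by gcongr
      _ ≤ _ := by
        rw [← mul_div_assoc]
        gcongr
        norm_num
  · subst h'
    rw [neg_div, abs_neg, abs_of_nonneg (by positivity)]
    refine key.trans ?_
    gcongr
    norm_num
  · simp; positivity

lemma aLocal_eq_zero {p e : ℕ} (he : 2 < e) : aLocal p e = 0 := by
  rw [aLocal]
  split_ifs <;> first | omega | rfl

/-- The radical of `n`. -/
def primeRadical (n : ℕ) : ℕ := ∏ p ∈ n.primeFactors, p

lemma primeRadical_pos (n : ℕ) : 0 < primeRadical n :=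
  Finset.prod_pos fun _ hp => (Nat.prime_of_mem_primeFactors hp).pos

lemma abs_aCoef_le {n : ℕ} (hn : n ≠ 0) :
    |aCoef n| ≤ (n.divisors.card : ℝ) ^ 3 / (primeRadical n : ℝ) ^ 2 := by
  rw [aCoef_eq hn, Finset.abs_prod, Nat.card_divisors hn, primeRadical]
  push_cast
  rw [← Finset.prod_pow, ← Finset.prod_pow, ← Finset.prod_div_distrib]
  exact Finset.prod_le_prod (fun _ _ => abs_nonneg _)
    fun p hp => abs_aLocal_le (Nat.prime_of_mem_primeFactors hp)

lemma dvd_primeRadical_sq {n : ℕ} (h : aCoef n ≠ 0) : n ∣ primeRadical n ^ 2 := by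
  have hn : n ≠ 0 := by
    rintro rfl
    simp [aCoef] at h
  rw [aCoef_eq hn, Finset.prod_ne_zero_iff] at h
  conv_lhs => rw [← Nat.prod_factorization_pow_eq_self hn]
  rw [primeRadical, ← Finset.prod_pow, Finsupp.prod, Nat.support_factorization]
  refine Finset.prod_dvd_prod_of_dvd _ _ fun p hp => ?_
  refine pow_dvd_pow _ ?_
  by_contra hlt
  exact h p hp (aLocal_eq_zero (not_le.mp hlt))

lemma abs_aCoef_mul_le (n : ℕ) : |aCoef n| * n ≤ (n.divisors.card : ℝ) ^ 3 := by
  by_cases h : aCoef n = 0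
  · rw [h]; simp
  have hn : n ≠ 0 := by
    rintro rfl
    simp [aCoef] at h
  have h1 : (n : ℝ) ≤ (primeRadical n : ℝ) ^ 2 := by
    exact_mod_cast Nat.le_of_dvd (pow_pos (primeRadical_pos n) 2) (dvd_primeRadical_sq h)
  have h2 : (0 : ℝ) < primeRadical n := by exact_mod_cast primeRadical_pos n
  calc |aCoef n| * n ≤ (n.divisors.card : ℝ) ^ 3 / (primeRadical n : ℝ) ^ 2 *
        (primeRadical n : ℝ) ^ 2 := by
        gcongr
        exact abs_aCoef_le hn
    _ = _ := by field_simp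

lemma summable_abs_aCoef_mul_rpow :
    Summable fun n : ℕ => |aCoef n| * (n : ℝ) ^ (1 / 4 : ℝ) := by
  refine summable_of_fiber_subset primeRadical (fun r => (r ^ 2).divisors)
    (h := fun r => ((r ^ 2).divisors.card : ℝ) ^ 3 / (r : ℝ) ^ (3 / 2 : ℝ))
    (fun i => by positivity) (fun i => by positivity) ?_ ?_ ?_
  · intro i hi
    have := left_ne_zero_of_mul hi
    rw [abs_ne_zero] at this
    exact Nat.mem_divisors.mpr ⟨dvd_primeRadical_sq this, (pow_pos (primeRadical_pos i) 2).ne'⟩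
  · intro n
    by_cases h : aCoef n = 0
    · rw [h]; simp; positivity
    have hn : n ≠ 0 := by
      rintro rfl
      simp [aCoef] at h
    have hd := dvd_primeRadical_sq h
    have hr2 := (pow_pos (primeRadical_pos n) 2)
    have h1 : (n : ℝ) ≤ (primeRadical n : ℝ) ^ 2 := by
      exact_mod_cast Nat.le_of_dvd hr2 hd
    have h2 : (0 : ℝ) < primeRadical n := by exact_mod_cast primeRadical_pos n
    have h3 : (n : ℝ) ^ (1 / 4 : ℝ) ≤ (primeRadical n : ℝ) ^ (1 / 2 : ℝ) := by
      calc (n : ℝ) ^ (1 / 4 : ℝ) ≤ ((primeRadical n : ℝ) ^ 2) ^ (1 / 4 : ℝ) := by gcongr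
        _ = _ := by
          rw [← Real.rpow_natCast, ← Real.rpow_mul h2.le]
          norm_num
    have h4 : (n.divisors.card : ℝ) ≤ ((primeRadical n ^ 2).divisors.card : ℝ) := by
      exact_mod_cast Finset.card_le_card (Nat.divisors_subset_of_dvd hr2.ne' hd)
    calc |aCoef n| * (n : ℝ) ^ (1 / 4 : ℝ)
        ≤ (n.divisors.card : ℝ) ^ 3 / (primeRadical n : ℝ) ^ 2 *
          (primeRadical n : ℝ) ^ (1 / 2 : ℝ) := by
          gcongr
          exact abs_aCoef_le hn
      _ = (n.divisors.card : ℝ) ^ 3 / (primeRadical n : ℝ) ^ (3 / 2 : ℝ) := by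
          rw [show (2 : ℝ) = 3 / 2 + 1 / 2 by norm_num] at *
          rw [div_mul_eq_mul_div, div_eq_div_iff (by positivity) (by positivity), mul_assoc,
            ← Real.rpow_add h2, ← Real.rpow_natCast (primeRadical n : ℝ) 2]
          norm_num
      _ ≤ _ := by gcongr
  · refine (summable_divisors_pow 8 (s := 3 / 2) (by norm_num)).of_nonneg_of_le
      (fun r => by positivity) fun r => ?_
    rw [← mul_div_assoc, ← pow_succ']
    gcongr
    have : ((r ^ 2).divisors.card : ℝ) ≤ (r.divisors.card : ℝ) ^ 2 := by
      rw [sq, sq]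
      exact_mod_cast card_divisors_mul_le r r
    calc ((r ^ 2).divisors.card : ℝ) ^ 4 ≤ ((r.divisors.card : ℝ) ^ 2) ^ 4 := by gcongr
      _ = _ := by ring

lemma summable_abs_aCoef : Summable fun n : ℕ => |aCoef n| := by
  refine summable_abs_aCoef_mul_rpow.of_nonneg_of_le (fun n => abs_nonneg _) fun n => ?_
  rcases Nat.eq_zero_or_pos n with rfl | hn
  · simp [aCoef]
  · have : (1 : ℝ) ≤ n := by exact_mod_cast hn
    exact le_mul_of_one_le_right (abs_nonneg _) (Real.one_le_rpow this (by norm_num))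

/-- The constant controlling all sums of `|a(n)|`. -/
noncomputable def aNorm : ℝ := ∑' n : ℕ, |aCoef n| * (n : ℝ) ^ (1 / 4 : ℝ)

lemma aNorm_nonneg : 0 ≤ aNorm := tsum_nonneg fun n => by positivity

lemma sum_abs_aCoef_tail (s : Finset ℕ) {T : ℕ} (hT : 0 < T) (hs : ∀ u ∈ s, T ≤ u) :
    ∑ u ∈ s, |aCoef u| ≤ aNorm * (T : ℝ) ^ (-(1 / 4) : ℝ) := by
  have hT' : (0 : ℝ) < T := by exact_mod_cast hT
  calc ∑ u ∈ s, |aCoef u|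
      ≤ ∑ u ∈ s, |aCoef u| * (u : ℝ) ^ (1 / 4 : ℝ) * (T : ℝ) ^ (-(1 / 4) : ℝ) := by
        refine Finset.sum_le_sum fun u hu => ?_
        rw [mul_assoc]
        refine le_mul_of_one_le_right (abs_nonneg _) ?_
        rw [Real.rpow_neg hT'.le, ← div_eq_mul_inv, one_le_div (by positivity)]
        have : (T : ℝ) ≤ u := by exact_mod_cast hs u hu
        gcongr
    _ = (∑ u ∈ s, |aCoef u| * (u : ℝ) ^ (1 / 4 : ℝ)) * (T : ℝ) ^ (-(1 / 4) : ℝ) := by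
        rw [Finset.sum_mul]
    _ ≤ _ := by
        gcongr
        exact summable_abs_aCoef_mul_rpow.sum_le_tsum s fun _ _ => by positivity

lemma sum_abs_aCoef_le (s : Finset ℕ) : ∑ u ∈ s, |aCoef u| ≤ aNorm := by
  have h := sum_abs_aCoef_tail (s.erase 0) (T := 1) one_pos fun u hu => by
    have := Finset.ne_of_mem_erase hu; omega
  have h0 : aCoef 0 = 0 := by simp [aCoef]
  rw [Finset.sum_erase _ (by simp [h0])] at h
  simpa using h

lemma sum_divisors_abs_aCoef_le {n : ℕ} (hn : n ≠ 0) :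
    ∑ u ∈ n.divisors, |aCoef u| / ((n / u : ℕ) : ℝ) ≤ (n.divisors.card : ℝ) ^ 4 / n := by
  have h : ∀ u ∈ n.divisors, |aCoef u| / ((n / u : ℕ) : ℝ) ≤ (n.divisors.card : ℝ) ^ 3 / n := by
    intro u hu
    have hun := Nat.dvd_of_mem_divisors hu
    have hu0 : (0 : ℝ) < u := by exact_mod_cast Nat.pos_of_mem_divisors hu
    have hn' : (0 : ℝ) < n := by exact_mod_cast Nat.pos_of_ne_zero hn
    rw [Nat.cast_div hun hu0.ne', div_div_eq_mul_div]
    gcongr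
    refine (abs_aCoef_mul_le u).trans ?_
    gcongr
  refine (Finset.sum_le_card_nsmul _ _ _ h).trans (le_of_eq ?_)
  rw [nsmul_eq_mul]
  ring

/-! ### The sawtooth function and its correlations -/

lemma abs_saw_le (x : ℝ) : |saw x| ≤ 1 / 2 := by
  have h0 := Int.fract_nonneg x
  have h1 := Int.fract_lt_one x
  rw [saw]
  split_ifs
  · norm_num
  · rw [abs_le]; constructor <;> linarith

lemma abs_saw_le_one (x : ℝ) : |saw x| ≤ 1 := (abs_saw_le x).trans (by norm_num)

lemma saw_add_nat (x : ℝ) (m : ℕ) : saw (x + m) = saw x := by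
  simp [saw]

lemma saw_zero : saw 0 = 0 := by simp [saw]

lemma saw_neg (x : ℝ) : saw (-x) = -saw x := by
  by_cases h : Int.fract x = 0
  · have h' : Int.fract (-x) = 0 := Int.fract_neg_eq_zero.mpr h
    simp [saw, h, h']
  · have h' : Int.fract (-x) ≠ 0 := fun h'' => h (Int.fract_neg_eq_zero.mp h'')
    rw [saw, saw, if_neg h, if_neg h', Int.fract_neg h]
    ring

lemma measurable_saw : Measurable saw := by
  unfold saw
  exact Measurable.ite (measurable_fract (measurableSet_singleton (0 : ℝ))) measurable_const
    (measurable_fract.sub_const _)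

lemma abs_sum_saw_add_div_le {r : ℕ} (hr : 0 < r) (y : ℝ) :
    |∑ t ∈ Finset.range r, saw (y + t / r)| ≤ 1 / 2 := by
  have hr' : (0 : ℝ) < r := by exact_mod_cast hr
  set f : ℝ → ℝ := fun y => ∑ t ∈ Finset.range r, saw (y + t / r) with hf
  have hper : Function.Periodic f (1 / r) := by
    intro y
    have h1 : f (y + 1 / r) = ∑ t ∈ Finset.range r, saw (y + (t + 1 : ℕ) / r) := by
      refine Finset.sum_congr rfl fun t _ => ?_
      congr 1
      push_cast
      ring
    rw [h1]
    have h2 := Finset.sum_range_succ' (fun t : ℕ => saw (y + t / r)) r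
    rw [Finset.sum_range_succ, div_self hr'.ne'] at h2
    have h3 := saw_add_nat y 1
    simp only [Nat.cast_one, Nat.cast_zero, zero_div, add_zero] at h2 h3
    rw [h3] at h2
    linarith
  have h1 : f y = f (Int.fract (r * y) / r) := by
    have h2 := hper.sub_zsmul_eq (x := y) ⌊r * y⌋
    rw [← h2]
    congr 1
    rw [← Int.self_sub_floor, zsmul_eq_mul]
    field_simp
  change |f y| ≤ _
  rw [h1]
  set z := Int.fract (r * y) with hz
  have hz0 : 0 ≤ z := Int.fract_nonneg _
  have hz1 : z < 1 := Int.fract_lt_one _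
  have hfr : ∀ t ∈ Finset.range r, Int.fract (z / r + t / r) = z / r + t / r := by
    intro t ht
    rw [Int.fract_eq_self, ← add_div]
    have : (t : ℝ) + 1 ≤ r := by exact_mod_cast Finset.mem_range.mp ht
    refine ⟨by positivity, ?_⟩
    rw [div_lt_one hr']
    linarith
  have hg : (∑ t ∈ Finset.range r, (t : ℝ)) = r * (r - 1) / 2 := by
    have := Finset.sum_range_id_mul_two r
    have h2 : ((∑ t ∈ Finset.range r, t : ℕ) : ℝ) * 2 = r * ((r - 1 : ℕ) : ℝ) := by
      exact_mod_cast this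
    rw [Nat.cast_sub (by omega)] at h2
    push_cast at h2
    linarith
  rcases hz0.eq_or_lt with h0 | h0
  · rw [← h0] at hfr ⊢
    have : f (0 / r) = (∑ t ∈ Finset.range r, ((t : ℝ) / r - 1 / 2)) + 1 / 2 := by
      obtain ⟨s, rfl⟩ : ∃ s, r = s + 1 := ⟨r - 1, by omega⟩
      simp only [hf]
      rw [Finset.sum_range_succ', Finset.sum_range_succ']
      simp only [zero_div, Nat.cast_zero, add_zero, saw_zero, zero_add, zero_sub]
      have : ∀ t ∈ Finset.range s, saw (((t + 1 : ℕ) : ℝ) / (s + 1 : ℕ)) =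
          ((t + 1 : ℕ) : ℝ) / (s + 1 : ℕ) - 1 / 2 := by
        intro t ht
        have h3 := hfr (t + 1) (Finset.mem_range.mpr (by have := Finset.mem_range.mp ht; omega))
        rw [zero_div, zero_add] at h3
        rw [saw, h3, if_neg (by positivity)]
      rw [Finset.sum_congr rfl this]
      ring
    rw [this, Finset.sum_sub_distrib, ← Finset.sum_div, hg]
    simp only [Finset.sum_const, Finset.card_range, nsmul_eq_mul]
    rw [show (r : ℝ) * (r - 1) / 2 / r - r * (1 / 2) + 1 / 2 = 0 by field_simp; ring]
    norm_num
  · have : f (z / r) = ∑ t ∈ Finset.range r, (z / r + t / r - 1 / 2) := by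
      refine Finset.sum_congr rfl fun t ht => ?_
      rw [saw, hfr t ht, if_neg (by positivity)]
    rw [this, Finset.sum_sub_distrib, Finset.sum_add_distrib,
      ← Finset.sum_div _ (fun t : ℕ => (t : ℝ)), hg]
    simp only [Finset.sum_const, Finset.card_range, nsmul_eq_mul]
    rw [show (r : ℝ) * (z / r) + (r : ℝ) * (r - 1) / 2 / r - r * (1 / 2) = z - 1 / 2 by
      field_simp; ring]
    rw [abs_le]
    constructor <;> linarith

lemma abs_sum_saw_add_mul_div_le {r s : ℕ} (hr : 0 < r) (hrs : s.Coprime r) (y : ℝ) :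
    |∑ t ∈ Finset.range r, saw (y + (t * s : ℕ) / r)| ≤ 1 / 2 := by
  have : NeZero r := ⟨hr.ne'⟩
  have hr' : (0 : ℝ) < r := by exact_mod_cast hr
  set F : ZMod r → ℝ := fun c => saw (y + (c.val : ℝ) / r) with hF
  have h1 : ∀ m : ℕ, saw (y + (m : ℝ) / r) = F (m : ZMod r) := by
    intro m
    rw [hF]
    simp only [ZMod.val_natCast]
    conv_lhs => rw [← Nat.mod_add_div m r]
    rw [← saw_add_nat (y + ((m % r : ℕ) : ℝ) / r) (m / r)]
    congr 1
    push_cast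
    field_simp
    ring
  have h2 : ∀ G : ZMod r → ℝ, ∑ t ∈ Finset.range r, G (t : ZMod r) = ∑ c, G c := by
    intro G
    refine Finset.sum_bij (fun t _ => (t : ZMod r)) (fun _ _ => Finset.mem_univ _) ?_ ?_ ?_
    · intro a ha b hb hab
      have := (ZMod.natCast_eq_natCast_iff' a b r).mp hab
      rwa [Nat.mod_eq_of_lt (Finset.mem_range.mp ha), Nat.mod_eq_of_lt (Finset.mem_range.mp hb)]
        at this
    · intro c _
      exact ⟨c.val, Finset.mem_range.mpr (ZMod.val_lt c), ZMod.natCast_zmod_val c⟩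
    · intro _ _; rfl
  have h3 := abs_sum_saw_add_div_le hr y
  simp only [h1] at h3 ⊢
  rw [h2 F] at h3
  rw [show ∑ t ∈ Finset.range r, F ((t * s : ℕ) : ZMod r) = ∑ c, F c from ?_]
  · exact h3
  have h4 := h2 (fun c => F (c * s))
  push_cast
  rw [h4]
  exact Fintype.sum_equiv (Units.mulRight (ZMod.unitOfCoprime s hrs)) _ _ fun c => by simp

/-- The mean of a function over `[0, P]`. -/
noncomputable def periodMean (P : ℕ) (F : ℝ → ℝ) : ℝ := (1 / (P : ℝ)) * ∫ x in (0 : ℝ)..P, F x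

lemma periodMean_mul {P : ℕ} {F : ℝ → ℝ} (hF : Function.Periodic F P)
    (hii : ∀ a b, IntervalIntegrable F volume a b) {k : ℕ} (hk : 0 < k) :
    periodMean (k * P) F = periodMean P F := by
  have h := hF.intervalIntegral_add_zsmul_eq k 0 hii
  have hk' : (0 : ℝ) < k := by exact_mod_cast hk
  simp only [zero_add, zsmul_eq_mul, Int.cast_natCast] at h
  rw [periodMean, periodMean, Nat.cast_mul, h]
  rcases eq_or_ne (P : ℝ) 0 with h0 | h0
  · simp [h0]
  · field_simp

lemma periodMean_eq {P Q : ℕ} {F : ℝ → ℝ} (hP : Function.Periodic F P)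
    (hQ : Function.Periodic F Q) (hP0 : 0 < P) (hQ0 : 0 < Q)
    (hii : ∀ a b, IntervalIntegrable F volume a b) : periodMean P F = periodMean Q F := by
  rw [← periodMean_mul hP hii hQ0, mul_comm, periodMean_mul hQ hii hP0]

lemma intervalIntegrable_of_bounded {F : ℝ → ℝ} (hF : Measurable F) {c : ℝ} (hc : ∀ x, |F x| ≤ c)
    (a b : ℝ) : IntervalIntegrable F volume a b := by
  rw [intervalIntegrable_iff]
  exact Measure.integrableOn_of_bounded (M := c) (by simp) hF.aestronglyMeasurable
    (Filter.Eventually.of_forall hc)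

lemma periodic_saw_div {n P : ℕ} (h : n ∣ P) : Function.Periodic (fun x => saw (x / n)) P := by
  intro x
  obtain ⟨m, rfl⟩ := h
  rcases Nat.eq_zero_or_pos n with rfl | hn
  · simp
  have hn' : (n : ℝ) ≠ 0 := by exact_mod_cast hn.ne'
  simp only
  rw [← saw_add_nat (x / n) m]
  congr 1
  push_cast
  field_simp

lemma measurable_saw_div (n : ℕ) : Measurable fun x : ℝ => saw (x / n) :=
  measurable_saw.comp (measurable_id.div_const _)

lemma abs_prod_saw_le {ι : Type*} (s : Finset ι) (y : ι → ℝ) : |∏ j ∈ s, saw (y j)| ≤ 1 := by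
  rw [Finset.abs_prod]
  exact Finset.prod_le_one (fun _ _ => abs_nonneg _) fun _ _ => abs_saw_le_one _

lemma measurable_prod_saw {ι : Type*} (s : Finset ι) (n : ι → ℕ) :
    Measurable fun x : ℝ => ∏ j ∈ s, saw (x / n j) :=
  Finset.measurable_prod _ fun _ _ => measurable_saw_div _

lemma periodic_prod_saw {ι : Type*} (s : Finset ι) (n : ι → ℕ) {P : ℕ} (h : ∀ j ∈ s, n j ∣ P) :
    Function.Periodic (fun x => ∏ j ∈ s, saw (x / n j)) P := fun x =>
  Finset.prod_congr rfl fun j hj => periodic_saw_div (h j hj) x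

lemma Bcorr_eq_periodMean {l : ℕ} {n : Fin l → ℕ} (hn : ∀ j, 0 < n j) {P : ℕ} (hP : 0 < P)
    (h : ∀ j, n j ∣ P) : Bcorr n = periodMean P fun x => ∏ j, saw (x / n j) := by
  have h1 : Bcorr n = periodMean (∏ j, n j) fun x => ∏ j, saw (x / n j) := by
    rw [Bcorr, periodMean]
    push_cast
    rfl
  rw [h1]
  exact periodMean_eq (periodic_prod_saw _ _ fun j hj => Finset.dvd_prod_of_mem n hj)
    (periodic_prod_saw _ _ fun j _ => h j) (Finset.prod_pos fun j _ => hn j) hP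
    (intervalIntegrable_of_bounded (measurable_prod_saw _ _) fun x => abs_prod_saw_le _ _)

lemma abs_Bcorr_le {l : ℕ} {n : Fin l → ℕ} (hn : ∀ j, 0 < n j) (i : Fin l) {P : ℕ} (hP : 0 < P)
    (h : ∀ j, j ≠ i → n j ∣ P) : |Bcorr n| ≤ (Nat.gcd (n i) P : ℝ) / n i := by
  set g := Nat.gcd (n i) P with hg
  have hg0 : 0 < g := Nat.gcd_pos_of_pos_left _ (hn i)
  obtain ⟨r, s, hcop, hr, hs⟩ := Nat.exists_coprime (n i) P
  rw [← hg] at hr hs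
  have hr0 : 0 < r := Nat.pos_of_mul_pos_right (hr ▸ hn i)
  have hs0 : 0 < s := Nat.pos_of_mul_pos_right (hs ▸ hP)
  have hr' : (0 : ℝ) < r := by exact_mod_cast hr0
  have hg' : (0 : ℝ) < g := by exact_mod_cast hg0
  have hP' : (0 : ℝ) < P := by exact_mod_cast hP
  have hdvd : ∀ j, n j ∣ r * P := by
    intro j
    rcases eq_or_ne j i with rfl | hj
    · exact ⟨s, by linear_combination r * hs - s * hr⟩
    · exact Dvd.dvd.mul_left (h j hj) r
  set G : ℝ → ℝ := fun x => ∏ j ∈ Finset.univ.erase i, saw (x / n j) with hG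
  have hGper : Function.Periodic G P :=
    periodic_prod_saw _ _ fun j hj => h j (Finset.ne_of_mem_erase hj)
  have hFG : ∀ x : ℝ, ∏ j, saw (x / n j) = saw (x / n i) * G x := fun x =>
    (Finset.mul_prod_erase Finset.univ (fun j => saw (x / n j)) (Finset.mem_univ i)).symm
  have hii : ∀ a b, IntervalIntegrable (fun x : ℝ => ∏ j, saw (x / n j)) volume a b :=
    intervalIntegrable_of_bounded (measurable_prod_saw _ _) fun x => abs_prod_saw_le _ _
  rw [Bcorr_eq_periodMean hn (Nat.mul_pos hr0 hP) hdvd, periodMean]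
  have h1 : ∫ x in (0 : ℝ)..((r * P : ℕ) : ℝ), ∏ j, saw (x / n j) =
      ∑ t ∈ Finset.range r, ∫ x in (0 : ℝ)..P, saw (x / n i + (t * s : ℕ) / r) * G x := by
    have h2 := intervalIntegral.sum_integral_adjacent_intervals
      (a := fun t : ℕ => (t : ℝ) * P) (n := r) (f := fun x : ℝ => ∏ j, saw (x / n j))
      (μ := volume) fun k _ => hii _ _
    simp only [Nat.cast_zero, zero_mul] at h2
    rw [Nat.cast_mul, ← h2]
    refine Finset.sum_congr rfl fun t _ => ?_
    have h3 := intervalIntegral.integral_comp_add_right (a := 0) (b := (P : ℝ))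
      (fun x : ℝ => ∏ j, saw (x / n j)) ((t : ℝ) * P)
    rw [zero_add, show (P : ℝ) + t * P = ((t + 1 : ℕ) : ℝ) * P by push_cast; ring] at h3
    rw [← h3]
    refine intervalIntegral.integral_congr fun x _ => ?_
    rw [hFG, hGper.nat_mul t x]
    congr 2
    rw [show (n i : ℝ) = r * g by exact_mod_cast hr, show (P : ℝ) = s * g by exact_mod_cast hs]
    push_cast
    field_simp
  have hGm : Measurable G := measurable_prod_saw _ _
  have hGb : ∀ x, |G x| ≤ 1 := fun x => abs_prod_saw_le _ _
  rw [h1, ← intervalIntegral.integral_finsetSum]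
  swap
  · intro t _
    refine intervalIntegrable_of_bounded (c := 1) ?_ ?_ _ _
    · exact (measurable_saw.comp ((measurable_id.div_const _).add_const _)).mul hGm
    · intro x
      rw [abs_mul]
      exact mul_le_one₀ (abs_saw_le_one _) (abs_nonneg _) (hGb x)
  have h4 : |∫ x in (0 : ℝ)..P, ∑ t ∈ Finset.range r, saw (x / n i + (t * s : ℕ) / r) * G x| ≤
      1 * |(P : ℝ) - 0| := by
    rw [← Real.norm_eq_abs]
    refine intervalIntegral.norm_integral_le_of_norm_le_const fun x _ => ?_
    rw [← Finset.sum_mul, Real.norm_eq_abs, abs_mul]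
    exact mul_le_one₀ ((abs_sum_saw_add_mul_div_le hr0 hcop.symm _).trans (by norm_num))
      (abs_nonneg _) (hGb x)
  rw [abs_mul, abs_of_pos (by positivity : (0 : ℝ) < 1 / ((r * P : ℕ) : ℝ))]
  refine (mul_le_mul_of_nonneg_left h4 (by positivity)).trans (le_of_eq ?_)
  rw [show (n i : ℝ) = r * g by exact_mod_cast hr, sub_zero, abs_of_pos hP']
  push_cast
  field_simp

/-! ### Absolute convergence of the main term -/

/-- The majorant `∑_{uv = n} |a(u)|/v` of `|b(n)|`. -/
noncomputable def bAbs (n : ℕ) : ℝ := ∑ u ∈ n.divisors, |aCoef u| / ((n / u : ℕ) : ℝ)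

lemma bAbs_nonneg (n : ℕ) : 0 ≤ bAbs n := Finset.sum_nonneg fun _ _ => by positivity

/-- The least common multiple of a tuple. -/
def tupleLcm {l : ℕ} (n : Fin l → ℕ+) : ℕ := Finset.univ.lcm fun j => (n j : ℕ)

lemma dvd_tupleLcm {l : ℕ} (n : Fin l → ℕ+) (j : Fin l) : (n j : ℕ) ∣ tupleLcm n :=
  Finset.dvd_lcm (Finset.mem_univ j)

lemma tupleLcm_dvd_prod {l : ℕ} (n : Fin l → ℕ+) : tupleLcm n ∣ ∏ j, (n j : ℕ) :=
  Finset.lcm_dvd fun j _ => Finset.dvd_prod_of_mem (fun j => (n j : ℕ)) (Finset.mem_univ j)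

lemma tupleLcm_pos {l : ℕ} (n : Fin l → ℕ+) : 0 < tupleLcm n :=
  Nat.pos_of_dvd_of_pos (tupleLcm_dvd_prod n) (Finset.prod_pos fun j _ => (n j).pos)

lemma abs_Bcorr_div_prod_le {l : ℕ} (n : Fin l → ℕ+) (i : Fin l) :
    |Bcorr fun j => (n j : ℕ)| / ∏ j, ((n j : ℕ) : ℝ) ≤ 1 / (tupleLcm n * (n i : ℕ)) := by
  set P := ∏ j ∈ Finset.univ.erase i, (n j : ℕ) with hP
  have hP0 : 0 < P := Finset.prod_pos fun j _ => (n j).pos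
  have hB := abs_Bcorr_le (n := fun j => (n j : ℕ)) (fun j => (n j).pos) i hP0 fun j hj =>
    Finset.dvd_prod_of_mem (fun j => (n j : ℕ)) (Finset.mem_erase.mpr ⟨hj, Finset.mem_univ j⟩)
  have hprod : ∏ j, ((n j : ℕ) : ℝ) = (n i : ℕ) * (P : ℝ) := by
    rw [hP, Nat.cast_prod]
    exact (Finset.mul_prod_erase Finset.univ (fun j => ((n j : ℕ) : ℝ)) (Finset.mem_univ i)).symm
  have hL : tupleLcm n ∣ Nat.lcm (n i) P := Finset.lcm_dvd fun j _ => by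
    rcases eq_or_ne j i with rfl | hj
    · exact Nat.dvd_lcm_left _ _
    · exact (Finset.dvd_prod_of_mem (fun j => (n j : ℕ))
        (Finset.mem_erase.mpr ⟨hj, Finset.mem_univ j⟩)).trans (Nat.dvd_lcm_right _ _)
  have hL' : tupleLcm n ≤ Nat.lcm (n i) P :=
    Nat.le_of_dvd (Nat.lcm_pos (n i).pos hP0) hL
  have h1 : Nat.gcd (n i) P * tupleLcm n ≤ n i * P := by
    rw [← Nat.gcd_mul_lcm (n i : ℕ) P]
    exact Nat.mul_le_mul_left _ hL'
  have h2 : (Nat.gcd (n i) P : ℝ) * tupleLcm n ≤ (n i : ℕ) * P := by exact_mod_cast h1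
  have hL0 : (0 : ℝ) < tupleLcm n := by exact_mod_cast tupleLcm_pos n
  have hn0 : (0 : ℝ) < (n i : ℕ) := by exact_mod_cast (n i).pos
  have hP0' : (0 : ℝ) < P := by exact_mod_cast hP0
  rw [hprod, div_le_div_iff₀ (by positivity) (by positivity)]
  calc _ ≤ (Nat.gcd (n i) P : ℝ) / (n i : ℕ) * (tupleLcm n * (n i : ℕ)) := by gcongr
    _ = (Nat.gcd (n i) P : ℝ) * tupleLcm n := by field_simp
    _ ≤ _ := by linarith

lemma exists_rpow_tupleLcm_le {l : ℕ} (hl : 0 < l) (n : Fin l → ℕ+) :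
    ∃ i, (tupleLcm n : ℝ) ^ (1 / l : ℝ) ≤ (n i : ℕ) := by
  by_contra! h
  have hne : (Finset.univ : Finset (Fin l)).Nonempty := ⟨⟨0, hl⟩, Finset.mem_univ _⟩
  have h1 : ∏ j, ((n j : ℕ) : ℝ) < ∏ _j : Fin l, (tupleLcm n : ℝ) ^ (1 / l : ℝ) :=
    Finset.prod_lt_prod_of_nonempty (fun j _ => by exact_mod_cast (n j).pos)
      (fun j _ => h j) hne
  rw [Finset.prod_const, Finset.card_univ, Fintype.card_fin, ← Real.rpow_natCast,
    ← Real.rpow_mul (by positivity), one_div, inv_mul_cancel₀ (by positivity), Real.rpow_one] at h1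
  have h2 := Nat.le_of_dvd (Finset.prod_pos fun j _ => (n j).pos) (tupleLcm_dvd_prod n)
  have h3 : (tupleLcm n : ℝ) ≤ ∏ j, ((n j : ℕ) : ℝ) := by exact_mod_cast h2
  linarith

lemma summable_prod_bAbs_mul_abs_Bcorr {l : ℕ} (hl : 0 < l) :
    Summable fun n : Fin l → ℕ+ => (∏ j, bAbs (n j)) * |Bcorr fun j => (n j : ℕ)| := by
  have hl' : (0 : ℝ) < l := by exact_mod_cast hl
  set h : ℕ → ℝ := fun L => (L.divisors.card : ℝ) ^ (4 * l) / (L : ℝ) ^ (1 + 1 / l : ℝ) with hh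
  set S : ℕ → Finset (Fin l → ℕ+) :=
    fun L => Fintype.piFinset fun _ => L.divisors.image Nat.toPNat' with hS
  refine summable_of_fiber_subset (h := h) tupleLcm S (fun n => ?_) (fun L => by positivity)
    (fun n _ => ?_) (fun n => ?_) ?_
  · exact mul_nonneg (Finset.prod_nonneg fun j _ => bAbs_nonneg _) (abs_nonneg _)
  · rw [hS, Fintype.mem_piFinset]
    intro j
    refine Finset.mem_image.mpr ⟨n j, Nat.mem_divisors.mpr
      ⟨dvd_tupleLcm n j, (tupleLcm_pos n).ne'⟩, PNat.coe_toPNat' _⟩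
  · set L := tupleLcm n with hL
    have hL0 : 0 < L := tupleLcm_pos n
    have hL0' : (0 : ℝ) < L := by exact_mod_cast hL0
    have h1 : ∏ j, bAbs (n j) ≤ (L.divisors.card : ℝ) ^ (4 * l) / ∏ j, ((n j : ℕ) : ℝ) := by
      calc ∏ j, bAbs (n j) ≤ ∏ j : Fin l, ((L.divisors.card : ℝ) ^ 4 / ((n j : ℕ) : ℝ)) := by
            refine Finset.prod_le_prod (fun j _ => bAbs_nonneg _) fun j _ => ?_
            refine (sum_divisors_abs_aCoef_le (n j).pos.ne').trans ?_
            gcongr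
            exact dvd_tupleLcm n j
        _ = _ := by
            rw [Finset.prod_div_distrib, Finset.prod_const, Finset.card_univ, Fintype.card_fin,
              pow_mul]
    obtain ⟨i, hi⟩ := exists_rpow_tupleLcm_le hl n
    have hp0 : 0 < ∏ j, ((n j : ℕ) : ℝ) := Finset.prod_pos fun j _ => by exact_mod_cast (n j).pos
    calc _ ≤ (L.divisors.card : ℝ) ^ (4 * l) / (∏ j, ((n j : ℕ) : ℝ)) *
          |Bcorr fun j => (n j : ℕ)| := by gcongr
      _ = (L.divisors.card : ℝ) ^ (4 * l) * (|Bcorr fun j => (n j : ℕ)| /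
          ∏ j, ((n j : ℕ) : ℝ)) := by ring
      _ ≤ (L.divisors.card : ℝ) ^ (4 * l) * (1 / (L * (L : ℝ) ^ (1 / l : ℝ))) := by
          refine mul_le_mul_of_nonneg_left ((abs_Bcorr_div_prod_le n i).trans ?_) (by positivity)
          gcongr
      _ = h L := by
          rw [hh]
          simp only
          rw [Real.rpow_add hL0', Real.rpow_one]
          ring
  · refine Summable.of_nonneg_of_le (fun L => by positivity) (fun L => ?_)
      (summable_divisors_pow (5 * l) (s := 1 + 1 / l)
        (lt_add_of_pos_right _ (one_div_pos.mpr hl')))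
    have hc : ((S L).card : ℝ) ≤ (L.divisors.card : ℝ) ^ l := by
      rw [hS]
      simp only [Fintype.card_piFinset, Finset.prod_const, Finset.card_univ, Fintype.card_fin,
        Nat.cast_pow]
      gcongr
      exact Finset.card_image_le
    calc ((S L).card : ℝ) * h L ≤ (L.divisors.card : ℝ) ^ l * h L := by gcongr
      _ = _ := by
          rw [hh]
          simp only
          rw [show 5 * l = l + 4 * l by ring, pow_add, mul_div_assoc]

/-! ### Bounded measurable functions and their means -/

/-- Bounded measurable real functions. -/
def BddMeas (F : ℝ → ℝ) : Prop := Measurable F ∧ ∃ c, ∀ x, |F x| ≤ c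

namespace BddMeas

lemma intervalIntegrable {F : ℝ → ℝ} (hF : BddMeas F) (a b : ℝ) :
    IntervalIntegrable F volume a b := by
  obtain ⟨hm, c, hc⟩ := hF
  exact intervalIntegrable_of_bounded hm hc a b

lemma const (c : ℝ) : BddMeas fun _ => c := ⟨measurable_const, |c|, fun _ => le_rfl⟩

lemma add {F G : ℝ → ℝ} (hF : BddMeas F) (hG : BddMeas G) : BddMeas fun x => F x + G x := by
  obtain ⟨hF, c, hc⟩ := hF
  obtain ⟨hG, d, hd⟩ := hG
  exact ⟨hF.add hG, c + d, fun x => (abs_add_le _ _).trans (add_le_add (hc x) (hd x))⟩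

lemma mul {F G : ℝ → ℝ} (hF : BddMeas F) (hG : BddMeas G) : BddMeas fun x => F x * G x := by
  obtain ⟨hF, c, hc⟩ := hF
  obtain ⟨hG, d, hd⟩ := hG
  refine ⟨hF.mul hG, c * d, fun x => ?_⟩
  rw [abs_mul]
  exact mul_le_mul (hc x) (hd x) (abs_nonneg _) ((abs_nonneg _).trans (hc x))

lemma const_mul {F : ℝ → ℝ} (c : ℝ) (hF : BddMeas F) : BddMeas fun x => c * F x :=
  (const c).mul hF

lemma sub {F G : ℝ → ℝ} (hF : BddMeas F) (hG : BddMeas G) : BddMeas fun x => F x - G x := by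
  simpa [sub_eq_add_neg] using hF.add (hG.const_mul (-1))

lemma abs {F : ℝ → ℝ} (hF : BddMeas F) : BddMeas fun x => |F x| := by
  obtain ⟨hF, c, hc⟩ := hF
  exact ⟨hF.norm, c, fun x => by rw [abs_abs]; exact hc x⟩

lemma sum {ι : Type*} (s : Finset ι) {F : ι → ℝ → ℝ} (hF : ∀ i ∈ s, BddMeas (F i)) :
    BddMeas fun x => ∑ i ∈ s, F i x := by
  induction s using Finset.induction_on with
  | empty => simpa using const 0
  | insert i s hi ih =>
    simp only [Finset.sum_insert hi]
    exact (hF i (Finset.mem_insert_self _ _)).add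
      (ih fun j hj => hF j (Finset.mem_insert_of_mem hj))

lemma prod {ι : Type*} (s : Finset ι) {F : ι → ℝ → ℝ} (hF : ∀ i ∈ s, BddMeas (F i)) :
    BddMeas fun x => ∏ i ∈ s, F i x := by
  induction s using Finset.induction_on with
  | empty => simpa using const 1
  | insert i s hi ih =>
    simp only [Finset.prod_insert hi]
    exact (hF i (Finset.mem_insert_self _ _)).mul
      (ih fun j hj => hF j (Finset.mem_insert_of_mem hj))

lemma pow {F : ℝ → ℝ} (hF : BddMeas F) (l : ℕ) : BddMeas fun x => F x ^ l := by
  simpa using prod (Finset.univ : Finset (Fin l)) fun _ _ => hF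

lemma saw_div (n : ℕ) : BddMeas fun x => saw (x / n) :=
  ⟨measurable_saw_div n, 1, fun _ => abs_saw_le_one _⟩

end BddMeas

lemma periodMean_const_mul (P : ℕ) (c : ℝ) (F : ℝ → ℝ) :
    periodMean P (fun x => c * F x) = c * periodMean P F := by
  rw [periodMean, periodMean, intervalIntegral.integral_const_mul]
  ring

lemma periodMean_sum {ι : Type*} (P : ℕ) (s : Finset ι) {F : ι → ℝ → ℝ}
    (hF : ∀ i ∈ s, BddMeas (F i)) :
    periodMean P (fun x => ∑ i ∈ s, F i x) = ∑ i ∈ s, periodMean P (F i) := by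
  simp only [periodMean]
  rw [intervalIntegral.integral_finsetSum fun i hi => (hF i hi).intervalIntegrable _ _,
    Finset.mul_sum]

lemma periodMean_sub (P : ℕ) {F G : ℝ → ℝ} (hF : BddMeas F) (hG : BddMeas G) :
    periodMean P (fun x => F x - G x) = periodMean P F - periodMean P G := by
  simp only [periodMean]
  rw [intervalIntegral.integral_sub (hF.intervalIntegrable _ _) (hG.intervalIntegrable _ _)]
  ring

lemma periodMean_mono (P : ℕ) {F G : ℝ → ℝ} (hF : BddMeas F) (hG : BddMeas G)
    (h : ∀ x, F x ≤ G x) : periodMean P F ≤ periodMean P G := by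
  refine mul_le_mul_of_nonneg_left ?_ (by positivity)
  exact intervalIntegral.integral_mono_on (by positivity) (hF.intervalIntegrable _ _)
    (hG.intervalIntegrable _ _) fun x _ => h x

lemma periodMean_const {P : ℕ} (hP : 0 < P) (c : ℝ) : periodMean P (fun _ => c) = c := by
  have : (P : ℝ) ≠ 0 := by exact_mod_cast hP.ne'
  rw [periodMean, intervalIntegral.integral_const]
  simp only [sub_zero, smul_eq_mul]
  field_simp

lemma abs_periodMean_le (P : ℕ) {F : ℝ → ℝ} :
    |periodMean P F| ≤ periodMean P fun x => |F x| := by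
  rw [periodMean, abs_mul, abs_of_nonneg (by positivity)]
  refine mul_le_mul_of_nonneg_left ?_ (by positivity)
  exact intervalIntegral.abs_integral_le_integral_abs (by positivity)

/-- A form of the Cauchy–Schwarz inequality for means. -/
lemma periodMean_abs_le {P : ℕ} (hP : 0 < P) {F : ℝ → ℝ} (hF : BddMeas F) {δ : ℝ} (hδ : 0 < δ)
    (h : periodMean P (fun x => F x * F x) ≤ δ ^ 2) : periodMean P (fun x => |F x|) ≤ δ := by
  have h1 : periodMean P (fun x => |F x|) ≤
      periodMean P (fun x => δ / 2 - (-(1 / (2 * δ))) * (F x * F x)) := by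
    refine periodMean_mono P hF.abs ((BddMeas.const _).sub ((hF.mul hF).const_mul _)) fun x => ?_
    have : δ / 2 - -(1 / (2 * δ)) * (F x * F x) = (δ ^ 2 + |F x| ^ 2) / (2 * δ) := by
      rw [sq_abs]; field_simp; ring
    rw [this, le_div_iff₀ (by positivity)]
    nlinarith [sq_nonneg (δ - |F x|)]
  rw [periodMean_sub P (BddMeas.const _) ((hF.mul hF).const_mul _), periodMean_const_mul,
    periodMean_const hP] at h1
  have h2 : 1 / (2 * δ) * periodMean P (fun x => F x * F x) ≤ 1 / (2 * δ) * δ ^ 2 := by gcongr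
  have h3 : 1 / (2 * δ) * δ ^ 2 = δ / 2 := by field_simp
  linarith

/-! ### Truncated moments -/

/-- The coefficient `b(n)` restricted to `n = uv` with `u, v ≤ T`. -/
noncomputable def bTrunc (T n : ℕ) : ℝ :=
  ∑ u ∈ n.divisors with (u ≤ T ∧ n / u ≤ T), aCoef u / ((n / u : ℕ) : ℝ)

lemma sum_divisors_trunc {M : Type*} [AddCommMonoid M] (T : ℕ) (H : ℕ → ℕ → M) :
    ∑ n ∈ Finset.Icc 1 (T ^ 2), ∑ u ∈ n.divisors with (u ≤ T ∧ n / u ≤ T), H u (n / u) =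
      ∑ u ∈ Finset.Icc 1 T, ∑ v ∈ Finset.Icc 1 T, H u v := by
  rw [Finset.sum_sigma', Finset.sum_sigma']
  refine Finset.sum_bij' (fun p _ => ⟨p.2, p.1 / p.2⟩) (fun p _ => ⟨p.1 * p.2, p.1⟩) ?_ ?_ ?_ ?_ ?_
  · rintro ⟨n, u⟩ h
    simp only [Finset.mem_sigma, Finset.mem_Icc, Finset.mem_filter, Nat.mem_divisors] at h ⊢
    have hu : 0 < u := Nat.pos_of_dvd_of_pos h.2.1.1 (by omega)
    exact ⟨⟨hu, h.2.2.1⟩, Nat.div_pos (Nat.le_of_dvd (by omega) h.2.1.1) hu, h.2.2.2⟩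
  · rintro ⟨u, v⟩ h
    simp only [Finset.mem_sigma, Finset.mem_Icc, Finset.mem_filter, Nat.mem_divisors] at h ⊢
    obtain ⟨⟨hu, huT⟩, hv, hvT⟩ := h
    refine ⟨⟨Nat.mul_pos hu hv, by rw [sq]; exact Nat.mul_le_mul huT hvT⟩,
      ⟨Dvd.intro _ rfl, (Nat.mul_pos hu hv).ne'⟩, huT, ?_⟩
    rwa [Nat.mul_div_cancel_left _ hu]
  · rintro ⟨n, u⟩ h
    simp only [Finset.mem_sigma, Finset.mem_filter, Nat.mem_divisors] at h
    simp [Nat.mul_div_cancel' h.2.1.1]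
  · rintro ⟨u, v⟩ h
    simp only [Finset.mem_sigma, Finset.mem_Icc] at h
    simp [Nat.mul_div_cancel_left v h.1.1]
  · rintro ⟨n, u⟩ h
    rfl

lemma sum_bTrunc_mul (T : ℕ) (G : ℕ → ℝ) :
    ∑ n ∈ Finset.Icc 1 (T ^ 2), bTrunc T n * G n =
      ∑ u ∈ Finset.Icc 1 T, aCoef u * ∑ v ∈ Finset.Icc 1 T, G (u * v) / v := by
  have h := sum_divisors_trunc T fun u v => aCoef u * (G (u * v) / v)
  simp only [← Finset.mul_sum] at h
  rw [← h]
  refine Finset.sum_congr rfl fun n _ => ?_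
  rw [bTrunc, Finset.sum_mul]
  refine Finset.sum_congr rfl fun u hu => ?_
  rw [Nat.mul_div_cancel' (Nat.dvd_of_mem_divisors (Finset.mem_of_mem_filter u hu))]
  ring

lemma abs_bTrunc_le (T n : ℕ) : |bTrunc T n| ≤ bAbs n := by
  refine (Finset.abs_sum_le_sum_abs _ _).trans ?_
  refine (Finset.sum_le_sum_of_subset_of_nonneg (Finset.filter_subset _ _)
    fun _ _ _ => abs_nonneg _).trans (le_of_eq ?_)
  refine Finset.sum_congr rfl fun u _ => ?_
  rw [abs_div, Nat.abs_cast]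

lemma bTrunc_eq_bCoef {T n : ℕ} (h : n ≤ T) : bTrunc T n = bCoef n := by
  rw [bTrunc, bCoef, Finset.filter_true_of_mem]
  intro u hu
  exact ⟨(Nat.divisor_le hu).trans h, (Nat.div_le_self _ _).trans h⟩

lemma bTrunc_eq_zero {T n : ℕ} (h : T ^ 2 < n) : bTrunc T n = 0 := by
  rw [bTrunc, Finset.filter_false_of_mem, Finset.sum_empty]
  rintro u hu ⟨h1, h2⟩
  have := Nat.mul_le_mul h1 h2
  rw [Nat.mul_div_cancel' (Nat.dvd_of_mem_divisors hu), ← sq] at this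
  omega

/-- The truncated function `∑_{u, v ≤ T} a(u) ψ(x/(uv))/v`. -/
noncomputable def truncFun (T : ℕ) (x : ℝ) : ℝ :=
  ∑ u ∈ Finset.Icc 1 T, aCoef u * ∑ v ∈ Finset.Icc 1 T, saw (x / (u * v : ℕ)) / v

/-- The moment of `truncFun`. -/
noncomputable def truncMoment (l T : ℕ) : ℝ :=
  ∑ n ∈ Fintype.piFinset fun _ : Fin l => Finset.Icc 1 (T ^ 2), (∏ j, bTrunc T (n j)) * Bcorr n

lemma pow_sum_bTrunc_mul (l T : ℕ) (G : ℕ → ℝ) :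
    (∑ u ∈ Finset.Icc 1 T, aCoef u * ∑ v ∈ Finset.Icc 1 T, G (u * v) / v) ^ l =
      ∑ n ∈ Fintype.piFinset fun _ : Fin l => Finset.Icc 1 (T ^ 2),
        (∏ j, bTrunc T (n j)) * ∏ j, G (n j) := by
  rw [← sum_bTrunc_mul]
  have := Finset.prod_univ_sum (fun _ : Fin l => Finset.Icc 1 (T ^ 2))
    fun _ n => bTrunc T n * G n
  rw [Finset.prod_const, Finset.card_univ, Fintype.card_fin] at this
  rw [this]
  exact Finset.sum_congr rfl fun n _ => Finset.prod_mul_distrib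

lemma truncMoment_eq {l T P : ℕ} (hP : 0 < P) (h : ∀ n ∈ Finset.Icc 1 (T ^ 2), n ∣ P) :
    truncMoment l T = periodMean P fun x => truncFun T x ^ l := by
  have h1 : (fun x => truncFun T x ^ l) = fun x =>
      ∑ n ∈ Fintype.piFinset fun _ : Fin l => Finset.Icc 1 (T ^ 2),
        (∏ j, bTrunc T (n j)) * ∏ j, saw (x / n j) := by
    funext x
    exact pow_sum_bTrunc_mul l T fun n => saw (x / n)
  rw [h1, periodMean_sum, truncMoment]
  · refine Finset.sum_congr rfl fun n hn => ?_
    rw [Fintype.mem_piFinset] at hn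
    rw [periodMean_const_mul, Bcorr_eq_periodMean (fun j => (Finset.mem_Icc.mp (hn j)).1) hP
      fun j => h _ (hn j)]
  · intro n _
    exact (BddMeas.prod _ fun j _ => BddMeas.saw_div _).const_mul _

lemma bddMeas_truncFun (T : ℕ) : BddMeas (truncFun T) := by
  unfold truncFun
  refine BddMeas.sum _ fun u _ => (BddMeas.sum _ fun v _ => ?_).const_mul _
  simpa [div_eq_inv_mul] using (BddMeas.saw_div (u * v)).const_mul (v : ℝ)⁻¹

lemma sum_Icc_inv_le (T : ℕ) : ∑ v ∈ Finset.Icc 1 T, (1 : ℝ) / v ≤ 1 + Real.log T := by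
  have := harmonic_le_one_add_log T
  rw [harmonic_eq_sum_Icc] at this
  simpa using this

lemma abs_sum_saw_div_le (s : Finset ℕ) (T : ℕ) (hs : s ⊆ Finset.Icc 1 T) (y : ℕ → ℝ) :
    |∑ v ∈ s, saw (y v) / v| ≤ 1 + Real.log T := by
  refine (Finset.abs_sum_le_sum_abs _ _).trans (le_trans ?_ (sum_Icc_inv_le T))
  refine (Finset.sum_le_sum_of_subset_of_nonneg hs fun _ _ _ => abs_nonneg _).trans ?_
  refine Finset.sum_le_sum fun v _ => ?_
  rw [abs_div, Nat.abs_cast]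
  gcongr
  exact abs_saw_le_one _

lemma abs_truncFun_le (T : ℕ) (x : ℝ) : |truncFun T x| ≤ aNorm * (1 + Real.log T) := by
  refine (Finset.abs_sum_le_sum_abs _ _).trans ?_
  refine le_trans ?_ (mul_le_mul_of_nonneg_right (sum_abs_aCoef_le (Finset.Icc 1 T))
    (by have := Real.log_natCast_nonneg T; linarith))
  rw [Finset.sum_mul]
  refine Finset.sum_le_sum fun u _ => ?_
  rw [abs_mul]
  exact mul_le_mul_of_nonneg_left (abs_sum_saw_div_le _ T subset_rfl _) (abs_nonneg _)

/-! ### Comparison of truncations -/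

lemma sum_gcd_div_le {v : ℕ} (hv : v ≠ 0) (T : ℕ) :
    ∑ w ∈ Finset.Icc 1 T, (Nat.gcd v w : ℝ) / w ≤ v.divisors.card * (1 + Real.log T) := by
  have hmap : ∀ w ∈ Finset.Icc 1 T, Nat.gcd v w ∈ v.divisors := fun w _ =>
    Nat.mem_divisors.mpr ⟨Nat.gcd_dvd_left _ _, hv⟩
  rw [← Finset.sum_fiberwise_of_maps_to hmap, ← nsmul_eq_mul]
  refine Finset.sum_le_card_nsmul _ _ _ fun d hd => le_trans ?_ (sum_Icc_inv_le T)
  have hd0 : 0 < d := Nat.pos_of_mem_divisors hd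
  have hdvd : ∀ w ∈ (Finset.Icc 1 T).filter (fun w => Nat.gcd v w = d), d ∣ w := fun w hw =>
    (Finset.mem_filter.mp hw).2 ▸ Nat.gcd_dvd_right _ _
  calc _ = ∑ w ∈ Finset.Icc 1 T with Nat.gcd v w = d, (1 : ℝ) / ((w / d : ℕ) : ℝ) := by
        refine Finset.sum_congr rfl fun w hw => ?_
        rw [(Finset.mem_filter.mp hw).2, Nat.cast_div (hdvd w hw) (by exact_mod_cast hd0.ne'),
          one_div_div]
    _ = ∑ m ∈ ((Finset.Icc 1 T).filter (fun w => Nat.gcd v w = d)).image (fun w => w / d),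
          (1 : ℝ) / m := by
        rw [Finset.sum_image]
        intro a ha b hb hab
        have h1 := Nat.div_mul_cancel (hdvd a ha)
        have h2 := Nat.div_mul_cancel (hdvd b hb)
        simp only at hab
        rw [← h1, ← h2, hab]
    _ ≤ _ := by
        refine Finset.sum_le_sum_of_subset_of_nonneg ?_ fun _ _ _ => by positivity
        intro m hm
        obtain ⟨w, hw, rfl⟩ := Finset.mem_image.mp hm
        have h1 := Finset.mem_Icc.mp (Finset.mem_filter.mp hw).1
        exact Finset.mem_Icc.mpr ⟨Nat.div_pos (Nat.le_of_dvd h1.1 (hdvd w hw)) hd0,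
          (Nat.div_le_self _ _).trans h1.2⟩

/-- The constant `∑ d(v) v^{-3/2}`. -/
noncomputable def divisorConst : ℝ := ∑' v : ℕ, (v.divisors.card : ℝ) / (v : ℝ) ^ (3 / 2 : ℝ)

lemma divisorConst_nonneg : 0 ≤ divisorConst := tsum_nonneg fun _ => by positivity

lemma sum_card_divisors_div_sq_le (s : Finset ℕ) {T : ℕ} (hT : 0 < T) (hs : ∀ v ∈ s, T ≤ v) :
    ∑ v ∈ s, (v.divisors.card : ℝ) / (v : ℝ) ^ 2 ≤ divisorConst * (T : ℝ) ^ (-(1 / 2) : ℝ) := by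
  have hsum : Summable fun v : ℕ => (v.divisors.card : ℝ) / (v : ℝ) ^ (3 / 2 : ℝ) := by
    simpa using summable_divisors_pow 1 (s := 3 / 2) (by norm_num)
  have hT' : (0 : ℝ) < T := by exact_mod_cast hT
  refine le_trans ?_ (mul_le_mul_of_nonneg_right (hsum.sum_le_tsum s fun _ _ => by positivity)
    (by positivity))
  rw [Finset.sum_mul]
  refine Finset.sum_le_sum fun v hv => ?_
  have hv' : (T : ℝ) ≤ v := by exact_mod_cast hs v hv
  have hv0 : (0 : ℝ) < v := hT'.trans_le hv'
  have h1 : (v : ℝ) ^ 2 = (v : ℝ) ^ (3 / 2 : ℝ) * (v : ℝ) ^ (1 / 2 : ℝ) := by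
    rw [← Real.rpow_add hv0, ← Real.rpow_natCast]
    norm_num
  rw [h1, ← div_div, div_eq_mul_inv _ ((v : ℝ) ^ (1 / 2 : ℝ)), ← Real.rpow_neg hv0.le]
  refine mul_le_mul_of_nonneg_left ?_ (by positivity)
  exact Real.rpow_le_rpow_of_nonpos hT' hv' (by norm_num)

lemma abs_periodMean_saw_mul_saw_le {m n P : ℕ} (hm : 0 < m) (hn : 0 < n) (hP : 0 < P)
    (hmP : m ∣ P) (hnP : n ∣ P) :
    |periodMean P fun x => saw (x / m) * saw (x / n)| ≤ (Nat.gcd m n : ℝ) / m := by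
  have h0 : ∀ j : Fin 2, 0 < (![m, n] : Fin 2 → ℕ) j := by
    intro j; fin_cases j <;> simpa
  have h1 := Bcorr_eq_periodMean h0 hP (by intro j; fin_cases j <;> simpa)
  have h2 := abs_Bcorr_le h0 0 hn (by intro j hj; fin_cases j <;> simp_all)
  rw [h1] at h2
  simpa using h2

lemma periodMean_sq_le {u T T' P : ℕ} (hu : 0 < u) (hT : 0 < T) (hP : 0 < P)
    (h : ∀ v ∈ Finset.Ioc T T', u * v ∣ P) :
    periodMean P (fun x => (∑ v ∈ Finset.Ioc T T', saw (x / (u * v : ℕ)) / v) *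
      ∑ v ∈ Finset.Ioc T T', saw (x / (u * v : ℕ)) / v) ≤
      divisorConst * (1 + Real.log T') * (T : ℝ) ^ (-(1 / 2) : ℝ) := by
  have hlog := Real.log_natCast_nonneg T'
  have h1 : (fun x : ℝ => (∑ v ∈ Finset.Ioc T T', saw (x / (u * v : ℕ)) / v) *
      ∑ v ∈ Finset.Ioc T T', saw (x / (u * v : ℕ)) / v) = fun x =>
      ∑ v ∈ Finset.Ioc T T', ∑ w ∈ Finset.Ioc T T',
        (1 / (v * w : ℝ)) * (saw (x / (u * v : ℕ)) * saw (x / (u * w : ℕ))) := by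
    funext x
    rw [Finset.sum_mul_sum]
    refine Finset.sum_congr rfl fun v _ => Finset.sum_congr rfl fun w _ => ?_
    ring
  have hb : ∀ v w : ℕ, BddMeas fun x =>
      (1 / (v * w : ℝ)) * (saw (x / (u * v : ℕ)) * saw (x / (u * w : ℕ))) := fun v w =>
    ((BddMeas.saw_div _).mul (BddMeas.saw_div _)).const_mul _
  rw [h1, periodMean_sum _ _ fun v _ => BddMeas.sum _ fun w _ => hb v w]
  calc _ ≤ ∑ v ∈ Finset.Ioc T T', ((v.divisors.card : ℝ) / (v : ℝ) ^ 2) * (1 + Real.log T') := by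
        refine Finset.sum_le_sum fun v hv => ?_
        rw [periodMean_sum _ _ fun w _ => hb v w]
        have hv0 : 0 < v := hT.trans (Finset.mem_Ioc.mp hv).1
        have hv0' : (0 : ℝ) < v := by exact_mod_cast hv0
        calc _ ≤ ∑ w ∈ Finset.Ioc T T', 1 / (v : ℝ) ^ 2 * ((Nat.gcd v w : ℝ) / w) := by
              refine Finset.sum_le_sum fun w hw => ?_
              have hw0 : 0 < w := hT.trans (Finset.mem_Ioc.mp hw).1
              have hw0' : (0 : ℝ) < w := by exact_mod_cast hw0
              have hu0' : (0 : ℝ) < u := by exact_mod_cast hu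
              rw [periodMean_const_mul]
              have h3 := abs_periodMean_saw_mul_saw_le (Nat.mul_pos hu hv0) (Nat.mul_pos hu hw0) hP
                (h v hv) (h w hw)
              rw [Nat.gcd_mul_left] at h3
              refine (mul_le_mul_of_nonneg_left ((le_abs_self _).trans h3)
                (by positivity)).trans (le_of_eq ?_)
              push_cast
              field_simp
          _ ≤ 1 / (v : ℝ) ^ 2 * ∑ w ∈ Finset.Icc 1 T', (Nat.gcd v w : ℝ) / w := by
              rw [← Finset.mul_sum]
              gcongr
              intro w hw
              have := Finset.mem_Ioc.mp hw
              exact Finset.mem_Icc.mpr ⟨by omega, this.2⟩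
          _ ≤ 1 / (v : ℝ) ^ 2 * (v.divisors.card * (1 + Real.log T')) := by
              gcongr
              exact sum_gcd_div_le hv0.ne' T'
          _ = _ := by ring
    _ ≤ (divisorConst * (T : ℝ) ^ (-(1 / 2) : ℝ)) * (1 + Real.log T') := by
        rw [← Finset.sum_mul]
        refine mul_le_mul_of_nonneg_right ?_ (by linarith)
        exact sum_card_divisors_div_sq_le _ hT fun v hv => (Finset.mem_Ioc.mp hv).1.le
    _ = _ := by ring

lemma sum_Icc_one_eq_add {T T' : ℕ} (h : T ≤ T') (f : ℕ → ℝ) :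
    ∑ n ∈ Finset.Icc 1 T', f n = ∑ n ∈ Finset.Icc 1 T, f n + ∑ n ∈ Finset.Ioc T T', f n := by
  rw [← Finset.sum_union]
  · congr 1
    ext n
    simp only [Finset.mem_union, Finset.mem_Icc, Finset.mem_Ioc]
    omega
  · rw [Finset.disjoint_left]
    intro n
    simp only [Finset.mem_Icc, Finset.mem_Ioc]
    omega

lemma periodMean_abs_truncFun_sub_le {T T' P : ℕ} (hT : 0 < T) (hTT : T ≤ T') (hP : 0 < P)
    (h : ∀ n ∈ Finset.Icc 1 (T' ^ 2), n ∣ P) :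
    periodMean P (fun x => |truncFun T' x - truncFun T x|) ≤
      aNorm * (2 + divisorConst) * (1 + Real.log T') * (T : ℝ) ^ (-(1 / 4) : ℝ) := by
  have hlog := Real.log_natCast_nonneg T'
  have hT' : (0 : ℝ) < T := by exact_mod_cast hT
  have hK := divisorConst_nonneg
  have hA := aNorm_nonneg
  set Λ := 1 + Real.log T' with hΛ
  set H : ℕ → ℝ → ℝ := fun u x => ∑ v ∈ Finset.Ioc T T', saw (x / (u * v : ℕ)) / v with hH
  have hHb : ∀ u, BddMeas (H u) := by
    intro u
    refine BddMeas.sum _ fun v _ => ?_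
    simpa [div_eq_inv_mul] using (BddMeas.saw_div (u * v)).const_mul (v : ℝ)⁻¹
  have hdiff : ∀ x, truncFun T' x - truncFun T x = ∑ u ∈ Finset.Icc 1 T, aCoef u * H u x +
      ∑ u ∈ Finset.Ioc T T', aCoef u * ∑ v ∈ Finset.Icc 1 T', saw (x / (u * v : ℕ)) / v := by
    intro x
    rw [truncFun, truncFun, sum_Icc_one_eq_add hTT, add_sub_right_comm, ← Finset.sum_sub_distrib]
    congr 1
    refine Finset.sum_congr rfl fun u _ => ?_
    rw [sum_Icc_one_eq_add hTT]
    ring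
  have hle : ∀ x, |truncFun T' x - truncFun T x| ≤
      ∑ u ∈ Finset.Icc 1 T, |aCoef u| * |H u x| + aNorm * (T : ℝ) ^ (-(1 / 4) : ℝ) * Λ := by
    intro x
    rw [hdiff]
    refine (abs_add_le _ _).trans (add_le_add ?_ ?_)
    · refine (Finset.abs_sum_le_sum_abs _ _).trans (le_of_eq ?_)
      exact Finset.sum_congr rfl fun u _ => abs_mul _ _
    · refine (Finset.abs_sum_le_sum_abs _ _).trans ?_
      refine le_trans ?_ (mul_le_mul_of_nonneg_right (sum_abs_aCoef_tail (Finset.Ioc T T') hT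
        fun u hu => (Finset.mem_Ioc.mp hu).1.le) (by linarith))
      rw [Finset.sum_mul]
      refine Finset.sum_le_sum fun u _ => ?_
      rw [abs_mul]
      exact mul_le_mul_of_nonneg_left (abs_sum_saw_div_le _ T' subset_rfl _) (abs_nonneg _)
  have hmean : ∀ u ∈ Finset.Icc 1 T, periodMean P (fun x => |H u x|) ≤
      (1 + divisorConst) * Λ * (T : ℝ) ^ (-(1 / 4) : ℝ) := by
    intro u hu
    have hu' := Finset.mem_Icc.mp hu
    have hΛ1 : 1 ≤ Λ := by linarith
    refine periodMean_abs_le hP (hHb u) (by positivity) ?_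
    refine (periodMean_sq_le hu'.1 hT hP fun v hv => ?_).trans ?_
    · have hv' := Finset.mem_Ioc.mp hv
      refine h _ (Finset.mem_Icc.mpr ⟨Nat.mul_pos hu'.1 (by omega), ?_⟩)
      rw [sq]
      exact Nat.mul_le_mul (hu'.2.trans hTT) hv'.2
    · have h1 : ((T : ℝ) ^ (-(1 / 4) : ℝ)) ^ 2 = (T : ℝ) ^ (-(1 / 2) : ℝ) := by
        rw [← Real.rpow_natCast, ← Real.rpow_mul hT'.le]
        norm_num
      rw [mul_pow, h1, mul_pow]
      gcongr ?_ * _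
      refine mul_le_mul ?_ ?_ (by linarith) (by positivity) <;> nlinarith
  calc _ ≤ periodMean P (fun x => ∑ u ∈ Finset.Icc 1 T, |aCoef u| * |H u x| -
        (-(aNorm * (T : ℝ) ^ (-(1 / 4) : ℝ) * Λ))) := by
        refine periodMean_mono P ((bddMeas_truncFun _).sub (bddMeas_truncFun _)).abs
          ((BddMeas.sum _ fun u _ => (hHb u).abs.const_mul _).sub (BddMeas.const _)) fun x => ?_
        rw [sub_neg_eq_add]
        exact hle x
    _ = ∑ u ∈ Finset.Icc 1 T, |aCoef u| * periodMean P (fun x => |H u x|) +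
        aNorm * (T : ℝ) ^ (-(1 / 4) : ℝ) * Λ := by
        rw [periodMean_sub _ (BddMeas.sum _ fun u _ => (hHb u).abs.const_mul _) (BddMeas.const _),
          periodMean_const hP, sub_neg_eq_add,
          periodMean_sum _ _ fun u _ => (hHb u).abs.const_mul _]
        simp only [periodMean_const_mul]
    _ ≤ ∑ u ∈ Finset.Icc 1 T, |aCoef u| * ((1 + divisorConst) * Λ * (T : ℝ) ^ (-(1 / 4) : ℝ)) +
        aNorm * (T : ℝ) ^ (-(1 / 4) : ℝ) * Λ := by
        gcongr with u hu
        exact hmean u hu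
    _ ≤ aNorm * ((1 + divisorConst) * Λ * (T : ℝ) ^ (-(1 / 4) : ℝ)) +
        aNorm * (T : ℝ) ^ (-(1 / 4) : ℝ) * Λ := by
        rw [← Finset.sum_mul]
        gcongr
        exact sum_abs_aCoef_le _
    _ = _ := by ring

/-- The constant in the comparison of truncated moments. -/
noncomputable def truncConst : ℝ := aNorm * (2 + divisorConst)

lemma aNorm_le_truncConst : aNorm ≤ truncConst := by
  rw [truncConst]
  nlinarith [divisorConst_nonneg, aNorm_nonneg]

lemma truncConst_nonneg : 0 ≤ truncConst := aNorm_nonneg.trans aNorm_le_truncConst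

lemma abs_truncMoment_sub_le {l T T' : ℕ} (hl : 0 < l) (hT : 0 < T) (hTT : T ≤ T') :
    |truncMoment l T' - truncMoment l T| ≤
      l * (truncConst * (1 + Real.log T')) ^ l * (T : ℝ) ^ (-(1 / 4) : ℝ) := by
  have hlog := Real.log_natCast_nonneg T'
  have hA := aNorm_nonneg
  have hK := truncConst_nonneg
  set P := Nat.factorial (T' ^ 2) with hP
  have hP0 : 0 < P := Nat.factorial_pos _
  have hdvd : ∀ n ∈ Finset.Icc 1 (T' ^ 2), n ∣ P := fun n hn =>
    Nat.dvd_factorial (Finset.mem_Icc.mp hn).1 (Finset.mem_Icc.mp hn).2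
  have hdvd' : ∀ n ∈ Finset.Icc 1 (T ^ 2), n ∣ P := fun n hn => hdvd n
    (Finset.mem_Icc.mpr ⟨(Finset.mem_Icc.mp hn).1, (Finset.mem_Icc.mp hn).2.trans
      (Nat.pow_le_pow_left hTT 2)⟩)
  have hTle : Real.log T ≤ Real.log T' :=
    Real.log_le_log (by exact_mod_cast hT) (by exact_mod_cast hTT)
  set S := truncConst * (1 + Real.log T') with hS
  have hSbound : ∀ x, max |truncFun T' x| |truncFun T x| ≤ S := by
    intro x
    refine max_le ((abs_truncFun_le T' x).trans ?_) ((abs_truncFun_le T x).trans ?_)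
    · exact mul_le_mul_of_nonneg_right aNorm_le_truncConst (by linarith)
    · have := Real.log_natCast_nonneg T
      exact mul_le_mul aNorm_le_truncConst (by linarith) (by linarith) hK
  rw [truncMoment_eq hP0 hdvd, truncMoment_eq hP0 hdvd',
    ← periodMean_sub P ((bddMeas_truncFun _).pow l) ((bddMeas_truncFun _).pow l)]
  refine (abs_periodMean_le P).trans ?_
  calc _ ≤ periodMean P (fun x => (l * S ^ (l - 1)) * |truncFun T' x - truncFun T x|) := by
        refine periodMean_mono P (((bddMeas_truncFun _).pow l).sub
          ((bddMeas_truncFun _).pow l)).abs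
          (((bddMeas_truncFun _).sub (bddMeas_truncFun _)).abs.const_mul _) fun x => ?_
        refine (abs_pow_sub_pow_le _ _ l).trans ?_
        have : max |truncFun T' x| |truncFun T x| ^ (l - 1) ≤ S ^ (l - 1) :=
          pow_le_pow_left₀ (le_max_of_le_left (abs_nonneg _)) (hSbound x) _
        calc _ ≤ |truncFun T' x - truncFun T x| * l * S ^ (l - 1) := by gcongr
          _ = _ := by ring
    _ ≤ l * S ^ (l - 1) * (S * (T : ℝ) ^ (-(1 / 4) : ℝ)) := by
        rw [periodMean_const_mul]
        have hS0 : 0 ≤ S := mul_nonneg hK (by linarith)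
        refine mul_le_mul_of_nonneg_left ?_ (by positivity)
        exact periodMean_abs_truncFun_sub_le hT hTT hP0 hdvd
    _ = _ := by
        obtain ⟨m, rfl⟩ : ∃ m, l = m + 1 := ⟨l - 1, by omega⟩
        rw [Nat.add_sub_cancel, pow_succ S m]
        ring

/-! ### The main term as a limit of truncated moments -/

lemma tsum_bTrunc_eq (l T : ℕ) :
    ∑' n : Fin l → ℕ+, (∏ j, bTrunc T (n j)) * Bcorr (fun j => (n j : ℕ)) = truncMoment l T := by
  rw [tsum_eq_sum (s := Fintype.piFinset fun _ : Fin l =>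
    (Finset.Icc 1 (T ^ 2)).image Nat.toPNat')]
  · rw [truncMoment]
    refine Finset.sum_bij' (fun n _ j => (n j : ℕ)) (fun n _ j => (n j).toPNat') ?_ ?_ ?_ ?_ ?_
    · intro n hn
      rw [Fintype.mem_piFinset] at hn ⊢
      intro j
      obtain ⟨m, hm, hmn⟩ := Finset.mem_image.mp (hn j)
      have hm0 : 0 < m := (Finset.mem_Icc.mp hm).1
      rw [← hmn]
      simpa [Nat.toPNat'_coe, hm0] using hm
    · intro n hn
      rw [Fintype.mem_piFinset] at hn ⊢
      exact fun j => Finset.mem_image_of_mem _ (hn j)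
    · intro n _
      funext j
      exact PNat.coe_toPNat' _
    · intro n hn
      rw [Fintype.mem_piFinset] at hn
      funext j
      have h0 : 0 < n j := (Finset.mem_Icc.mp (hn j)).1
      simp [Nat.toPNat'_coe, h0]
    · intro n _
      rfl
  · intro n hn
    rw [Fintype.mem_piFinset] at hn
    push Not at hn
    obtain ⟨j, hj⟩ := hn
    rw [Finset.prod_eq_zero (Finset.mem_univ j), zero_mul]
    refine bTrunc_eq_zero ?_
    by_contra! hle
    exact hj (Finset.mem_image.mpr ⟨n j, Finset.mem_Icc.mpr ⟨(n j).pos, hle⟩, PNat.coe_toPNat' _⟩)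

lemma tendsto_truncMoment {l : ℕ} (hl : 0 < l) :
    Filter.Tendsto (truncMoment l) Filter.atTop
      (nhds (∑' n : Fin l → ℕ+, (∏ j, bCoef (n j)) * Bcorr (fun j => (n j : ℕ)))) := by
  have h := tendsto_tsum_of_dominated_convergence (𝓕 := Filter.atTop)
    (f := fun T (n : Fin l → ℕ+) => (∏ j, bTrunc T (n j)) * Bcorr (fun j => (n j : ℕ)))
    (g := fun n : Fin l → ℕ+ => (∏ j, bCoef (n j)) * Bcorr (fun j => (n j : ℕ)))
    (summable_prod_bAbs_mul_abs_Bcorr hl) ?_ ?_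
  · simpa only [tsum_bTrunc_eq] using h
  · intro n
    refine Filter.Tendsto.congr' ?_ tendsto_const_nhds
    filter_upwards [Filter.eventually_ge_atTop (∏ j, (n j : ℕ))] with T hT
    congr 1
    refine Finset.prod_congr rfl fun j _ => (bTrunc_eq_bCoef (le_trans ?_ hT)).symm
    exact Nat.le_of_dvd (Finset.prod_pos fun j _ => (n j).pos)
      (Finset.dvd_prod_of_mem (fun j => (n j : ℕ)) (Finset.mem_univ j))
  · refine Filter.Eventually.of_forall fun T n => ?_
    rw [Real.norm_eq_abs, abs_mul, Finset.abs_prod]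
    gcongr
    exact abs_bTrunc_le _ _

lemma abs_tsum_sub_truncMoment_le {l T : ℕ} (hl : 0 < l) (hT : 2 ^ (4 * (l + 1)) ≤ T) :
    |∑' n : Fin l → ℕ+, (∏ j, bCoef (n j)) * Bcorr (fun j => (n j : ℕ)) - truncMoment l T| ≤
      2 * l * (4 * truncConst * Real.log T) ^ l * (T : ℝ) ^ (-(1 / 4) : ℝ) := by
  have hK := truncConst_nonneg
  have hT' : (2 : ℝ) ^ (4 * (l + 1)) ≤ T := by exact_mod_cast hT
  have hT0 : (0 : ℝ) < T := lt_of_lt_of_le (by positivity) hT'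
  have hT0' : 0 < T := by exact_mod_cast hT0
  have hT1 : 1 < T := lt_of_lt_of_le (Nat.one_lt_two_pow (by omega)) hT
  have hlog : 1 ≤ Real.log T := by
    rw [Real.le_log_iff_exp_le hT0]
    refine le_trans ?_ hT'
    calc Real.exp 1 ≤ 2 ^ 4 := by have := Real.exp_one_lt_d9; norm_num; linarith
      _ ≤ _ := pow_le_pow_right₀ (by norm_num) (by omega)
  set ρ := (T : ℝ) ^ (-(1 / 4) : ℝ) with hρ
  have hρ0 : 0 < ρ := by positivity
  have hρle : ρ ≤ (2 : ℝ)⁻¹ ^ (l + 1) := by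
    calc ρ ≤ ((2 : ℝ) ^ (4 * (l + 1))) ^ (-(1 / 4) : ℝ) :=
          Real.rpow_le_rpow_of_nonpos (by positivity) hT' (by norm_num)
      _ = _ := by
          rw [← Real.rpow_natCast, ← Real.rpow_mul (by norm_num), inv_pow, ← Real.rpow_natCast,
            ← Real.rpow_neg (by norm_num)]
          congr 1
          push_cast
          ring
  have hρ1 : ρ ≤ 1 := hρle.trans (pow_le_one₀ (by norm_num) (by norm_num))
  have hρ2 : 2 ^ l * ρ ≤ 1 / 2 := by
    calc 2 ^ l * ρ ≤ 2 ^ l * (2 : ℝ)⁻¹ ^ (l + 1) := by gcongr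
      _ = 1 / 2 := by rw [pow_succ, ← mul_assoc, ← mul_pow]; norm_num
  set M : ℕ → ℝ := fun i => truncMoment l (T ^ 2 ^ i) with hM
  have hstep : ∀ i, |M (i + 1) - M i| ≤
      l * (4 * truncConst * Real.log T) ^ l * ρ * (1 / 2 : ℝ) ^ i := by
    intro i
    refine (abs_truncMoment_sub_le hl (Nat.pow_pos hT0')
      (Nat.pow_le_pow_right hT0' (Nat.pow_le_pow_right (by norm_num) (Nat.le_succ i)))).trans ?_
    have h1 : 1 + Real.log ((T ^ 2 ^ (i + 1) : ℕ) : ℝ) ≤ 2 ^ i * (4 * Real.log T) := by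
      push_cast
      rw [Real.log_pow]
      push_cast
      have : (1 : ℝ) ≤ 2 ^ i := one_le_pow₀ (by norm_num)
      rw [pow_succ]
      nlinarith
    have h0 : 0 ≤ 1 + Real.log ((T ^ 2 ^ (i + 1) : ℕ) : ℝ) := by
      have := Real.log_natCast_nonneg (T ^ 2 ^ (i + 1))
      linarith
    have h2 : ((T ^ 2 ^ i : ℕ) : ℝ) ^ (-(1 / 4) : ℝ) ≤ ρ * ρ ^ i := by
      rw [← pow_succ']
      calc _ = ρ ^ 2 ^ i := by
            push_cast
            rw [hρ, ← Real.rpow_natCast, ← Real.rpow_mul hT0.le, ← Real.rpow_natCast _ (2 ^ i),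
              ← Real.rpow_mul hT0.le, mul_comm]
        _ ≤ ρ ^ (i + 1) := pow_le_pow_of_le_one hρ0.le hρ1 (Nat.lt_two_pow_self)
    calc _ ≤ l * (truncConst * (2 ^ i * (4 * Real.log T))) ^ l * (ρ * ρ ^ i) := by gcongr
      _ = l * (4 * truncConst * Real.log T) ^ l * ρ * (2 ^ l * ρ) ^ i := by
          rw [show truncConst * (2 ^ i * (4 * Real.log T)) =
            2 ^ i * (4 * truncConst * Real.log T) by ring, mul_pow, mul_pow (2 ^ l), ← pow_mul,
            ← pow_mul, mul_comm i l]
          ring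
      _ ≤ _ := by gcongr
  have hsum : ∀ n, |M n - M 0| ≤ 2 * l * (4 * truncConst * Real.log T) ^ l * ρ := by
    intro n
    rw [← Finset.sum_range_sub]
    refine (Finset.abs_sum_le_sum_abs _ _).trans ((Finset.sum_le_sum fun i _ => hstep i).trans ?_)
    rw [← Finset.mul_sum]
    have h0 : 0 ≤ l * (4 * truncConst * Real.log T) ^ l * ρ := by positivity
    nlinarith [sum_geometric_two_le n]
  have hlim : Filter.Tendsto M Filter.atTop
      (nhds (∑' n : Fin l → ℕ+, (∏ j, bCoef (n j)) * Bcorr (fun j => (n j : ℕ)))) := by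
    refine (tendsto_truncMoment hl).comp ?_
    refine (Filter.tendsto_atTop_mono (fun n => ?_) Filter.tendsto_id)
    exact Nat.lt_two_pow_self.le.trans (Nat.lt_pow_self hT1).le
  have hM0 : M 0 = truncMoment l T := by simp [hM]
  rw [← hM0]
  exact le_of_tendsto (hlim.sub_const _).abs (Filter.Eventually.of_forall hsum)

/-! ### Discrete moments versus means -/

/-- The sawtooth function on `ℤ/q`. -/
noncomputable def zsaw {q : ℕ} (c : ZMod q) : ℝ := saw ((c.val : ℝ) / q)

lemma zsaw_natCast {q : ℕ} (hq : 0 < q) (m : ℕ) : zsaw (m : ZMod q) = saw ((m : ℝ) / q) := by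
  have hq' : (0 : ℝ) < q := by exact_mod_cast hq
  rw [zsaw, ZMod.val_natCast]
  conv_rhs => rw [← Nat.mod_add_div m q]
  rw [← saw_add_nat (((m % q : ℕ) : ℝ) / q) (m / q)]
  congr 1
  push_cast
  field_simp

lemma abs_zsaw_le {q : ℕ} (c : ZMod q) : |zsaw c| ≤ 1 := abs_saw_le_one _

lemma sum_range_natCast_zmod {M : Type*} [AddCommMonoid M] {q : ℕ} [NeZero q] (G : ZMod q → M) :
    ∑ t ∈ Finset.range q, G (t : ZMod q) = ∑ c, G c := by
  refine Finset.sum_bij (fun t _ => (t : ZMod q)) (fun _ _ => Finset.mem_univ _) ?_ ?_ ?_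
  · intro a ha b hb hab
    have := (ZMod.natCast_eq_natCast_iff' a b q).mp hab
    rwa [Nat.mod_eq_of_lt (Finset.mem_range.mp ha), Nat.mod_eq_of_lt (Finset.mem_range.mp hb)]
      at this
  · intro c _
    exact ⟨c.val, Finset.mem_range.mpr (ZMod.val_lt c), ZMod.natCast_zmod_val c⟩
  · intro _ _
    rfl

lemma abs_prod_sub_prod_le {ι : Type*} (s : Finset ι) {f g : ι → ℝ} (hf : ∀ i ∈ s, |f i| ≤ 1)
    (hg : ∀ i ∈ s, |g i| ≤ 1) : |∏ i ∈ s, f i - ∏ i ∈ s, g i| ≤ ∑ i ∈ s, |f i - g i| := by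
  induction s using Finset.induction_on with
  | empty => simp
  | insert i s hi ih =>
    rw [Finset.prod_insert hi, Finset.prod_insert hi, Finset.sum_insert hi]
    have h1 := ih (fun j hj => hf j (Finset.mem_insert_of_mem hj))
      fun j hj => hg j (Finset.mem_insert_of_mem hj)
    have h2 : |∏ j ∈ s, f j| ≤ 1 := by
      rw [Finset.abs_prod]
      exact Finset.prod_le_one (fun _ _ => abs_nonneg _) fun j hj =>
        hf j (Finset.mem_insert_of_mem hj)
    have h3 : f i * ∏ j ∈ s, f j - g i * ∏ j ∈ s, g j =
        (f i - g i) * ∏ j ∈ s, f j + g i * (∏ j ∈ s, f j - ∏ j ∈ s, g j) := by ring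
    rw [h3]
    refine (abs_add_le _ _).trans (add_le_add ?_ ?_)
    · rw [abs_mul]
      exact mul_le_of_le_one_right (abs_nonneg _) h2
    · rw [abs_mul]
      exact (mul_le_of_le_one_left (abs_nonneg _) (hg i (Finset.mem_insert_self _ _))).trans h1

lemma abs_saw_sub_saw_le {x y : ℝ} (h : x ≤ y) :
    |saw y - saw x| ≤ (y - x) + (⌊y⌋ - ⌊x⌋) + if Int.fract x = 0 then 1 else 0 := by
  rcases (Int.floor_mono h).eq_or_lt with hfl | hfl
  · have hfl' : (⌊x⌋ : ℝ) = ⌊y⌋ := by exact_mod_cast hfl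
    have h1 : Int.fract y = Int.fract x + (y - x) := by
      rw [← Int.self_sub_floor, ← Int.self_sub_floor, hfl']
      ring
    have hx0 := Int.fract_nonneg x
    by_cases hx : Int.fract x = 0
    · rw [if_pos hx]
      have h2 := abs_le.mp (abs_saw_le y)
      have h3 := abs_le.mp (abs_saw_le x)
      rw [abs_le]
      constructor <;> linarith
    · have hx' : 0 < Int.fract x := lt_of_le_of_ne hx0 (Ne.symm hx)
      have hy : Int.fract y ≠ 0 := by
        rw [h1]
        exact (by linarith : (0 : ℝ) < Int.fract x + (y - x)).ne'
      rw [saw, saw, if_neg hx, if_neg hy, if_neg hx, h1, hfl', abs_le]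
      constructor <;> linarith
  · have hfl' : (⌊x⌋ : ℝ) + 1 ≤ ⌊y⌋ := by exact_mod_cast hfl
    have h2 := abs_le.mp (abs_saw_le y)
    have h3 := abs_le.mp (abs_saw_le x)
    have h4 : (0 : ℝ) ≤ if Int.fract x = 0 then 1 else 0 := by split_ifs <;> norm_num
    rw [abs_le]
    constructor <;> linarith

lemma sum_prod_zsaw_eq {q l : ℕ} (hq : q.Prime) [NeZero q] {n : Fin l → ℕ} (hn : ∀ j, 0 < n j)
    (hco : ∀ j, (n j).Coprime q) :
    ∑ k : ZMod q, ∏ j, zsaw (k * ((n j : ℕ) : ZMod q)⁻¹) =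
      ∑ k ∈ Finset.range q, ∏ j, saw ((k * (∏ i, (n i : ℝ)) / q) / n j) := by
  have hq' : (0 : ℝ) < q := by exact_mod_cast hq.pos
  have hN : (∏ i, n i).Coprime q := Nat.Coprime.prod_left fun j _ => hco j
  have h1 : ∑ k : ZMod q, ∏ j, zsaw (k * ((n j : ℕ) : ZMod q)⁻¹) =
      ∑ k : ZMod q, ∏ j, zsaw (k * ((∏ i, n i : ℕ) : ZMod q) * ((n j : ℕ) : ZMod q)⁻¹) :=
    (Fintype.sum_equiv (Units.mulRight (ZMod.unitOfCoprime _ hN)) _ _ fun c => by simp).symm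
  rw [h1, ← sum_range_natCast_zmod]
  refine Finset.sum_congr rfl fun k _ => Finset.prod_congr rfl fun j _ => ?_
  have h2 : ((∏ i, n i : ℕ) : ZMod q) * ((n j : ℕ) : ZMod q)⁻¹ =
      ((∏ i ∈ Finset.univ.erase j, n i : ℕ) : ZMod q) := by
    rw [← Finset.mul_prod_erase Finset.univ n (Finset.mem_univ j), Nat.cast_mul, mul_right_comm,
      ZMod.coe_mul_inv_eq_one _ (hco j), one_mul]
  have h3 : ∏ i, (n i : ℝ) = n j * ((∏ i ∈ Finset.univ.erase j, n i : ℕ) : ℝ) := by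
    rw [Nat.cast_prod]
    exact (Finset.mul_prod_erase Finset.univ (fun i => (n i : ℝ)) (Finset.mem_univ j)).symm
  have hj : (0 : ℝ) < n j := by exact_mod_cast hn j
  rw [mul_assoc, h2, ← Nat.cast_mul, zsaw_natCast hq.pos, h3]
  congr 1
  push_cast
  field_simp

lemma abs_sum_prod_zsaw_sub_le {q l : ℕ} (hq : q.Prime) [NeZero q] {n : Fin l → ℕ}
    (hn : ∀ j, 0 < n j) (hco : ∀ j, (n j).Coprime q) :
    |(1 / q : ℝ) * ∑ k : ZMod q, ∏ j, zsaw (k * ((n j : ℕ) : ZMod q)⁻¹) - Bcorr n| ≤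
      3 * l / q * ∏ j, (n j : ℝ) := by
  have hq' : (0 : ℝ) < q := by exact_mod_cast hq.pos
  rw [sum_prod_zsaw_eq hq hn hco]
  set N : ℝ := ∏ j, (n j : ℝ) with hN
  have hn1 : ∀ j, (1 : ℝ) ≤ n j := fun j => by exact_mod_cast hn j
  have hN1 : 1 ≤ N := by
    rw [hN, ← Nat.cast_prod]
    exact_mod_cast Finset.prod_pos fun j _ => hn j
  have hN0 : 0 < N := by linarith
  set F : ℝ → ℝ := fun x => ∏ j, saw (x / n j) with hF
  have hFb : BddMeas F := BddMeas.prod _ fun j _ => BddMeas.saw_div _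
  set X : ℕ → ℝ := fun k => k * N / q with hX
  have hXmono : ∀ k, X (k + 1) - X k = N / q := by
    intro k
    simp only [hX]
    push_cast
    ring
  set D : ℕ → ℝ := fun k => ∑ j, ((X (k + 1) / n j - X k / n j) +
    (⌊X (k + 1) / n j⌋ - ⌊X k / n j⌋ : ℝ) + if k = 0 then 1 else 0) with hD
  have hfract : ∀ k < q, ∀ j, Int.fract (X k / n j) = 0 → k = 0 := by
    intro k hk j h
    obtain ⟨m, hm⟩ := Int.fract_eq_zero_iff.mp h
    have h3 : N = n j * ((∏ i ∈ Finset.univ.erase j, n i : ℕ) : ℝ) := by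
      rw [Nat.cast_prod]
      exact (Finset.mul_prod_erase Finset.univ (fun i => (n i : ℝ)) (Finset.mem_univ j)).symm
    have hj : (0 : ℝ) < n j := by exact_mod_cast hn j
    simp only [hX] at hm
    rw [h3] at hm
    have h4 : (m : ℝ) * q = k * ((∏ i ∈ Finset.univ.erase j, n i : ℕ) : ℝ) := by
      rw [hm]
      field_simp
    have h5 : m * q = ((k * ∏ i ∈ Finset.univ.erase j, n i : ℕ) : ℤ) := by exact_mod_cast h4
    have h6 : q ∣ k * ∏ i ∈ Finset.univ.erase j, n i := by
      rw [← Int.natCast_dvd_natCast, ← h5]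
      exact Dvd.intro_left m rfl
    have h7 : q ∣ k := (Nat.Coprime.prod_left fun i _ => hco i).symm.dvd_of_dvd_mul_right h6
    exact Nat.eq_zero_of_dvd_of_lt h7 hk
  have hstep : ∀ k ∈ Finset.range q,
      |∫ x in X k..X (k + 1), (F (X k) - F x)| ≤ D k * (N / q) := by
    intro k hk
    have h0 : X k ≤ X (k + 1) := by have := hXmono k; have : 0 < N / q := by positivity
                                    linarith
    have h1 : ‖∫ x in X k..X (k + 1), (F (X k) - F x)‖ ≤ D k * |X (k + 1) - X k| := by
      refine intervalIntegral.norm_integral_le_of_norm_le_const fun x hx => ?_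
      rw [Set.uIoc_of_le h0] at hx
      rw [Real.norm_eq_abs, abs_sub_comm]
      refine (abs_prod_sub_prod_le _ (fun _ _ => abs_saw_le_one _)
        fun _ _ => abs_saw_le_one _).trans (Finset.sum_le_sum fun j _ => ?_)
      have hj : (0 : ℝ) < n j := by exact_mod_cast hn j
      refine (abs_saw_sub_saw_le (div_le_div_of_nonneg_right hx.1.le hj.le)).trans ?_
      have h5 : (⌊x / n j⌋ : ℝ) ≤ ⌊X (k + 1) / n j⌋ := by
        exact_mod_cast Int.floor_mono (div_le_div_of_nonneg_right hx.2 hj.le)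
      have h6 : x / n j ≤ X (k + 1) / n j := div_le_div_of_nonneg_right hx.2 hj.le
      have h7 : (if Int.fract (X k / n j) = 0 then (1 : ℝ) else 0) ≤ if k = 0 then 1 else 0 := by
        by_cases hk0 : k = 0
        · rw [if_pos hk0]
          split_ifs <;> norm_num
        · rw [if_neg hk0, if_neg fun h => hk0 (hfract k (Finset.mem_range.mp hk) j h)]
      linarith
    rwa [hXmono, abs_of_pos (by positivity)] at h1
  have hsumD : ∑ k ∈ Finset.range q, D k ≤ 3 * l * N := by
    rw [hD, Finset.sum_comm]
    calc _ ≤ ∑ _j : Fin l, 3 * N := by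
          refine Finset.sum_le_sum fun j _ => ?_
          have hj : (0 : ℝ) < n j := by exact_mod_cast hn j
          rw [Finset.sum_add_distrib, Finset.sum_add_distrib,
            Finset.sum_range_sub (fun k => X k / n j),
            Finset.sum_range_sub (fun k => (⌊X k / n j⌋ : ℝ)), Finset.sum_ite_eq' (Finset.range q),
            if_pos (Finset.mem_range.mpr hq.pos)]
          have hX0 : X 0 = 0 := by simp [hX]
          have hXq : X q = N := by simp only [hX]; field_simp
          rw [hX0, hXq]
          have h1 : N / n j ≤ N := div_le_self hN0.le (hn1 j)
          have h2 := Int.floor_le (N / n j)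
          simp only [zero_div, Int.floor_zero, Int.cast_zero]
          linarith
      _ = _ := by
          rw [Finset.sum_const, Finset.card_univ, Fintype.card_fin, nsmul_eq_mul]
          ring
  have hmain : ∑ k ∈ Finset.range q, ∫ x in X k..X (k + 1), (F (X k) - F x) =
      N / q * ∑ k ∈ Finset.range q, F (X k) - ∫ x in (0 : ℝ)..N, F x := by
    have h1 := intervalIntegral.sum_integral_adjacent_intervals (a := X) (n := q) (f := F)
      (μ := volume) fun k _ => hFb.intervalIntegrable _ _
    have hX0 : X 0 = 0 := by simp [hX]
    have hXq : X q = N := by simp only [hX]; field_simp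
    rw [hX0, hXq] at h1
    rw [← h1, Finset.mul_sum, ← Finset.sum_sub_distrib]
    refine Finset.sum_congr rfl fun k _ => ?_
    rw [intervalIntegral.integral_sub intervalIntegrable_const (hFb.intervalIntegrable _ _),
      intervalIntegral.integral_const, hXmono, smul_eq_mul]
  have hB : Bcorr n = (1 / N) * ∫ x in (0 : ℝ)..N, F x := rfl
  have hfin : (1 / q : ℝ) * ∑ k ∈ Finset.range q, F (X k) - Bcorr n =
      1 / N * ∑ k ∈ Finset.range q, ∫ x in X k..X (k + 1), (F (X k) - F x) := by
    rw [hmain, hB]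
    field_simp
  change |(1 / q : ℝ) * ∑ k ∈ Finset.range q, F (X k) - Bcorr n| ≤ _
  rw [hfin, abs_mul, abs_of_pos (by positivity : 0 < 1 / N)]
  calc _ ≤ 1 / N * (∑ k ∈ Finset.range q, D k * (N / q)) := by
        gcongr
        exact (Finset.abs_sum_le_sum_abs _ _).trans (Finset.sum_le_sum hstep)
    _ = (∑ k ∈ Finset.range q, D k) / q := by
        rw [← Finset.sum_mul]
        field_simp
    _ ≤ 3 * l * N / q := by gcongr
    _ = _ := by ring

/-- The discrete analogue of `truncFun`. -/
noncomputable def ztrunc {q : ℕ} (T : ℕ) (k : ZMod q) : ℝ :=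
  ∑ u ∈ Finset.Icc 1 T, aCoef u *
    ∑ v ∈ Finset.Icc 1 T, zsaw (k * ((u * v : ℕ) : ZMod q)⁻¹) / v

lemma sum_abs_bTrunc_mul_le (T : ℕ) :
    ∑ n ∈ Finset.Icc 1 (T ^ 2), |bTrunc T n| * n ≤ aNorm * (T : ℝ) ^ 2 := by
  calc _ ≤ ∑ n ∈ Finset.Icc 1 (T ^ 2), ∑ u ∈ n.divisors with (u ≤ T ∧ n / u ≤ T),
        |aCoef u| * T := by
        refine Finset.sum_le_sum fun n hn => ?_
        rw [bTrunc]
        refine (mul_le_mul_of_nonneg_right (Finset.abs_sum_le_sum_abs _ _)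
          (by positivity)).trans ?_
        rw [Finset.sum_mul]
        refine Finset.sum_le_sum fun u hu => ?_
        have hu' := Finset.mem_filter.mp hu
        have hdvd := Nat.dvd_of_mem_divisors hu'.1
        have hn0 : 0 < n := (Finset.mem_Icc.mp hn).1
        have hu0 : 0 < u := Nat.pos_of_dvd_of_pos hdvd hn0
        have hv0 : 0 < n / u := Nat.div_pos (Nat.le_of_dvd hn0 hdvd) hu0
        have hn' : (n : ℝ) = u * ((n / u : ℕ) : ℝ) := by
          exact_mod_cast (Nat.mul_div_cancel' hdvd).symm
        have hv0' : (0 : ℝ) < ((n / u : ℕ) : ℝ) := by exact_mod_cast hv0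
        rw [abs_div, Nat.abs_cast]
        calc _ = |aCoef u| * u := by
              conv_lhs => rw [hn']
              field_simp
          _ ≤ _ := by
              gcongr
              exact hu'.2.1
    _ = ∑ u ∈ Finset.Icc 1 T, ∑ v ∈ Finset.Icc 1 T, |aCoef u| * T :=
        sum_divisors_trunc T fun u _ => |aCoef u| * T
    _ = (∑ u ∈ Finset.Icc 1 T, |aCoef u|) * (T : ℝ) ^ 2 := by
        simp only [Finset.sum_const, Nat.card_Icc, nsmul_eq_mul, Nat.add_sub_cancel, Finset.sum_mul]
        refine Finset.sum_congr rfl fun u _ => ?_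
        ring
    _ ≤ _ := by
        gcongr
        exact sum_abs_aCoef_le _

lemma abs_mean_ztrunc_pow_sub_le {q T : ℕ} (l : ℕ) (hq : q.Prime) [NeZero q] (hT : T < q) :
    |(1 / q : ℝ) * ∑ k : ZMod q, ztrunc T k ^ l - truncMoment l T| ≤
      3 * l / q * (aNorm * (T : ℝ) ^ 2) ^ l := by
  have h1 : (1 / q : ℝ) * ∑ k : ZMod q, ztrunc T k ^ l - truncMoment l T =
      ∑ n ∈ Fintype.piFinset fun _ : Fin l => Finset.Icc 1 (T ^ 2), (∏ j, bTrunc T (n j)) *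
        ((1 / q : ℝ) * ∑ k : ZMod q, ∏ j, zsaw (k * ((n j : ℕ) : ZMod q)⁻¹) - Bcorr n) := by
    simp only [ztrunc]
    rw [Finset.sum_congr rfl fun k _ =>
      pow_sum_bTrunc_mul l T fun n => zsaw (k * ((n : ℕ) : ZMod q)⁻¹), Finset.sum_comm,
      truncMoment, Finset.mul_sum, ← Finset.sum_sub_distrib]
    refine Finset.sum_congr rfl fun n _ => ?_
    rw [← Finset.mul_sum]
    ring
  have hbz : ∀ n ∈ Finset.Icc 1 (T ^ 2), ¬ n.Coprime q → bTrunc T n = 0 := by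
    intro n hn hco
    rw [bTrunc, Finset.filter_false_of_mem, Finset.sum_empty]
    rintro u hu ⟨hu1, hu2⟩
    have hdvd := Nat.dvd_of_mem_divisors hu
    have hn0 : 0 < n := (Finset.mem_Icc.mp hn).1
    have hu0 : 0 < u := Nat.pos_of_dvd_of_pos hdvd hn0
    have hv0 : 0 < n / u := Nat.div_pos (Nat.le_of_dvd hn0 hdvd) hu0
    refine hco ?_
    rw [← Nat.mul_div_cancel' hdvd]
    exact Nat.Coprime.mul_left
      (Nat.coprime_of_lt_prime hu0.ne' (hu1.trans_lt hT) hq).symm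
      (Nat.coprime_of_lt_prime hv0.ne' (hu2.trans_lt hT) hq).symm
  rw [h1]
  refine (Finset.abs_sum_le_sum_abs _ _).trans ?_
  calc _ ≤ ∑ n ∈ Fintype.piFinset fun _ : Fin l => Finset.Icc 1 (T ^ 2),
        3 * l / q * ∏ j, (|bTrunc T (n j)| * n j) := by
        refine Finset.sum_le_sum fun n hn => ?_
        rw [Fintype.mem_piFinset] at hn
        rw [abs_mul, Finset.abs_prod, Finset.prod_mul_distrib]
        by_cases hco : ∀ j, (n j).Coprime q
        · calc _ ≤ (∏ j, |bTrunc T (n j)|) * (3 * l / q * ∏ j, (n j : ℝ)) := by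
                refine mul_le_mul_of_nonneg_left ?_ (Finset.prod_nonneg fun _ _ => abs_nonneg _)
                exact abs_sum_prod_zsaw_sub_le hq (fun j => (Finset.mem_Icc.mp (hn j)).1) hco
            _ = _ := by ring
        · push Not at hco
          obtain ⟨j, hj⟩ := hco
          rw [Finset.prod_eq_zero (Finset.mem_univ j) (by rw [hbz _ (hn j) hj, abs_zero])]
          simp
    _ = 3 * l / q * (∑ n ∈ Finset.Icc 1 (T ^ 2), |bTrunc T n| * n) ^ l := by
        have := Finset.prod_univ_sum (fun _ : Fin l => Finset.Icc 1 (T ^ 2))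
          fun _ n => |bTrunc T n| * (n : ℝ)
        rw [Finset.prod_const, Finset.card_univ, Fintype.card_fin] at this
        rw [this, Finset.mul_sum]
    _ ≤ _ := by
        gcongr
        exact sum_abs_bTrunc_mul_le T

/-! ### Dirichlet L-functions at `0` and `1` -/

/-- The second-order error term in the interpolation of `t ↦ t^{-s}` on `[n + 1, n + 2]`. -/
noncomputable def hurwitzTerm (x : ℝ) (n : ℕ) (s : ℂ) : ℂ :=
  ((n : ℂ) + 1 + x) ^ (-s) - (1 - x) * ((n : ℂ) + 1) ^ (-s) - x * ((n : ℂ) + 2) ^ (-s)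

lemma norm_cpow_sub_linear_le {m : ℝ} (hm : 1 ≤ m) {s : ℂ} (hs : -(1 / 2) < s.re) {x : ℝ}
    (hx : x ∈ Set.Icc (0 : ℝ) 1) :
    ‖((m + x : ℝ) : ℂ) ^ (-s) - (m : ℂ) ^ (-s) - x * (-s * (m : ℂ) ^ (-s - 1))‖ ≤
      ‖s‖ * ‖s + 1‖ * m ^ (-(3 / 2) : ℝ) := by
  have hderiv : ∀ (w : ℂ), ∀ t ∈ Set.Icc m (m + 1),
      HasDerivAt (fun t : ℝ => (t : ℂ) ^ w) (w * (t : ℂ) ^ (w - 1)) t := by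
    intro w t ht
    have ht0 : 0 < t := by linarith [ht.1]
    have h1 : HasDerivAt (fun z : ℂ => z ^ w) (w * (t : ℂ) ^ (w - 1) * 1) (t : ℂ) :=
      (hasDerivAt_id (t : ℂ)).cpow_const (Or.inl (by simpa using ht0))
    simpa using h1.comp_ofReal
  have hconv : Convex ℝ (Set.Icc m (m + 1)) := convex_Icc _ _
  have hm0 : m ∈ Set.Icc m (m + 1) := ⟨le_rfl, by linarith⟩
  have hbound : ∀ t ∈ Set.Icc m (m + 1),
      ‖-s * ((-s - 1) * (t : ℂ) ^ (-s - 1 - 1))‖ ≤ ‖s‖ * ‖s + 1‖ * m ^ (-(3 / 2) : ℝ) := by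
    intro t ht
    have ht0 : 0 < t := by linarith [ht.1]
    rw [norm_mul, norm_mul, norm_neg, ← norm_neg (-s - 1), Complex.norm_cpow_eq_rpow_re_of_pos ht0,
      ← mul_assoc, show -(-s - 1) = s + 1 by ring]
    gcongr
    calc t ^ (-s - 1 - 1).re ≤ t ^ (-(3 / 2) : ℝ) := by
          refine Real.rpow_le_rpow_of_exponent_le (by linarith [ht.1]) ?_
          simp
          linarith
      _ ≤ m ^ (-(3 / 2) : ℝ) :=
          Real.rpow_le_rpow_of_nonpos (by linarith) ht.1 (by norm_num)
  have hderiv2 : ∀ t ∈ Set.Icc m (m + 1),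
      ‖-s * (t : ℂ) ^ (-s - 1) - -s * (m : ℂ) ^ (-s - 1)‖ ≤
        ‖s‖ * ‖s + 1‖ * m ^ (-(3 / 2) : ℝ) := by
    intro t ht
    refine (hconv.norm_image_sub_le_of_norm_hasDerivWithin_le
      (f := fun t : ℝ => -s * (t : ℂ) ^ (-s - 1))
      (f' := fun t : ℝ => -s * ((-s - 1) * (t : ℂ) ^ (-s - 1 - 1)))
      (fun t ht => ((hderiv _ t ht).const_mul _).hasDerivWithinAt) hbound hm0 ht).trans ?_
    refine mul_le_of_le_one_right (by positivity) ?_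
    rw [Real.norm_eq_abs, abs_le]
    constructor <;> linarith [ht.1, ht.2]
  have hmx : m + x ∈ Set.Icc m (m + 1) := ⟨by linarith [hx.1], by linarith [hx.2]⟩
  have h := hconv.norm_image_sub_le_of_norm_hasDerivWithin_le
      (f := fun t : ℝ => (t : ℂ) ^ (-s) - (t : ℂ) * (-s * (m : ℂ) ^ (-s - 1)))
      (f' := fun t : ℝ => -s * (t : ℂ) ^ (-s - 1) - 1 * (-s * (m : ℂ) ^ (-s - 1)))
      (fun t ht => ((hderiv _ t ht).sub
        ((Complex.ofRealCLM.hasDerivAt (x := t)).mul_const _)).hasDerivWithinAt)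
      (fun t ht => by rw [one_mul]; exact hderiv2 t ht) hm0 hmx
  have h2 : ‖m + x - m‖ ≤ 1 := by
    rw [Real.norm_eq_abs, abs_le]
    constructor <;> linarith [hx.1, hx.2]
  refine le_trans (le_of_eq ?_) (h.trans (mul_le_of_le_one_right (by positivity) h2))
  congr 1
  push_cast
  ring

lemma norm_hurwitzTerm_le {x : ℝ} (hx : x ∈ Set.Icc (0 : ℝ) 1) (n : ℕ) {s : ℂ}
    (hs : -(1 / 2) < s.re) :
    ‖hurwitzTerm x n s‖ ≤ 2 * (‖s‖ * ‖s + 1‖) * ((n : ℝ) + 1) ^ (-(3 / 2) : ℝ) := by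
  have hm : (1 : ℝ) ≤ (n : ℝ) + 1 := by linarith [Nat.cast_nonneg (α := ℝ) n]
  have h1 := norm_cpow_sub_linear_le hm hs hx
  have h2 := norm_cpow_sub_linear_le hm hs (x := 1) ⟨zero_le_one, le_rfl⟩
  have h3 : hurwitzTerm x n s =
      ((((n : ℝ) + 1 + x : ℝ) : ℂ) ^ (-s) - (((n : ℝ) + 1 : ℝ) : ℂ) ^ (-s) -
        x * (-s * (((n : ℝ) + 1 : ℝ) : ℂ) ^ (-s - 1))) -
      x * ((((n : ℝ) + 1 + 1 : ℝ) : ℂ) ^ (-s) - (((n : ℝ) + 1 : ℝ) : ℂ) ^ (-s) -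
        (1 : ℝ) * (-s * (((n : ℝ) + 1 : ℝ) : ℂ) ^ (-s - 1))) := by
    rw [hurwitzTerm]
    push_cast
    rw [show (n : ℂ) + 1 + 1 = n + 2 by ring]
    ring
  rw [h3]
  refine (norm_sub_le _ _).trans ?_
  rw [norm_mul]
  have hx1 : ‖(x : ℂ)‖ ≤ 1 := by
    rw [Complex.norm_real, Real.norm_eq_abs, abs_le]
    constructor <;> linarith [hx.1, hx.2]
  have h4 := mul_le_mul hx1 h2 (norm_nonneg _) zero_le_one
  linarith

lemma summable_add_one_rpow : Summable fun n : ℕ => ((n : ℝ) + 1) ^ (-(3 / 2) : ℝ) := by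
  have h := (summable_nat_add_iff 1).mpr
    (Real.summable_nat_rpow.mpr (by norm_num : (-(3 / 2) : ℝ) < -1))
  simpa using h

/-- A convex region containing `0` and `1` and some points with real part larger than `1`. -/
def lRegion : Set ℂ := {s : ℂ | -(1 / 2) < s.re} ∩ Metric.ball 0 10

lemma isOpen_lRegion : IsOpen lRegion :=
  (isOpen_lt continuous_const Complex.continuous_re).inter Metric.isOpen_ball

lemma isPreconnected_lRegion : IsPreconnected lRegion :=
  ((convex_halfSpace_re_gt _).inter (convex_ball _ _)).isPreconnected

lemma norm_hurwitzTerm_le_of_mem {x : ℝ} (hx : x ∈ Set.Icc (0 : ℝ) 1) (n : ℕ) {s : ℂ}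
    (hs : s ∈ lRegion) : ‖hurwitzTerm x n s‖ ≤ 220 * ((n : ℝ) + 1) ^ (-(3 / 2) : ℝ) := by
  refine (norm_hurwitzTerm_le hx n hs.1).trans ?_
  have h1 : ‖s‖ < 10 := by simpa using hs.2
  have h2 : ‖s + 1‖ ≤ 11 := (norm_add_le _ _).trans (by rw [norm_one]; linarith)
  gcongr
  nlinarith [norm_nonneg s, norm_nonneg (s + 1)]

/-- The analytic remainder of the Hurwitz zeta function. -/
noncomputable def hurwitzRem (x : ℝ) (s : ℂ) : ℂ := ∑' n, hurwitzTerm x n s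

lemma differentiableOn_hurwitzRem {x : ℝ} (hx : x ∈ Set.Icc (0 : ℝ) 1) :
    DifferentiableOn ℂ (hurwitzRem x) lRegion := by
  refine Complex.differentiableOn_tsum_of_summable_norm (summable_add_one_rpow.mul_left 220)
    (fun n => ?_) isOpen_lRegion fun n s hs => norm_hurwitzTerm_le_of_mem hx n hs
  have hpos : ∀ t : ℝ, 0 < t → Differentiable ℂ fun s : ℂ => (t : ℂ) ^ (-s) := fun t ht =>
    (differentiable_id.neg).const_cpow (Or.inl (by exact_mod_cast ht.ne'))
  have h1 := hpos ((n : ℝ) + 1 + x) (by have := hx.1; positivity)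
  have h2 := hpos ((n : ℝ) + 1) (by positivity)
  have h3 := hpos ((n : ℝ) + 2) (by positivity)
  push_cast at h1 h2 h3
  exact ((h1.sub (h2.const_mul _)).sub (h3.const_mul _)).differentiableOn

lemma hurwitzZeta_eq {x : ℝ} (hx : x ∈ Set.Icc (0 : ℝ) 1) {s : ℂ} (hs : 1 < s.re) :
    HurwitzZeta.hurwitzZeta x s = (x : ℂ) ^ (-s) - x + riemannZeta s + hurwitzRem x s := by
  have h1 := HurwitzZeta.hasSum_hurwitzZeta_of_one_lt_re hx hs
  have h2 := HurwitzZeta.hasSum_hurwitzZeta_of_one_lt_re (a := 1) ⟨zero_le_one, le_rfl⟩ hs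
  have hz : HurwitzZeta.hurwitzZeta ((1 : ℝ) : UnitAddCircle) s = riemannZeta s := by
    rw [AddCircle.coe_period]
    exact congrFun HurwitzZeta.hurwitzZeta_zero s
  rw [hz] at h2
  simp only [one_div, ← Complex.cpow_neg] at h1 h2
  have h1' := (hasSum_nat_add_iff' 1).mpr h1
  have h2' := (hasSum_nat_add_iff' 1).mpr h2
  simp only [Finset.sum_range_one, Nat.cast_zero, zero_add, Complex.ofReal_one,
    Complex.one_cpow] at h1' h2'
  have h3 := (h1'.sub (h2.mul_left (1 - (x : ℂ)))).sub (h2'.mul_left (x : ℂ))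
  have h4 : hurwitzRem x s = HurwitzZeta.hurwitzZeta x s - (x : ℂ) ^ (-s) -
      (1 - x) * riemannZeta s - x * (riemannZeta s - 1) := by
    rw [← h3.tsum_eq, hurwitzRem]
    refine tsum_congr fun n => ?_
    rw [hurwitzTerm]
    push_cast
    rw [show (n : ℂ) + 1 + 1 = n + 2 by ring]
  rw [h4]
  ring

lemma val_div_mem_Icc {q : ℕ} [NeZero q] (c : ZMod q) : (c.val : ℝ) / q ∈ Set.Icc (0 : ℝ) 1 := by
  have hq : (0 : ℝ) < q := by exact_mod_cast Nat.pos_of_ne_zero (NeZero.ne q)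
  refine ⟨by positivity, (div_le_one hq).mpr ?_⟩
  exact_mod_cast (ZMod.val_lt c).le

lemma LFunction_eqOn {q : ℕ} [NeZero q] (hq : 1 < q) {χ : DirichletCharacter ℂ q} (hχ : χ ≠ 1) :
    Set.EqOn (DirichletCharacter.LFunction χ)
      (fun s => (q : ℂ) ^ (-s) * ∑ c : ZMod q, χ c * ((((c.val : ℝ) / q : ℝ) : ℂ) ^ (-s) -
        (((c.val : ℝ) / q : ℝ) : ℂ) + hurwitzRem ((c.val : ℝ) / q) s)) lRegion := by
  have hq0 : (q : ℂ) ≠ 0 := by exact_mod_cast NeZero.ne q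
  have hχ0 : χ 0 = 0 := by
    have : Fact (1 < q) := ⟨hq⟩
    exact χ.map_nonunit not_isUnit_zero
  refine AnalyticOnNhd.eqOn_of_preconnected_of_eventuallyEq (𝕜 := ℂ) (E := ℂ) (F := ℂ)
    (z₀ := 2) ?_ ?_
    isPreconnected_lRegion ?_ ?_
  · exact (DirichletCharacter.differentiable_LFunction hχ).differentiableOn.analyticOnNhd
      isOpen_lRegion
  · refine DifferentiableOn.analyticOnNhd ?_ isOpen_lRegion
    refine DifferentiableOn.mul ?_ ?_
    · exact ((differentiable_id.neg).const_cpow (Or.inl hq0)).differentiableOn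
    · refine DifferentiableOn.fun_sum fun c _ => ?_
      by_cases hc : c = 0
      · simp only [hc, hχ0, zero_mul]
        exact differentiableOn_const _
      · refine DifferentiableOn.const_mul ?_ _
        have hx : (((c.val : ℝ) / q : ℝ) : ℂ) ≠ 0 := by
          have h1 : c.val ≠ 0 := fun h => hc ((ZMod.val_eq_zero c).mp h)
          push_cast
          exact div_ne_zero (by exact_mod_cast h1) hq0
        refine DifferentiableOn.add (DifferentiableOn.sub ?_ (differentiableOn_const _))
          (differentiableOn_hurwitzRem (val_div_mem_Icc c))
        exact ((differentiable_id.neg).const_cpow (Or.inl hx)).differentiableOn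
  · refine ⟨?_, ?_⟩
    · simp only [Set.mem_ofPred_eq, Complex.re_ofNat]
      norm_num
    · simp only [Metric.mem_ball, dist_zero_right, Complex.norm_ofNat]
      norm_num
  · have hopen : IsOpen {s : ℂ | 1 < s.re} := isOpen_lt continuous_const Complex.continuous_re
    filter_upwards [hopen.mem_nhds (show (2 : ℂ) ∈ {s : ℂ | 1 < s.re} by simp)] with s hs
    rw [DirichletCharacter.LFunction, ZMod.LFunction]
    congr 1
    have hsum : ∑ c : ZMod q, χ c * riemannZeta s = 0 := by
      rw [← Finset.sum_mul, MulChar.sum_eq_zero_of_ne_one hχ, zero_mul]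
    rw [← sub_eq_zero, ← Finset.sum_sub_distrib, ← hsum]
    refine Finset.sum_congr rfl fun c _ => ?_
    rw [ZMod.toAddCircle_apply, hurwitzZeta_eq (val_div_mem_Icc c) hs]
    ring

lemma zero_mem_lRegion : (0 : ℂ) ∈ lRegion := by
  refine ⟨?_, by simp⟩
  simp

lemma one_mem_lRegion : (1 : ℂ) ∈ lRegion := by
  refine ⟨?_, by simp⟩
  simp only [Set.mem_ofPred_eq, Complex.one_re]
  norm_num

lemma LFunction_zero_eq {q : ℕ} [NeZero q] (hq : 1 < q) {χ : DirichletCharacter ℂ q}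
    (hχ : χ ≠ 1) : DirichletCharacter.LFunction χ 0 = -∑ c : ZMod q, χ c * (zsaw c : ℝ) := by
  have hχ0 : χ 0 = 0 := by
    have : Fact (1 < q) := ⟨hq⟩
    exact χ.map_nonunit not_isUnit_zero
  have hrem : ∀ x : ℝ, hurwitzRem x 0 = 0 := by
    intro x
    rw [hurwitzRem]
    simp [hurwitzTerm]
  rw [LFunction_eqOn hq hχ zero_mem_lRegion]
  simp only [neg_zero, Complex.cpow_zero, one_mul, hrem, add_zero]
  have hsum : ∑ c : ZMod q, χ c * (1 / 2 : ℂ) = 0 := by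
    rw [← Finset.sum_mul, MulChar.sum_eq_zero_of_ne_one hχ, zero_mul]
  rw [← sub_eq_zero, sub_neg_eq_add, ← Finset.sum_add_distrib, ← hsum]
  refine Finset.sum_congr rfl fun c _ => ?_
  by_cases hc : c = 0
  · rw [hc, hχ0]
    ring
  · have hq' : (0 : ℝ) < q := by exact_mod_cast (by omega : 0 < q)
    have h1 : 0 < c.val := Nat.pos_of_ne_zero fun h => hc ((ZMod.val_eq_zero c).mp h)
    have h1' : (0 : ℝ) < c.val := by exact_mod_cast h1
    have h2 : Int.fract ((c.val : ℝ) / q) = (c.val : ℝ) / q := by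
      rw [Int.fract_eq_self]
      refine ⟨by positivity, (div_lt_one hq').mpr ?_⟩
      exact_mod_cast ZMod.val_lt c
    rw [zsaw, saw, h2, if_neg (by positivity)]
    push_cast
    ring

lemma exists_LFunction_one_coeff :
    ∃ K : ℝ, 0 < K ∧ ∀ q : ℕ, [NeZero q] → 1 < q → ∃ h : ZMod q → ℝ,
      (∀ c, |h c - 1 / c.val| ≤ K / q) ∧ ∀ χ : DirichletCharacter ℂ q, χ ≠ 1 →
        DirichletCharacter.LFunction χ 1 = ∑ c, χ c * (h c : ℝ) := by
  set S : ℝ := ∑' n : ℕ, 220 * ((n : ℝ) + 1) ^ (-(3 / 2) : ℝ) with hS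
  have hS0 : 0 ≤ S := tsum_nonneg fun n => by positivity
  refine ⟨1 + S, by positivity, fun q _ hq => ?_⟩
  have hq' : (0 : ℝ) < q := by exact_mod_cast (by omega : 0 < q)
  set t : ℝ → ℕ → ℝ := fun x n => ((n : ℝ) + 1 + x)⁻¹ - (1 - x) * ((n : ℝ) + 1)⁻¹ -
    x * ((n : ℝ) + 2)⁻¹ with ht
  have hterm : ∀ x n, hurwitzTerm x n 1 = (t x n : ℂ) := by
    intro x n
    rw [hurwitzTerm, ht]
    simp only [Complex.cpow_neg_one]
    push_cast
    rfl
  have hrem : ∀ x, hurwitzRem x 1 = ((∑' n, t x n : ℝ) : ℂ) := by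
    intro x
    rw [hurwitzRem, Complex.ofReal_tsum]
    exact tsum_congr fun n => hterm x n
  refine ⟨fun c => (1 / q : ℝ) * (((c.val : ℝ) / q)⁻¹ - (c.val : ℝ) / q +
    ∑' n, t ((c.val : ℝ) / q) n), fun c => ?_, fun χ hχ => ?_⟩
  · have hx := val_div_mem_Icc c
    have h1 : |∑' n, t ((c.val : ℝ) / q) n| ≤ S := by
      rw [← Real.norm_eq_abs]
      refine tsum_of_norm_bounded (summable_add_one_rpow.mul_left 220).hasSum fun n => ?_
      have := norm_hurwitzTerm_le_of_mem hx n one_mem_lRegion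
      rwa [hterm, Complex.norm_real] at this
    have h2 : (1 / q : ℝ) * (((c.val : ℝ) / q)⁻¹ - (c.val : ℝ) / q +
        ∑' n, t ((c.val : ℝ) / q) n) - 1 / c.val =
        (-((c.val : ℝ) / q) + ∑' n, t ((c.val : ℝ) / q) n) / q := by
      rw [inv_div]
      have : (1 / q : ℝ) * (q / c.val) = 1 / c.val := by
        rw [one_div, ← mul_div_assoc, inv_mul_cancel₀ hq'.ne']
      linear_combination this
    rw [h2, abs_div, Nat.abs_cast]
    gcongr
    refine (abs_add_le _ _).trans (add_le_add ?_ h1)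
    rw [abs_neg, abs_of_nonneg hx.1]
    exact hx.2
  · rw [LFunction_eqOn hq hχ one_mem_lRegion]
    simp only [hrem, Complex.cpow_neg_one]
    rw [Finset.mul_sum]
    refine Finset.sum_congr rfl fun c _ => ?_
    push_cast
    ring

lemma norm_gaussSum_stdAddChar {q : ℕ} [Fact q.Prime] {χ : DirichletCharacter ℂ q} (hχ : χ ≠ 1) :
    ‖gaussSum χ (ZMod.stdAddChar (N := q))‖ = Real.sqrt q := by
  have h := gaussSum_mul_gaussSum_eq_card hχ (ZMod.isPrimitive_stdAddChar q)
  have h1 : (‖gaussSum χ (ZMod.stdAddChar (N := q))‖ ^ 2 : ℝ) = q := by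
    rw [← star_gaussSum_eq, ZMod.card] at h
    have h2 := congrArg norm h
    rwa [norm_mul, norm_star, ← sq, Complex.norm_natCast] at h2
  rw [← h1, Real.sqrt_sq (norm_nonneg _)]

lemma isPrimitive_of_prime {q : ℕ} (hq : q.Prime) {χ : DirichletCharacter ℂ q} (hχ : χ ≠ 1) :
    χ.IsPrimitive := by
  have : NeZero q := ⟨hq.ne_zero⟩
  rw [DirichletCharacter.isPrimitive_def]
  refine ((Nat.dvd_prime hq).mp χ.conductor_dvd_level).resolve_left fun h => hχ ?_
  exact DirichletCharacter.eq_one_iff_conductor_eq_one.mpr h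

lemma ZMod_LFunction_const_mul {q : ℕ} [NeZero q] (a : ℂ) (Φ : ZMod q → ℂ) (s : ℂ) :
    ZMod.LFunction (fun k => a * Φ k) s = a * ZMod.LFunction Φ s := by
  simp only [ZMod.LFunction, mul_assoc, ← Finset.mul_sum]
  ring

lemma norm_LFunction_zero_le {q : ℕ} [Fact q.Prime] {χ : DirichletCharacter ℂ q} (hχ : χ ≠ 1) :
    ‖DirichletCharacter.LFunction χ 0‖ ≤
      Real.sqrt q * ‖DirichletCharacter.LFunction χ⁻¹ 1‖ := by
  have hq : q.Prime := Fact.out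
  have hprim := isPrimitive_of_prime hq hχ
  have hdft : ZMod.dft (⇑χ) =
      fun k => (χ⁻¹ (-1) * gaussSum χ (ZMod.stdAddChar (N := q))) * χ⁻¹ k := by
    funext k
    rw [hprim.fourierTransform_eq_inv_mul_gaussSum, neg_eq_neg_one_mul k, map_mul]
    ring
  have hdft' : ZMod.dft (fun x => χ (-x)) =
      fun k => (gaussSum χ (ZMod.stdAddChar (N := q))) * χ⁻¹ k := by
    rw [ZMod.dft_comp_neg]
    funext k
    rw [hprim.fourierTransform_eq_inv_mul_gaussSum, neg_neg]
    ring
  have h := ZMod.LFunction_one_sub (⇑χ) (s := 1) (fun n hn => by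
    have := congrArg Complex.re hn
    simp at this
    linarith [Nat.cast_nonneg (α := ℝ) n]) (Or.inl (χ.map_nonunit not_isUnit_zero))
  rw [sub_self, hdft, hdft', ZMod_LFunction_const_mul, ZMod_LFunction_const_mul] at h
  rw [DirichletCharacter.LFunction, h, DirichletCharacter.LFunction]
  set Λ := ZMod.LFunction (⇑χ⁻¹) 1
  set G := gaussSum χ (ZMod.stdAddChar (N := q)) with hG
  have hGn : ‖G‖ = Real.sqrt q := norm_gaussSum_stdAddChar hχ
  have hexp : ∀ t : ℝ, ‖cexp (t * I)‖ = 1 := Complex.norm_exp_ofReal_mul_I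
  have e1 : cexp (↑π * I * 1 / 2) = cexp ((π / 2 : ℝ) * I) := by
    congr 1; push_cast; ring
  have e2 : cexp (-↑π * I * 1 / 2) = cexp ((-π / 2 : ℝ) * I) := by
    congr 1; push_cast; ring
  have h1 : ‖cexp (↑π * I * 1 / 2) * (χ⁻¹ (-1) * G * Λ) + cexp (-↑π * I * 1 / 2) * (G * Λ)‖ ≤
      2 * (Real.sqrt q * ‖Λ‖) := by
    refine (norm_add_le _ _).trans ?_
    simp only [e1, e2, norm_mul, hexp, hGn]
    have h3 : ‖χ⁻¹ (-1)‖ ≤ 1 := DirichletCharacter.norm_le_one _ _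
    have h4 : ‖χ⁻¹ (-1)‖ * (Real.sqrt q * ‖Λ‖) ≤ 1 * (Real.sqrt q * ‖Λ‖) := by gcongr
    linarith
  rw [norm_mul]
  have h2 : ‖(q : ℂ) ^ (0 : ℂ) * (2 * (π : ℂ)) ^ (-1 : ℂ) * Gamma 1‖ = 1 / (2 * π) := by
    rw [Complex.cpow_zero, Complex.Gamma_one, one_mul, mul_one, Complex.cpow_neg_one,
      norm_inv, norm_mul, Complex.norm_real, Real.norm_eq_abs, abs_of_pos Real.pi_pos]
    simp
  rw [h2]
  have h3 : (1 : ℝ) / (2 * π) ≤ 1 / 2 := by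
    gcongr
    linarith [Real.pi_gt_three]
  have h4 := mul_le_mul h3 h1 (norm_nonneg _) (by norm_num)
  linarith

lemma sum_one_div_val {q : ℕ} [NeZero q] : ∑ c : ZMod q, (1 : ℝ) / c.val ≤ 1 + Real.log q := by
  have h := sum_range_natCast_zmod (q := q) fun c : ZMod q => (1 : ℝ) / c.val
  rw [← h]
  have hq : 0 < q := Nat.pos_of_ne_zero (NeZero.ne q)
  calc ∑ t ∈ Finset.range q, (1 : ℝ) / ((t : ZMod q).val : ℝ) = ∑ t ∈ Finset.range q, (1 : ℝ) / t :=
        Finset.sum_congr rfl fun t ht => by rw [ZMod.val_cast_of_lt (Finset.mem_range.mp ht)]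
    _ ≤ ∑ t ∈ insert 0 (Finset.Icc 1 q), (1 : ℝ) / t := by
        refine Finset.sum_le_sum_of_subset_of_nonneg (fun t ht => ?_) fun t _ _ => by positivity
        rw [Finset.mem_range] at ht
        rw [Finset.mem_insert, Finset.mem_Icc]
        omega
    _ = ∑ t ∈ Finset.Icc 1 q, (1 : ℝ) / t := by
        rw [Finset.sum_insert (by simp)]
        simp
    _ ≤ 1 + Real.log q := sum_Icc_inv_le q

lemma sum_abs_le_of_abs_sub_one_div_val {q : ℕ} [NeZero q] {K : ℝ} {h : ZMod q → ℝ}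
    (hh : ∀ c, |h c - 1 / c.val| ≤ K / q) : ∑ c, |h c| ≤ 1 + Real.log q + K := by
  have hq : (q : ℝ) ≠ 0 := by exact_mod_cast NeZero.ne q
  calc ∑ c, |h c| ≤ ∑ c : ZMod q, (1 / (c.val : ℝ) + K / q) := by
        refine Finset.sum_le_sum fun c _ => ?_
        have h1 := abs_add_le (1 / (c.val : ℝ)) (h c - 1 / c.val)
        rw [add_sub_cancel, abs_of_nonneg (by positivity : (0 : ℝ) ≤ 1 / (c.val : ℝ))] at h1
        linarith [hh c]
    _ = ∑ c : ZMod q, 1 / (c.val : ℝ) + K := by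
        rw [Finset.sum_add_distrib, Finset.sum_const, Finset.card_univ, ZMod.card, nsmul_eq_mul,
          mul_div_cancel₀ _ hq]
    _ ≤ 1 + Real.log q + K := by linarith [sum_one_div_val (q := q)]

lemma norm_sum_char_mul_le {q : ℕ} (χ : DirichletCharacter ℂ q) [NeZero q] (f : ZMod q → ℝ) :
    ‖∑ c, χ c * (f c : ℝ)‖ ≤ ∑ c, |f c| := by
  refine norm_sum_le_of_le _ fun c _ => ?_
  rw [norm_mul, Complex.norm_real, Real.norm_eq_abs]
  exact mul_le_of_le_one_left (abs_nonneg _) (DirichletCharacter.norm_le_one _ _)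

/-! ### The Euler product -/

lemma aCoef_mul {m n : ℕ} (h : m.Coprime n) : aCoef (m * n) = aCoef m * aCoef n := by
  rcases eq_or_ne m 0 with rfl | hm
  · simp [aCoef]
  rcases eq_or_ne n 0 with rfl | hn
  · simp [aCoef]
  rw [aCoef_eq hm, aCoef_eq hn, aCoef_eq (mul_ne_zero hm hn), h.primeFactors_mul,
    Finset.prod_union h.disjoint_primeFactors]
  congr 1
  · refine Finset.prod_congr rfl fun p hp => ?_
    rw [Nat.factorization_eq_of_coprime_left h (Nat.mem_primeFactors_iff_mem_primeFactorsList.mp hp)]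
  · refine Finset.prod_congr rfl fun p hp => ?_
    rw [Nat.factorization_eq_of_coprime_right h
      (Nat.mem_primeFactors_iff_mem_primeFactorsList.mp hp)]

lemma aCoef_one : aCoef 1 = 1 := by simp [aCoef]

lemma aCoef_prime_pow {p e : ℕ} (hp : p.Prime) (he : e ≠ 0) : aCoef (p ^ e) = aLocal p e := by
  rw [aCoef_eq (pow_ne_zero _ hp.ne_zero), Nat.primeFactors_prime_pow he hp,
    Finset.prod_singleton, hp.factorization_pow, Finsupp.single_eq_same]

lemma summable_norm_aCoef_mul {q : ℕ} (χ : DirichletCharacter ℂ q) :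
    Summable fun n : ℕ => ‖(aCoef n : ℂ) * χ (n : ZMod q)‖ := by
  refine Summable.of_nonneg_of_le (fun _ => norm_nonneg _) (fun n => ?_) summable_abs_aCoef
  rw [norm_mul, Complex.norm_real, Real.norm_eq_abs]
  exact mul_le_of_le_one_right (abs_nonneg _) (DirichletCharacter.norm_le_one _ _)

lemma tsum_aCoef_prime_pow {q : ℕ} (χ : DirichletCharacter ℂ q) {p : ℕ} (hp : p.Prime) :
    ∑' e : ℕ, (aCoef (p ^ e) : ℂ) * χ ((p ^ e : ℕ) : ZMod q) =
      1 + aLocal p 1 * χ (p : ZMod q) + aLocal p 2 * χ (p : ZMod q) ^ 2 := by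
  rw [tsum_eq_sum (s := Finset.range 3)]
  · rw [Finset.sum_range_succ, Finset.sum_range_succ, Finset.sum_range_one,
      aCoef_prime_pow hp one_ne_zero, aCoef_prime_pow hp two_ne_zero]
    simp [aCoef_one]
  · intro e he
    rw [Finset.mem_range, not_lt] at he
    rw [aCoef_prime_pow hp (by omega), aLocal_eq_zero (by omega)]
    simp

lemma Cq_factor_mem_Icc (q : ℕ) (p : Nat.Primes) :
    (if (p : ℕ) = 2 ∨ (p : ℕ) ∣ q then (1 : ℝ) else 1 - 1 / ((p : ℝ) - 1) ^ 2) ∈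
      Set.Icc (0 : ℝ) 1 := by
  split_ifs with h
  · exact ⟨zero_le_one, le_rfl⟩
  · push Not at h
    have h2 : (2 : ℝ) ≤ p := by exact_mod_cast p.2.two_le
    have h3 : 1 / ((p : ℝ) - 1) ^ 2 ≤ 1 := by
      rw [div_le_one (by nlinarith)]
      nlinarith
    have h4 : 0 ≤ 1 / ((p : ℝ) - 1) ^ 2 := by positivity
    exact ⟨by linarith, by linarith⟩

lemma hasProd_Cq (q : ℕ) :
    HasProd (fun p : Nat.Primes => if (p : ℕ) = 2 ∨ (p : ℕ) ∣ q then (1 : ℝ)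
      else 1 - 1 / ((p : ℝ) - 1) ^ 2) (Cq q / 2) := by
  have hm : Multipliable fun p : Nat.Primes => if (p : ℕ) = 2 ∨ (p : ℕ) ∣ q then (1 : ℝ)
      else 1 - 1 / ((p : ℝ) - 1) ^ 2 := by
    have hs : Summable fun p : Nat.Primes =>
        ‖(if (p : ℕ) = 2 ∨ (p : ℕ) ∣ q then (0 : ℝ) else -(1 / ((p : ℝ) - 1) ^ 2))‖ := by
      have h1 : Summable fun n : ℕ => 4 * (1 / (n : ℝ) ^ 2) :=
        (Real.summable_one_div_nat_pow.mpr one_lt_two).mul_left 4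
      refine Summable.of_nonneg_of_le (fun _ => norm_nonneg _) (fun p => ?_)
        (h1.comp_injective (i := fun p : Nat.Primes => (p : ℕ)) Subtype.val_injective)
      have h2 : (2 : ℝ) ≤ p := by exact_mod_cast p.2.two_le
      split_ifs with h
      · rw [norm_zero]
        simp only [Function.comp_apply]
        positivity
      · rw [norm_neg, Real.norm_eq_abs, abs_of_nonneg (by positivity), Function.comp_apply,
          ← mul_div_assoc, mul_one, div_le_div_iff₀ (by nlinarith) (by nlinarith)]
        nlinarith
    refine (multipliable_one_add_of_summable hs).congr fun p => ?_
    split_ifs <;> ring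
  have h := hm.hasProd
  have h2 : Cq q / 2 = ∏' p : Nat.Primes, (if (p : ℕ) = 2 ∨ (p : ℕ) ∣ q then (1 : ℝ)
      else 1 - 1 / ((p : ℝ) - 1) ^ 2) := by
    rw [Cq]
    ring
  rw [h2]
  exact h

lemma Cq_mem_Icc (q : ℕ) : Cq q ∈ Set.Icc (0 : ℝ) 2 := by
  have h := hasProd_Cq q
  have h0 : 0 ≤ Cq q / 2 :=
    ge_of_tendsto' h fun s => Finset.prod_nonneg fun p _ => (Cq_factor_mem_Icc q p).1
  have h1 : Cq q / 2 ≤ 1 :=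
    le_of_tendsto' h fun s => Finset.prod_le_one (fun p _ => (Cq_factor_mem_Icc q p).1)
      fun p _ => (Cq_factor_mem_Icc q p).2
  exact ⟨by linarith, by linarith⟩

lemma abs_Cq_le (q : ℕ) : |Cq q| ≤ 2 := by
  rw [abs_of_nonneg (Cq_mem_Icc q).1]
  exact (Cq_mem_Icc q).2

lemma Aq_factor_eq {q : ℕ} (hq : q.Prime) (hodd : Odd q) (χ : DirichletCharacter ℂ q)
    (p : Nat.Primes) :
    (if (p : ℕ) ∣ q then (1 : ℂ) else
      1 - (1 - χ ((p : ℕ) : ZMod q)) ^ 2 / (((p : ℕ) : ℂ) - 1) ^ 2) =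
    (((if (p : ℕ) = 2 ∨ (p : ℕ) ∣ q then (1 : ℝ) else 1 - 1 / ((p : ℝ) - 1) ^ 2) : ℝ) : ℂ) *
      (1 + aLocal p 1 * χ (p : ZMod q) + aLocal p 2 * χ (p : ZMod q) ^ 2) *
      (if p = ⟨2, Nat.prime_two⟩ then 2 * χ 2 else 1) := by
  by_cases hp : (p : ℕ) ∣ q
  · have hpq : (p : ℕ) = q := (Nat.prime_dvd_prime_iff_eq p.2 hq).mp hp
    have hp2 : p ≠ ⟨2, Nat.prime_two⟩ := by
      intro h
      rw [h] at hpq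
      change 2 = q at hpq
      rw [← hpq] at hodd
      exact absurd hodd (by decide)
    have : Fact (1 < q) := ⟨hq.one_lt⟩
    rw [if_pos hp, if_pos (Or.inr hp), if_neg hp2, hpq, ZMod.natCast_self,
      χ.map_nonunit not_isUnit_zero]
    simp
  · rw [if_neg hp]
    by_cases hp2 : (p : ℕ) = 2
    · have hp2' : p = ⟨2, Nat.prime_two⟩ := Subtype.ext hp2
      rw [if_pos (Or.inl hp2), if_pos hp2', hp2]
      simp only [aLocal, Nat.cast_ofNat]
      norm_num
      ring
    · have hp2' : p ≠ ⟨2, Nat.prime_two⟩ := fun h => hp2 (congrArg Subtype.val h)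
      rw [if_neg (by tauto), if_neg hp2']
      simp only [aLocal, if_neg hp2, if_true, show (2 : ℕ) ≠ 1 by decide, if_false]
      have h3 : 3 ≤ (p : ℕ) := by
        have := p.2.two_le
        omega
      have hc0 : ((p : ℕ) : ℂ) ≠ 0 := by exact_mod_cast (by omega : (p : ℕ) ≠ 0)
      have hc1 : ((p : ℕ) : ℂ) - 1 ≠ 0 := by
        rw [sub_ne_zero]
        exact_mod_cast (by omega : (p : ℕ) ≠ 1)
      have hc2 : ((p : ℕ) : ℂ) - 2 ≠ 0 := by
        rw [sub_ne_zero]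
        exact_mod_cast (by omega : (p : ℕ) ≠ 2)
      push_cast
      field_simp
      ring

lemma Aq_eq {q : ℕ} (hq : q.Prime) (hodd : Odd q) (χ : DirichletCharacter ℂ q) :
    Aq q χ = Cq q * χ 2 * ∑' u : ℕ, (aCoef u : ℂ) * χ (u : ZMod q) := by
  have h1 : HasProd (fun p : Nat.Primes =>
      (((if (p : ℕ) = 2 ∨ (p : ℕ) ∣ q then (1 : ℝ) else 1 - 1 / ((p : ℝ) - 1) ^ 2) : ℝ) : ℂ))
      ((Cq q / 2 : ℝ) : ℂ) :=
    (hasProd_Cq q).map Complex.ofRealHom Complex.continuous_ofReal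
  have : Fact (1 < q) := ⟨hq.one_lt⟩
  have h2 := EulerProduct.eulerProduct_hasProd
    (f := fun n : ℕ => (aCoef n : ℂ) * χ (n : ZMod q)) (by simp [aCoef_one])
    (fun {m n} hmn => by
      simp only [aCoef_mul hmn, Nat.cast_mul, map_mul, Complex.ofReal_mul]
      ring) (summable_norm_aCoef_mul χ) (by simp [aCoef])
  simp only [fun p : Nat.Primes => tsum_aCoef_prime_pow χ p.2] at h2
  have h3 : HasProd (fun p : Nat.Primes => if p = ⟨2, Nat.prime_two⟩ then 2 * χ 2 else 1)
      (2 * χ 2) := by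
    have h := hasProd_single (f := fun p : Nat.Primes =>
      if p = ⟨2, Nat.prime_two⟩ then 2 * χ 2 else 1) ⟨2, Nat.prime_two⟩ (fun p hp => if_neg hp)
    convert h using 1
    exact (if_pos rfl).symm
  have h4 := (h1.mul h2).mul h3
  simp only [← Aq_factor_eq hq hodd χ] at h4
  rw [Aq, h4.tprod_eq]
  push_cast
  ring

/-! ### Fourier analysis over the characters modulo a prime -/

lemma sum_char_inv_mul_sum {q : ℕ} [Fact q.Prime] (G : ZMod q → ℂ) (hG : G 0 = 0) (k : ZMod q) :
    ∑ χ : DirichletCharacter ℂ q, χ k⁻¹ * ∑ m, χ m * G m = (q.totient : ℂ) * G k := by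
  rcases eq_or_ne k 0 with rfl | hk
  · rw [hG, mul_zero]
    refine Finset.sum_eq_zero fun χ _ => ?_
    rw [inv_zero, χ.map_nonunit not_isUnit_zero, zero_mul]
  simp only [Finset.mul_sum]
  rw [Finset.sum_comm]
  calc ∑ m, ∑ χ : DirichletCharacter ℂ q, χ k⁻¹ * (χ m * G m)
      = ∑ m, (∑ χ : DirichletCharacter ℂ q, χ k⁻¹ * χ m) * G m :=
        Finset.sum_congr rfl fun m _ => by
          rw [Finset.sum_mul]
          exact Finset.sum_congr rfl fun χ _ => by ring
    _ = (q.totient : ℂ) * G k := by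
        simp only [DirichletCharacter.sum_char_inv_mul_char_eq ℂ (isUnit_iff_ne_zero.mpr hk)]
        simp [ite_mul]

lemma conj_char_apply {q : ℕ} [Fact q.Prime] (χ : DirichletCharacter ℂ q) (k : ZMod q) :
    (starRingEnd ℂ) (χ k) = χ k⁻¹ := by
  rw [starRingEnd_apply, MulChar.star_apply', MulChar.inv_apply']

lemma sum_norm_sq_sum_char {q : ℕ} [Fact q.Prime] (G : ZMod q → ℝ) (hG : G 0 = 0) :
    ∑ χ : DirichletCharacter ℂ q, ‖∑ m, χ m * (G m : ℂ)‖ ^ 2 = q.totient * ∑ k, G k ^ 2 := by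
  have h : ((∑ χ : DirichletCharacter ℂ q, ‖∑ m, χ m * (G m : ℂ)‖ ^ 2 : ℝ) : ℂ) =
      ((q.totient * ∑ k, G k ^ 2 : ℝ) : ℂ) := by
    push_cast
    calc ∑ χ : DirichletCharacter ℂ q, (‖∑ m, χ m * (G m : ℂ)‖ : ℂ) ^ 2
        = ∑ χ : DirichletCharacter ℂ q, ∑ k, (G k : ℂ) * (χ k⁻¹ * ∑ m, χ m * (G m : ℂ)) := by
          refine Finset.sum_congr rfl fun χ _ => ?_
          rw [← Complex.conj_mul', map_sum, Finset.sum_mul]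
          refine Finset.sum_congr rfl fun k _ => ?_
          rw [map_mul, conj_char_apply, Complex.conj_ofReal]
          ring
      _ = ∑ k, (G k : ℂ) * ((q.totient : ℂ) * G k) := by
          rw [Finset.sum_comm]
          refine Finset.sum_congr rfl fun k _ => ?_
          rw [← Finset.mul_sum, sum_char_inv_mul_sum (fun m => (G m : ℂ)) (by simp [hG])]
      _ = _ := by
          rw [Finset.mul_sum]
          exact Finset.sum_congr rfl fun k _ => by ring
  exact_mod_cast h

lemma zsaw_zero (q : ℕ) : zsaw (0 : ZMod q) = 0 := by
  simp [zsaw, saw_zero]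

lemma zsaw_neg {q : ℕ} [NeZero q] (c : ZMod q) : zsaw (-c) = -zsaw c := by
  have hq : 0 < q := Nat.pos_of_ne_zero (NeZero.ne q)
  have hq' : (q : ℝ) ≠ 0 := by exact_mod_cast hq.ne'
  rw [zsaw, zsaw, ZMod.neg_val]
  split_ifs with h
  · simp [h, saw_zero]
  · rw [Nat.cast_sub (ZMod.val_lt c).le, sub_div, div_self hq', sub_eq_neg_add, ← saw_neg]
    have := saw_add_nat (-((c.val : ℝ) / q)) 1
    simpa using this

/-- The multiplicative convolution of `h` with the sawtooth function modulo `q`. -/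
noncomputable def mulConv {q : ℕ} [NeZero q] (h : ZMod q → ℝ) (k : ZMod q) : ℝ :=
  ∑ c, h c * zsaw (k * c⁻¹)

lemma mulConv_zero {q : ℕ} [NeZero q] (h : ZMod q → ℝ) : mulConv h 0 = 0 := by
  simp [mulConv, zsaw_zero]

lemma mulConv_neg {q : ℕ} [NeZero q] (h : ZMod q → ℝ) (k : ZMod q) :
    mulConv h (-k) = -mulConv h k := by
  simp only [mulConv, neg_mul, zsaw_neg, mul_neg, Finset.sum_neg_distrib]

lemma abs_mulConv_le {q : ℕ} [NeZero q] (h : ZMod q → ℝ) (k : ZMod q) :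
    |mulConv h k| ≤ ∑ c, |h c| := by
  refine (Finset.abs_sum_le_sum_abs _ _).trans (Finset.sum_le_sum fun c _ => ?_)
  rw [abs_mul]
  exact mul_le_of_le_one_right (abs_nonneg _) (abs_zsaw_le _)

lemma sum_char_mul_comp_mul {q : ℕ} [Fact q.Prime] (χ : DirichletCharacter ℂ q) {G : ZMod q → ℂ}
    (hG : G 0 = 0) (c : ZMod q) :
    ∑ k, χ k * G (k * c⁻¹) = χ c * ∑ k, χ k * G k := by
  rcases eq_or_ne c 0 with rfl | hc
  · simp [hG, χ.map_nonunit not_isUnit_zero]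
  rw [Finset.mul_sum, ← Equiv.sum_comp (Equiv.mulRight₀ c hc)]
  refine Finset.sum_congr rfl fun k _ => ?_
  rw [Equiv.mulRight₀_apply, map_mul, mul_inv_cancel_right₀ hc]
  ring

lemma sum_char_mul_mulConv {q : ℕ} [Fact q.Prime] (χ : DirichletCharacter ℂ q) (h : ZMod q → ℝ) :
    ∑ k, χ k * (mulConv h k : ℂ) = (∑ c, χ c * (h c : ℂ)) * ∑ k, χ k * (zsaw k : ℂ) := by
  rw [Finset.sum_mul]
  simp only [mulConv, Complex.ofReal_sum, Finset.mul_sum]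
  rw [Finset.sum_comm]
  refine Finset.sum_congr rfl fun c _ => ?_
  have h1 := sum_char_mul_comp_mul χ (G := fun k => (zsaw k : ℂ)) (by simp [zsaw_zero]) c
  rw [← Finset.mul_sum, mul_right_comm, ← h1, Finset.sum_mul]
  refine Finset.sum_congr rfl fun k _ => ?_
  push_cast
  ring

lemma sum_one_char_mul_zsaw {q : ℕ} [Fact q.Prime] :
    ∑ k : ZMod q, (1 : DirichletCharacter ℂ q) k * (zsaw k : ℂ) = 0 := by
  have h : ∑ k : ZMod q, (1 : DirichletCharacter ℂ q) k * (zsaw k : ℂ) =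
      -∑ k : ZMod q, (1 : DirichletCharacter ℂ q) k * (zsaw k : ℂ) := by
    conv_lhs => rw [← Equiv.sum_comp (Equiv.neg (ZMod q))]
    rw [← Finset.sum_neg_distrib]
    refine Finset.sum_congr rfl fun k _ => ?_
    rw [Equiv.neg_apply, zsaw_neg]
    rcases eq_or_ne k 0 with rfl | hk
    · simp [zsaw_zero]
    · rw [MulChar.one_apply (isUnit_iff_ne_zero.mpr hk),
        MulChar.one_apply (isUnit_iff_ne_zero.mpr (neg_ne_zero.mpr hk))]
      push_cast
      ring
  exact self_eq_neg.mp h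

lemma sum_sq_mulConv_le {q : ℕ} [Fact q.Prime] {B : ℝ}
    (hB : ∀ χ : DirichletCharacter ℂ q, χ ≠ 1 → ‖DirichletCharacter.LFunction χ 0‖ ≤ B)
    (e : ZMod q → ℝ) (he : e 0 = 0) : ∑ k, mulConv e k ^ 2 ≤ B ^ 2 * ∑ c, e c ^ 2 := by
  have hq : q.Prime := Fact.out
  have hφ : (0 : ℝ) < q.totient := by exact_mod_cast Nat.totient_pos.mpr hq.pos
  refine le_of_mul_le_mul_left ?_ hφ
  rw [mul_left_comm, ← sum_norm_sq_sum_char _ (mulConv_zero e), ← sum_norm_sq_sum_char _ he,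
    Finset.mul_sum]
  refine Finset.sum_le_sum fun χ _ => ?_
  rw [sum_char_mul_mulConv, norm_mul, mul_pow, mul_comm]
  refine mul_le_mul_of_nonneg_right ?_ (by positivity)
  rcases eq_or_ne χ 1 with rfl | hχ
  · rw [sum_one_char_mul_zsaw, norm_zero, zero_pow two_ne_zero]
    exact sq_nonneg B
  · have h1 := hB χ hχ
    rw [LFunction_zero_eq hq.one_lt hχ, norm_neg] at h1
    gcongr

/-- The multiplicative convolution of `aCoef` with `mulConv h`. -/
noncomputable def aConv {q : ℕ} [NeZero q] (h : ZMod q → ℝ) (k : ZMod q) : ℝ :=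
  ∑' u : ℕ, aCoef u * mulConv h (k * (u : ZMod q)⁻¹)

lemma summable_aConv {q : ℕ} [NeZero q] (h : ZMod q → ℝ) (k : ZMod q) :
    Summable fun u : ℕ => |aCoef u * mulConv h (k * (u : ZMod q)⁻¹)| := by
  refine Summable.of_nonneg_of_le (fun _ => abs_nonneg _) (fun u => ?_)
    (summable_abs_aCoef.mul_right (∑ c, |h c|))
  rw [abs_mul]
  exact mul_le_mul_of_nonneg_left (abs_mulConv_le _ _) (abs_nonneg _)

lemma aConv_zero {q : ℕ} [NeZero q] (h : ZMod q → ℝ) : aConv h 0 = 0 := by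
  simp [aConv, mulConv_zero]

lemma aConv_neg {q : ℕ} [NeZero q] (h : ZMod q → ℝ) (k : ZMod q) :
    aConv h (-k) = -aConv h k := by
  simp only [aConv, neg_mul, mulConv_neg, mul_neg, tsum_neg]

lemma sum_char_mul_aConv {q : ℕ} [Fact q.Prime] (χ : DirichletCharacter ℂ q) (h : ZMod q → ℝ) :
    ∑ k, χ k * (aConv h k : ℂ) =
      (∑' u : ℕ, (aCoef u : ℂ) * χ (u : ZMod q)) * ∑ k, χ k * (mulConv h k : ℂ) := by
  have hs : ∀ k : ZMod q, Summable fun u : ℕ =>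
      χ k * ((aCoef u * mulConv h (k * (u : ZMod q)⁻¹) : ℝ) : ℂ) := by
    intro k
    refine Summable.mul_left _ ?_
    exact_mod_cast (summable_aConv h k).of_abs
  simp only [aConv, Complex.ofReal_tsum, ← tsum_mul_left]
  rw [← Summable.tsum_finsetSum fun k _ => hs k, ← tsum_mul_right]
  refine tsum_congr fun u => ?_
  rw [mul_assoc, ← sum_char_mul_comp_mul χ (G := fun k => (mulConv h k : ℂ))
    (by simp [mulConv_zero]), Finset.mul_sum]
  refine Finset.sum_congr rfl fun k _ => ?_
  push_cast
  ring

lemma two_ne_zero_zmod {q : ℕ} [Fact q.Prime] (hodd : Odd q) : (2 : ZMod q) ≠ 0 := by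
  intro h
  have h1 : ((2 : ℕ) : ZMod q) = 0 := by exact_mod_cast h
  rw [ZMod.natCast_eq_zero_iff] at h1
  have h2 := (Nat.prime_dvd_prime_iff_eq Fact.out Nat.prime_two).mp h1
  rw [h2] at hodd
  exact absurd hodd (by decide)

lemma Cfun_eq {q : ℕ} [Fact q.Prime] (hodd : Odd q) {h : ZMod q → ℝ}
    (hh : ∀ χ : DirichletCharacter ℂ q, χ ≠ 1 →
      DirichletCharacter.LFunction χ 1 = ∑ c, χ c * (h c : ℝ)) (k : ℤ) :
    Cfun q k = Cq q * aConv h (-((k : ZMod q) * 2⁻¹)) := by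
  have hq : q.Prime := Fact.out
  have h2 := two_ne_zero_zmod hodd
  have hφ : (q.totient : ℂ) ≠ 0 := by exact_mod_cast (Nat.totient_pos.mpr hq.pos).ne'
  have hterm : ∀ χ : DirichletCharacter ℂ q, χ ≠ 1 →
      (starRingEnd ℂ) (χ (k : ZMod q)) * DirichletCharacter.LFunction χ 0 *
        DirichletCharacter.LFunction χ 1 * Aq q χ =
      -(Cq q : ℂ) * (χ ((k : ZMod q) * 2⁻¹)⁻¹ * ∑ m, χ m * (aConv h m : ℂ)) := by
    intro χ hχ
    rw [sum_char_mul_aConv, sum_char_mul_mulConv, ← hh χ hχ, Aq_eq hq hodd,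
      LFunction_zero_eq hq.one_lt hχ, conj_char_apply, mul_inv, inv_inv, map_mul]
    ring
  have hone : (1 : DirichletCharacter ℂ q) ((k : ZMod q) * 2⁻¹)⁻¹ *
      ∑ m, (1 : DirichletCharacter ℂ q) m * (aConv h m : ℂ) = 0 := by
    rw [sum_char_mul_aConv, sum_char_mul_mulConv, sum_one_char_mul_zsaw]
    ring
  rw [Cfun, dif_neg hq.ne_zero]
  have hsum : ∑ χ ∈ Finset.univ.filter (fun χ : DirichletCharacter ℂ q => χ ≠ 1),
      (starRingEnd ℂ) (χ (k : ZMod q)) * DirichletCharacter.LFunction χ 0 *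
        DirichletCharacter.LFunction χ 1 * Aq q χ =
      -(Cq q : ℂ) * ((q.totient : ℂ) * aConv h ((k : ZMod q) * 2⁻¹)) := by
    rw [← sum_char_inv_mul_sum (fun m => (aConv h m : ℂ)) (by simp [aConv_zero]),
      Finset.sum_congr rfl fun χ hχ => hterm χ (Finset.mem_filter.mp hχ).2, ← Finset.mul_sum]
    congr 1
    refine Finset.sum_subset (Finset.filter_subset _ _) fun χ _ hχ => ?_
    have : χ = 1 := by simpa using hχ
    rw [this, hone]
  rw [hsum, aConv_neg, mul_left_comm, inv_mul_cancel_left₀ hφ]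
  rw [neg_mul, Complex.neg_re, ← Complex.ofReal_mul, Complex.ofReal_re]
  ring

lemma sum_Cfun_pow {q : ℕ} [Fact q.Prime] (hodd : Odd q) {h : ZMod q → ℝ}
    (hh : ∀ χ : DirichletCharacter ℂ q, χ ≠ 1 →
      DirichletCharacter.LFunction χ 1 = ∑ c, χ c * (h c : ℝ)) (l : ℕ) :
    ∑ k ∈ Finset.range q, Cfun q k ^ l = Cq q ^ l * ∑ k, aConv h k ^ l := by
  have h2 := two_ne_zero_zmod hodd
  rw [Finset.mul_sum, ← Equiv.sum_comp ((Equiv.mulRight₀ (2⁻¹ : ZMod q) (inv_ne_zero h2)).trans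
    (Equiv.neg (ZMod q))), ← sum_range_natCast_zmod]
  refine Finset.sum_congr rfl fun k _ => ?_
  rw [Cfun_eq hodd hh, mul_pow]
  simp

/-! ### Truncation -/

lemma exists_LFunction_one_coeff_zero :
    ∃ K : ℝ, 0 < K ∧ ∀ q : ℕ, [NeZero q] → 1 < q → ∃ h : ZMod q → ℝ, h 0 = 0 ∧
      (∀ c, |h c - 1 / c.val| ≤ K / q) ∧ ∀ χ : DirichletCharacter ℂ q, χ ≠ 1 →
        DirichletCharacter.LFunction χ 1 = ∑ c, χ c * (h c : ℝ) := by
  obtain ⟨K, hK, H⟩ := exists_LFunction_one_coeff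
  refine ⟨K, hK, fun q _ hq => ?_⟩
  obtain ⟨h, h1, h2⟩ := H q hq
  have : Fact (1 < q) := ⟨hq⟩
  refine ⟨fun c => if c = 0 then 0 else h c, if_pos rfl, fun c => ?_, fun χ hχ => ?_⟩
  · dsimp only
    split_ifs with hc
    · simp only [hc, ZMod.val_zero, Nat.cast_zero, div_zero, sub_zero, abs_zero]
      positivity
    · exact h1 c
  · rw [h2 χ hχ]
    refine Finset.sum_congr rfl fun c _ => ?_
    dsimp only
    split_ifs with hc
    · simp [hc, χ.map_nonunit not_isUnit_zero]
    · rfl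

/-- The function `c ↦ 1 / c` on residues between `1` and `T`. -/
noncomputable def invCoeff {q : ℕ} (T : ℕ) (c : ZMod q) : ℝ :=
  if c.val ≤ T then 1 / (c.val : ℝ) else 0

lemma abs_invCoeff_le {q : ℕ} (T : ℕ) (c : ZMod q) : |invCoeff T c| ≤ 1 / (c.val : ℝ) := by
  rw [invCoeff]
  split_ifs
  · rw [abs_of_nonneg (by positivity)]
  · rw [abs_zero]
    positivity

lemma mulConv_invCoeff {q : ℕ} [NeZero q] {T : ℕ} (hT : T < q) (k : ZMod q) :
    mulConv (invCoeff T) k = ∑ v ∈ Finset.Icc 1 T, zsaw (k * (v : ZMod q)⁻¹) / v := by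
  rw [mulConv, ← sum_range_natCast_zmod fun c : ZMod q => invCoeff T c * zsaw (k * c⁻¹)]
  symm
  have hsub : Finset.Icc 1 T ⊆ Finset.range q := fun v hv => by
    rw [Finset.mem_Icc] at hv
    rw [Finset.mem_range]
    omega
  rw [← Finset.sum_subset hsub]
  · refine Finset.sum_congr rfl fun v hv => ?_
    rw [Finset.mem_Icc] at hv
    rw [invCoeff, ZMod.val_cast_of_lt (by omega), if_pos hv.2]
    ring
  · intro v hv hv'
    rw [Finset.mem_range] at hv
    rw [Finset.mem_Icc, not_and_or, not_le, not_le] at hv'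
    rw [invCoeff, ZMod.val_cast_of_lt hv]
    rcases hv' with h | h
    · have : v = 0 := by omega
      simp [this]
    · rw [if_neg (by omega), zero_mul]

lemma ztrunc_eq {q : ℕ} [Fact q.Prime] {T : ℕ} (hT : T < q) (k : ZMod q) :
    ztrunc T k =
      ∑ u ∈ Finset.Icc 1 T, aCoef u * mulConv (invCoeff T) (k * (u : ZMod q)⁻¹) := by
  rw [ztrunc]
  refine Finset.sum_congr rfl fun u _ => ?_
  rw [mulConv_invCoeff hT]
  congr 1
  refine Finset.sum_congr rfl fun v _ => ?_
  rw [Nat.cast_mul, mul_inv, mul_assoc]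

lemma abs_ztrunc_le {q : ℕ} [Fact q.Prime] {T : ℕ} (hT : T < q) (k : ZMod q) :
    |ztrunc T k| ≤ aNorm * (1 + Real.log q) := by
  rw [ztrunc_eq hT]
  have h1 : ∑ c : ZMod q, |invCoeff T c| ≤ 1 + Real.log q :=
    (Finset.sum_le_sum fun c _ => abs_invCoeff_le T c).trans sum_one_div_val
  have h0 : 0 ≤ ∑ c : ZMod q, |invCoeff T c| := Finset.sum_nonneg fun c _ => abs_nonneg _
  calc _ ≤ ∑ u ∈ Finset.Icc 1 T, |aCoef u| * ∑ c : ZMod q, |invCoeff T c| := by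
        refine Finset.abs_sum_le_sum_abs _ _ |>.trans (Finset.sum_le_sum fun u _ => ?_)
        rw [abs_mul]
        exact mul_le_mul_of_nonneg_left (abs_mulConv_le _ _) (abs_nonneg _)
    _ ≤ aNorm * (1 + Real.log q) := by
        rw [← Finset.sum_mul]
        exact mul_le_mul (sum_abs_aCoef_le _) h1 h0 aNorm_nonneg

lemma abs_aConv_le {q : ℕ} [NeZero q] (h : ZMod q → ℝ) (k : ZMod q) :
    |aConv h k| ≤ aNorm * ∑ c, |h c| := by
  have h0 : 0 ≤ ∑ c : ZMod q, |h c| := Finset.sum_nonneg fun c _ => abs_nonneg _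
  rw [aConv, ← Real.norm_eq_abs]
  refine tsum_of_norm_bounded (summable_abs_aCoef.mul_right (∑ c, |h c|)).hasSum (fun u => ?_)
    |>.trans ?_
  · rw [Real.norm_eq_abs, abs_mul]
    exact mul_le_mul_of_nonneg_left (abs_mulConv_le _ _) (abs_nonneg _)
  · rw [tsum_mul_right]
    exact mul_le_mul_of_nonneg_right
      (summable_abs_aCoef.tsum_le_of_sum_le fun s => sum_abs_aCoef_le s) h0

lemma abs_aConv_sub_sum_le {q : ℕ} [NeZero q] (h : ZMod q → ℝ) (k : ZMod q) {T : ℕ} (hT : 0 < T) :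
    |aConv h k - ∑ u ∈ Finset.Icc 1 T, aCoef u * mulConv h (k * (u : ZMod q)⁻¹)| ≤
      aNorm * (T : ℝ) ^ (-(1 / 4) : ℝ) * ∑ c, |h c| := by
  have h0 : 0 ≤ ∑ c : ZMod q, |h c| := Finset.sum_nonneg fun c _ => abs_nonneg _
  have hs := (summable_aConv h k).of_abs
  have ha0 : aCoef 0 = 0 := by simp [aCoef]
  have h1 := hs.sum_add_tsum_compl (s := Finset.Icc 1 T)
  rw [aConv, ← h1, add_sub_cancel_left, ← Real.norm_eq_abs]
  have hsa := summable_abs_aCoef.subtype ((↑(Finset.Icc 1 T) : Set ℕ)ᶜ)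
  refine tsum_of_norm_bounded (hsa.mul_right (∑ c, |h c|)).hasSum (fun u => ?_) |>.trans ?_
  · rw [Real.norm_eq_abs, abs_mul]
    exact mul_le_mul_of_nonneg_left (abs_mulConv_le _ _) (abs_nonneg _)
  · rw [tsum_mul_right]
    refine mul_le_mul_of_nonneg_right (hsa.tsum_le_of_sum_le fun s => ?_) h0
    have h2 : ∑ u ∈ s, |aCoef (u : ℕ)| = ∑ u ∈ (s.image Subtype.val).filter (fun u => T ≤ u),
        |aCoef u| := by
      rw [Finset.sum_filter_of_ne, Finset.sum_image fun a _ b _ hab => Subtype.ext hab]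
      intro u hu hne
      rw [Finset.mem_image] at hu
      obtain ⟨⟨v, hv⟩, -, rfl⟩ := hu
      have hv0 : v ≠ 0 := by
        rintro rfl
        simp [ha0] at hne
      have hv' : v ∉ Finset.Icc 1 T := hv
      rw [Finset.mem_Icc] at hv'
      change T ≤ v
      omega
    change ∑ u ∈ s, |aCoef (u : ℕ)| ≤ _
    rw [h2]
    exact sum_abs_aCoef_tail _ hT fun u hu => (Finset.mem_filter.mp hu).2

lemma mulConv_sub {q : ℕ} [NeZero q] (f g : ZMod q → ℝ) (k : ZMod q) :
    mulConv f k - mulConv g k = mulConv (fun c => f c - g c) k := by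
  simp only [mulConv, ← Finset.sum_sub_distrib, sub_mul]

lemma sum_abs_mulConv_le {q : ℕ} [NeZero q] (e : ZMod q → ℝ) {D : ℝ} (hD : 0 ≤ D)
    (h : ∑ k, mulConv e k ^ 2 ≤ q * D ^ 2) : ∑ k, |mulConv e k| ≤ q * D := by
  refine abs_le_of_sq_le_sq' ?_ (by positivity) |>.2
  have h1 := sq_sum_le_card_mul_sum_sq (s := Finset.univ) (f := fun k : ZMod q => |mulConv e k|)
  rw [Finset.card_univ, ZMod.card] at h1
  simp only [sq_abs] at h1
  refine h1.trans ?_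
  have := mul_le_mul_of_nonneg_left h (Nat.cast_nonneg (α := ℝ) q)
  linarith [this, (by ring : (q : ℝ) * (q * D ^ 2) = (q * D) ^ 2)]

lemma sum_val_gt_one_div_sq_le {q : ℕ} [NeZero q] {T : ℕ} (hT : 0 < T) :
    ∑ c : ZMod q, (if T < c.val then 1 / (c.val : ℝ) ^ 2 else (0 : ℝ)) ≤ 2 / (T : ℝ) := by
  rw [← sum_range_natCast_zmod fun c : ZMod q => if T < c.val then 1 / (c.val : ℝ) ^ 2 else (0 : ℝ)]
  calc _ = ∑ t ∈ Finset.range q, (if T < t then 1 / (t : ℝ) ^ 2 else (0 : ℝ)) :=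
        Finset.sum_congr rfl fun t ht => by rw [ZMod.val_cast_of_lt (Finset.mem_range.mp ht)]
    _ = ∑ t ∈ (Finset.range q).filter (fun t => T < t), ((t : ℝ) ^ 2)⁻¹ := by
        rw [Finset.sum_filter]
        simp only [one_div]
    _ = ∑ t ∈ Finset.Ioo T q, ((t : ℝ) ^ 2)⁻¹ := by
        refine Finset.sum_congr ?_ fun _ _ => rfl
        ext t
        simp only [Finset.mem_filter, Finset.mem_range, Finset.mem_Ioo]
        tauto
    _ ≤ 2 / (T + 1) := sum_Ioo_inv_sq_le T q
    _ ≤ 2 / T := by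
        have : (0 : ℝ) < T := by exact_mod_cast hT
        gcongr
        linarith

lemma sum_sub_invCoeff_sq_le {q : ℕ} [NeZero q] {K : ℝ} {h : ZMod q → ℝ}
    (hh : ∀ c, |h c - 1 / c.val| ≤ K / q) {T : ℕ} (hT : 0 < T) (hTq : T < q) :
    ∑ c, (h c - invCoeff T c) ^ 2 ≤ (2 * K ^ 2 + 4) / T := by
  have hT' : (0 : ℝ) < T := by exact_mod_cast hT
  have hq : (0 : ℝ) < q := by exact_mod_cast hT.trans hTq
  have hterm : ∀ c : ZMod q, (h c - invCoeff T c) ^ 2 ≤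
      2 * (K / q) ^ 2 + 2 * (if T < c.val then 1 / (c.val : ℝ) ^ 2 else 0) := by
    intro c
    have h1 : (h c - 1 / c.val) ^ 2 ≤ (K / q) ^ 2 := sq_le_sq' (by linarith [(abs_le.mp (hh c)).1])
      (abs_le.mp (hh c)).2
    rw [invCoeff]
    split_ifs with h2 h3 h3
    · omega
    · nlinarith [sq_nonneg (K / q)]
    · have h4 : (1 / (c.val : ℝ)) ^ 2 = 1 / (c.val : ℝ) ^ 2 := by rw [div_pow, one_pow]
      rw [← h4]
      nlinarith [sq_nonneg (h c - 1 / c.val - 1 / c.val)]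
    · omega
  calc _ ≤ ∑ c : ZMod q,
        (2 * (K / q) ^ 2 + 2 * (if T < c.val then 1 / (c.val : ℝ) ^ 2 else 0)) :=
        Finset.sum_le_sum fun c _ => hterm c
    _ ≤ q * (2 * (K / q) ^ 2) + 2 * (2 / T) := by
        rw [Finset.sum_add_distrib, Finset.sum_const, Finset.card_univ, ZMod.card, nsmul_eq_mul,
          ← Finset.mul_sum]
        gcongr
        exact sum_val_gt_one_div_sq_le hT
    _ = 2 * K ^ 2 / q + 4 / T := by
        field_simp
        ring
    _ ≤ 2 * K ^ 2 / T + 4 / T := by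
        gcongr
    _ = _ := by ring

lemma sum_abs_aConv_sub_ztrunc_le {q : ℕ} [Fact q.Prime] {K : ℝ} {h : ZMod q → ℝ} (hK : 0 < K)
    (h0 : h 0 = 0) (hh : ∀ c, |h c - 1 / c.val| ≤ K / q)
    (hL : ∀ χ : DirichletCharacter ℂ q, χ ≠ 1 →
      DirichletCharacter.LFunction χ 1 = ∑ c, χ c * (h c : ℝ)) {T : ℕ} (hT : 0 < T) (hTq : T < q) :
    ∑ k, |aConv h k - ztrunc T k| ≤
      q * (aNorm * ((2 * K + 3) * (1 + Real.log q + K) * (T : ℝ) ^ (-(1 / 4) : ℝ))) := by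
  have hq : q.Prime := Fact.out
  have hT' : (1 : ℝ) ≤ T := by exact_mod_cast hT
  set S : ℝ := 1 + Real.log q + K with hS
  have hS0 : 0 ≤ S := by
    have := Real.log_natCast_nonneg q
    positivity
  have hsum : ∑ c, |h c| ≤ S := sum_abs_le_of_abs_sub_one_div_val hh
  have hB : ∀ χ : DirichletCharacter ℂ q, χ ≠ 1 →
      ‖DirichletCharacter.LFunction χ 0‖ ≤ Real.sqrt q * S := by
    intro χ hχ
    refine (norm_LFunction_zero_le hχ).trans ?_
    rw [hL _ (inv_ne_one.mpr hχ)]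
    gcongr
    exact (norm_sum_char_mul_le _ _).trans hsum
  set e : ZMod q → ℝ := fun c => h c - invCoeff T c with he
  have he0 : e 0 = 0 := by simp [he, h0, invCoeff]
  have hpow : ((T : ℝ) ^ (-(1 / 2) : ℝ)) ^ 2 = 1 / T := by
    rw [← Real.rpow_natCast, ← Real.rpow_mul (by positivity)]
    norm_num
    rw [Real.rpow_neg_one]
  have hD : ∑ k, mulConv e k ^ 2 ≤ q * (S * (2 * K + 2) * (T : ℝ) ^ (-(1 / 2) : ℝ)) ^ 2 := by
    refine (sum_sq_mulConv_le hB e he0).trans ?_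
    rw [mul_pow, mul_pow, mul_pow, hpow, Real.sq_sqrt (Nat.cast_nonneg q)]
    have h1 := sum_sub_invCoeff_sq_le hh hT hTq
    have h2 : (2 * K ^ 2 + 4) / T ≤ (2 * K + 2) ^ 2 * (1 / T) := by
      rw [mul_one_div]
      gcongr
      nlinarith
    have h3 := mul_le_mul_of_nonneg_left (h1.trans h2) (by positivity : 0 ≤ (q : ℝ) * S ^ 2)
    refine h3.trans (le_of_eq ?_)
    ring
  have hE := sum_abs_mulConv_le e (by positivity) hD
  have hk : ∀ k : ZMod q, |aConv h k - ztrunc T k| ≤ aNorm * (T : ℝ) ^ (-(1 / 4) : ℝ) * S +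
      ∑ u ∈ Finset.Icc 1 T, |aCoef u| * |mulConv e (k * (u : ZMod q)⁻¹)| := by
    intro k
    have h1 := abs_aConv_sub_sum_le h k hT
    have h2 : |∑ u ∈ Finset.Icc 1 T, aCoef u * mulConv h (k * (u : ZMod q)⁻¹) - ztrunc T k| ≤
        ∑ u ∈ Finset.Icc 1 T, |aCoef u| * |mulConv e (k * (u : ZMod q)⁻¹)| := by
      rw [ztrunc_eq hTq, ← Finset.sum_sub_distrib]
      refine (Finset.abs_sum_le_sum_abs _ _).trans (le_of_eq (Finset.sum_congr rfl fun u _ => ?_))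
      rw [← mul_sub, mulConv_sub, abs_mul]
    refine (abs_sub_le _ _ _).trans (add_le_add (h1.trans ?_) h2)
    exact mul_le_mul_of_nonneg_left hsum (mul_nonneg aNorm_nonneg (by positivity))
  have hquarter : (T : ℝ) ^ (-(1 / 2) : ℝ) ≤ (T : ℝ) ^ (-(1 / 4) : ℝ) :=
    Real.rpow_le_rpow_of_exponent_le hT' (by norm_num)
  calc ∑ k, |aConv h k - ztrunc T k|
      ≤ ∑ k : ZMod q, (aNorm * (T : ℝ) ^ (-(1 / 4) : ℝ) * S +
        ∑ u ∈ Finset.Icc 1 T, |aCoef u| * |mulConv e (k * (u : ZMod q)⁻¹)|) :=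
        Finset.sum_le_sum fun k _ => hk k
    _ = q * (aNorm * (T : ℝ) ^ (-(1 / 4) : ℝ) * S) +
        ∑ u ∈ Finset.Icc 1 T, |aCoef u| * ∑ k, |mulConv e k| := by
        rw [Finset.sum_add_distrib, Finset.sum_const, Finset.card_univ, ZMod.card, nsmul_eq_mul,
          Finset.sum_comm]
        congr 1
        refine Finset.sum_congr rfl fun u hu => ?_
        rw [Finset.mem_Icc] at hu
        have hu0 : (u : ZMod q)⁻¹ ≠ 0 := by
          refine inv_ne_zero fun h0 => ?_
          rw [ZMod.natCast_eq_zero_iff] at h0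
          revert h0
          exact fun hd => absurd (Nat.le_of_dvd (by omega) hd) (by omega)
        rw [← Finset.mul_sum, ← Equiv.sum_comp (Equiv.mulRight₀ _ hu0) fun k => |mulConv e k|]
        rfl
    _ ≤ q * (aNorm * (T : ℝ) ^ (-(1 / 4) : ℝ) * S) +
        aNorm * (q * (S * (2 * K + 2) * (T : ℝ) ^ (-(1 / 4) : ℝ))) := by
        rw [← Finset.sum_mul]
        refine add_le_add le_rfl (mul_le_mul (sum_abs_aCoef_le _) (hE.trans ?_)
          (Finset.sum_nonneg fun k _ => abs_nonneg _) aNorm_nonneg)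
        gcongr
    _ = _ := by ring

lemma abs_mean_pow_sub_mean_pow_le {q : ℕ} [NeZero q] {F G : ZMod q → ℝ} {M D : ℝ}
    (hF : ∀ k, |F k| ≤ M) (hG : ∀ k, |G k| ≤ M) (hD : ∑ k, |F k - G k| ≤ q * D) (l : ℕ) :
    |(1 / q : ℝ) * ∑ k, F k ^ l - (1 / q : ℝ) * ∑ k, G k ^ l| ≤ l * M ^ (l - 1) * D := by
  have hq : (0 : ℝ) < q := by exact_mod_cast Nat.pos_of_ne_zero (NeZero.ne q)
  have hM : 0 ≤ M := (abs_nonneg _).trans (hF 0)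
  rw [← mul_sub, ← Finset.sum_sub_distrib, abs_mul, abs_of_nonneg (by positivity)]
  have h1 : |∑ k, (F k ^ l - G k ^ l)| ≤ ∑ k, |F k - G k| * (l * M ^ (l - 1)) := by
    refine (Finset.abs_sum_le_sum_abs _ _).trans (Finset.sum_le_sum fun k _ => ?_)
    refine (abs_pow_sub_pow_le _ _ _).trans ?_
    rw [mul_assoc]
    gcongr
    exact max_le (hF k) (hG k)
  rw [← Finset.sum_mul] at h1
  have h2 := mul_le_mul_of_nonneg_right hD (by positivity : 0 ≤ l * M ^ (l - 1))
  calc (1 / q : ℝ) * |∑ k, (F k ^ l - G k ^ l)| ≤ (1 / q) * (q * D * (l * M ^ (l - 1))) := by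
        gcongr
        exact h1.trans h2
    _ = _ := by
        field_simp

lemma exists_abs_moment_sub_le : ∃ K : ℝ, 1 ≤ K ∧ ∀ q : ℕ, q.Prime → Odd q → ∀ l T : ℕ, 0 < l →
    2 ^ (4 * (l + 1)) ≤ T → T < q →
    |(1 / q : ℝ) * ∑ k ∈ Finset.range q, Cfun q k ^ l - MC q l| ≤
      2 ^ l * (3 * l * (K * (1 + Real.log q)) ^ l * (T : ℝ) ^ (-(1 / 4) : ℝ) +
        3 * l / q * (K * (T : ℝ) ^ 2) ^ l) := by
  obtain ⟨K, hK, H⟩ := exists_LFunction_one_coeff_zero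
  have haN := aNorm_nonneg
  have htC := truncConst_nonneg
  refine ⟨1 + (2 * K + 3) * (1 + K) * (1 + aNorm) + 4 * truncConst, ?_,
    fun q hq hodd l T hl hT hTq => ?_⟩
  · have : 0 ≤ (2 * K + 3) * (1 + K) * (1 + aNorm) := by positivity
    linarith
  have : Fact q.Prime := ⟨hq⟩
  obtain ⟨h, h0, hh, hL⟩ := H q hq.one_lt
  set K' := 1 + (2 * K + 3) * (1 + K) * (1 + aNorm) + 4 * truncConst with hK'
  have hT0 : 0 < T := lt_of_lt_of_le (by positivity) hT
  have hT' : (1 : ℝ) ≤ T := by exact_mod_cast hT0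
  have hlog : 0 ≤ Real.log q := Real.log_natCast_nonneg q
  have hlogT : Real.log T ≤ 1 + Real.log q := by
    have := Real.log_le_log (by positivity) (by exact_mod_cast hTq.le : (T : ℝ) ≤ q)
    linarith
  have hlogT0 : 0 ≤ Real.log T := Real.log_natCast_nonneg T
  set S : ℝ := 1 + Real.log q + K with hS
  set R : ℝ := 1 + Real.log q with hR
  have hR1 : 1 ≤ R := by linarith
  have hSR : S ≤ (1 + K) * R := by nlinarith
  have hS0 : 0 ≤ S := by positivity
  set τ : ℝ := (T : ℝ) ^ (-(1 / 4) : ℝ) with hτ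
  have hτ0 : 0 ≤ τ := by positivity
  have hsum : ∑ c, |h c| ≤ S := sum_abs_le_of_abs_sub_one_div_val hh
  have e1 := abs_mean_pow_sub_mean_pow_le (M := aNorm * S)
    (fun k => (abs_aConv_le h k).trans (mul_le_mul_of_nonneg_left hsum haN))
    (fun k => (abs_ztrunc_le hTq k).trans (mul_le_mul_of_nonneg_left (by linarith) haN))
    (sum_abs_aConv_sub_ztrunc_le hK h0 hh hL hT0 hTq) l
  have e2 := abs_mean_ztrunc_pow_sub_le l hq hTq
  have e3 := abs_tsum_sub_truncMoment_le hl hT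
  have hKR1 : aNorm * S ≤ K' * R := by
    have h1 : aNorm * S ≤ aNorm * ((1 + K) * R) := by gcongr
    have h2 : aNorm * (1 + K) ≤ K' := by
      rw [hK']
      nlinarith [mul_nonneg haN hK.le, mul_nonneg hK.le hK.le, mul_nonneg (mul_nonneg haN hK.le) hK.le]
    have h3 := mul_le_mul_of_nonneg_right h2 (by linarith : 0 ≤ R)
    linarith
  have hKR2 : aNorm * ((2 * K + 3) * S) ≤ K' * R := by
    have h1 : aNorm * ((2 * K + 3) * S) ≤ aNorm * ((2 * K + 3) * ((1 + K) * R)) := by gcongr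
    have h2 : aNorm * ((2 * K + 3) * (1 + K)) ≤ K' := by
      rw [hK']
      nlinarith [mul_nonneg hK.le hK.le]
    have h3 := mul_le_mul_of_nonneg_right h2 (by linarith : 0 ≤ R)
    linarith
  have hKR3 : 4 * truncConst * Real.log T ≤ K' * R := by
    have h1 : 4 * truncConst * Real.log T ≤ 4 * truncConst * R := by gcongr
    have h2 : 4 * truncConst ≤ K' := by
      have : 0 ≤ (2 * K + 3) * (1 + K) * (1 + aNorm) := by positivity
      linarith
    have h3 := mul_le_mul_of_nonneg_right h2 (by linarith : 0 ≤ R)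
    linarith
  have hKa : aNorm ≤ K' := by
    rw [hK']
    nlinarith [mul_nonneg haN hK.le, mul_nonneg hK.le hK.le, mul_nonneg (mul_nonneg haN hK.le) hK.le]
  have b1 : l * (aNorm * S) ^ (l - 1) * (aNorm * ((2 * K + 3) * S * τ)) ≤
      l * (K' * R) ^ l * τ := by
    calc _ = l * ((aNorm * S) ^ (l - 1) * (aNorm * ((2 * K + 3) * S))) * τ := by ring
      _ ≤ l * ((K' * R) ^ (l - 1) * (K' * R)) * τ := by gcongr
      _ = _ := by rw [← pow_succ, Nat.sub_add_cancel hl]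
  have b2 : 3 * l / q * (aNorm * (T : ℝ) ^ 2) ^ l ≤ 3 * l / q * (K' * (T : ℝ) ^ 2) ^ l := by
    gcongr
  have b3 : 2 * l * (4 * truncConst * Real.log T) ^ l * τ ≤ 2 * l * (K' * R) ^ l * τ := by
    gcongr
  rw [sum_Cfun_pow hodd hL, MC, mul_left_comm, ← mul_sub, abs_mul, abs_pow]
  have hrest : |1 / (q : ℝ) * ∑ k, aConv h k ^ l -
      ∑' n : Fin l → ℕ+, (∏ j, bCoef (n j)) * Bcorr (fun j => (n j : ℕ))| ≤
      3 * l * (K' * R) ^ l * τ + 3 * l / q * (K' * (T : ℝ) ^ 2) ^ l := by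
    rw [abs_le] at e1 e2 e3 ⊢
    constructor <;> linarith [e1.1, e1.2, e2.1, e2.2, e3.1, e3.2]
  refine mul_le_mul (pow_le_pow_left₀ (abs_nonneg _) (abs_Cq_le q) l) hrest (abs_nonneg _)
    (by positivity)

/-! ### Optimising the truncation -/

lemma exponent_le {L w : ℝ} {l : ℕ} (hl : 2 ≤ l) (hL : 0 < L) (hw : 200 ≤ w)
    (hlw : (l : ℝ) ^ 2 * w ^ 2 ≤ L) :
    2 * l * w - L / (12 * l) ≤ -(L * (1 / (20 * l * Real.log l))) := by
  have hl' : (2 : ℝ) ≤ l := by exact_mod_cast hl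
  have hl0 : (0 : ℝ) < l := by linarith
  have hlog : (0.69 : ℝ) < Real.log l := by
    have h1 := Real.log_two_gt_d9
    have h2 := Real.log_le_log (by norm_num) hl'
    norm_num at h1 ⊢
    linarith
  set y : ℝ := L / l with hy
  have hy0 : 0 < y := by positivity
  have h1 : 2 * l * w ≤ y / 100 := by
    rw [hy, div_div, le_div_iff₀ (by positivity)]
    have : (l : ℝ) ^ 2 * w * 200 ≤ (l : ℝ) ^ 2 * w * w := by gcongr
    nlinarith
  have h2 : L / (12 * l) = y / 12 := by
    rw [hy]
    field_simp
  have h3 : L * (1 / (20 * l * Real.log l)) = y / (20 * Real.log l) := by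
    rw [hy]
    field_simp
  have h4 : y / (20 * Real.log l) ≤ y / (20 * 0.69) := by gcongr
  rw [h2, h3]
  norm_num at h4
  linarith

lemma exists_truncation {K : ℝ} (hK : 1 ≤ K) {q l : ℕ} (hl : 2 ≤ l)
    (hw : 200 ≤ Real.log (Real.log q)) (hw' : Real.log (72 * K) ≤ Real.log (Real.log q))
    (hlq : (l : ℝ) ≤ Real.sqrt (Real.log q) / Real.log (Real.log q)) :
    ∃ T : ℕ, 2 ^ (4 * (l + 1)) ≤ T ∧ T < q ∧
      2 ^ l * (3 * l * (K * (1 + Real.log q)) ^ l * (T : ℝ) ^ (-(1 / 4) : ℝ) +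
        3 * l / q * (K * (T : ℝ) ^ 2) ^ l) ≤ (q : ℝ) ^ (-(1 / (20 * l * Real.log l))) := by
  set L : ℝ := Real.log q with hLdef
  set w : ℝ := Real.log L with hwdef
  have hL : 0 < L := by
    rcases (Real.log_natCast_nonneg q).lt_or_eq with h | h
    · exact h
    · rw [hwdef, hLdef, ← h, Real.log_zero] at hw
      norm_num at hw
  have hLw : L = Real.exp w := (Real.exp_log hL).symm
  have hL1 : 1 ≤ L := by
    rw [hLw]
    exact Real.one_le_exp (by linarith)
  have hq0 : (0 : ℝ) < q := by
    rcases (Nat.cast_nonneg (α := ℝ) q).lt_or_eq with h | h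
    · exact h
    · rw [hLdef, ← h, Real.log_zero] at hL
      exact absurd hL (lt_irrefl _)
  have hqL : (q : ℝ) = Real.exp L := (Real.exp_log hq0).symm
  have hl' : (2 : ℝ) ≤ l := by exact_mod_cast hl
  have hl0 : (0 : ℝ) < l := by linarith
  have hlw : (l : ℝ) ^ 2 * w ^ 2 ≤ L := by
    rw [le_div_iff₀ (by linarith)] at hlq
    have h1 := pow_le_pow_left₀ (by positivity) hlq 2
    rwa [mul_pow, Real.sq_sqrt hL.le] at h1
  set x : ℝ := Real.exp (L / (3 * l)) with hx
  have hlog2 := Real.log_two_lt_d9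
  have hlog2' := Real.log_two_gt_d9
  norm_num at hlog2 hlog2'
  have hpow : (2 : ℝ) ^ (4 * (l + 1)) ≤ x := by
    rw [← Real.exp_log (by positivity : (0 : ℝ) < 2 ^ (4 * (l + 1))), hx, Real.exp_le_exp,
      Real.log_pow, le_div_iff₀ (by positivity)]
    push_cast
    have h1 : (l : ℝ) ^ 2 * 200 ^ 2 ≤ (l : ℝ) ^ 2 * w ^ 2 := by gcongr
    have h2 : 4 * ((l : ℝ) + 1) * Real.log 2 ≤ 4 * ((l : ℝ) + 1) * 1 := by
      gcongr
      linarith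
    have h3 := mul_le_mul_of_nonneg_right h2 (by positivity : 0 ≤ 3 * (l : ℝ))
    nlinarith
  have hTpow : 2 ^ (4 * (l + 1)) ≤ ⌊x⌋₊ := Nat.le_floor (by exact_mod_cast hpow)
  have hT1 : 1 ≤ ⌊x⌋₊ := le_trans Nat.one_le_two_pow hTpow
  have hT1' : (1 : ℝ) ≤ (⌊x⌋₊ : ℝ) := by exact_mod_cast hT1
  have hTx : (⌊x⌋₊ : ℝ) ≤ x := Nat.floor_le (Real.exp_pos _).le
  have hxT : x / 2 ≤ (⌊x⌋₊ : ℝ) := by linarith [Nat.lt_floor_add_one x]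
  refine ⟨⌊x⌋₊, hTpow, ?_, ?_⟩
  · have h1 : x < q := by
      rw [hx, hqL, Real.exp_lt_exp]
      exact div_lt_self hL (by linarith)
    exact_mod_cast hTx.trans_lt h1
  set T : ℝ := (⌊x⌋₊ : ℝ) with hT
  set E : ℝ := Real.exp (-(L / (12 * l))) with hE
  have hE0 : 0 < E := Real.exp_pos _
  have hτ : T ^ (-(1 / 4) : ℝ) ≤ 2 * E := by
    refine (Real.rpow_le_rpow_of_nonpos (by positivity) hxT (by norm_num)).trans ?_
    rw [hx, hE, ← Real.exp_log (by norm_num : (0 : ℝ) < 2), ← Real.exp_sub, ← Real.exp_mul,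
      ← Real.exp_add, Real.exp_le_exp]
    have h1 : L / (3 * l) * (-(1 / 4)) = -(L / (12 * l)) := by
      field_simp
      norm_num
    linarith
  have hT2 : (T ^ 2) ^ l / q ≤ E := by
    have h1 : (T ^ 2) ^ l ≤ Real.exp (2 * L / 3) := by
      calc (T ^ 2) ^ l ≤ (x ^ 2) ^ l := by gcongr
        _ = Real.exp (2 * L / 3) := by
          rw [hx, ← pow_mul, ← Real.exp_nat_mul]
          congr 1
          push_cast
          field_simp
    rw [hqL, div_le_iff₀ (Real.exp_pos _), hE, ← Real.exp_add]
    refine h1.trans (Real.exp_le_exp.mpr ?_)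
    have h2 : L / (12 * l) ≤ L / 3 := by
      gcongr
      linarith
    linarith
  set P : ℝ := (K * (1 + L)) ^ l with hP
  have hP0 : 0 ≤ P := by positivity
  have hKP : K ^ l ≤ P := by
    rw [hP]
    gcongr
    nlinarith
  have hterm1 : 3 * l * P * T ^ (-(1 / 4) : ℝ) ≤ 6 * l * P * E := by
    calc 3 * l * P * T ^ (-(1 / 4) : ℝ) ≤ 3 * l * P * (2 * E) := by gcongr
      _ = _ := by ring
  have hterm2 : 3 * l / q * (K * T ^ 2) ^ l ≤ 3 * l * P * E := by
    calc 3 * l / q * (K * T ^ 2) ^ l = 3 * l * K ^ l * ((T ^ 2) ^ l / q) := by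
          rw [mul_pow]
          ring
      _ ≤ 3 * l * P * E := by gcongr
  have hl2 : (9 * l : ℝ) ≤ 18 ^ l := by
    have h1 : (l : ℝ) ≤ 2 ^ l := by exact_mod_cast Nat.lt_two_pow_self.le
    have h2 : (9 : ℝ) ≤ 9 ^ l := le_self_pow₀ (by norm_num) (by omega)
    calc (9 * l : ℝ) ≤ 9 ^ l * 2 ^ l := by gcongr
      _ = 18 ^ l := by
        rw [← mul_pow]
        norm_num
  have h72 : (72 * K * L) ^ l ≤ Real.exp (2 * l * w) := by
    have h1 : 72 * K * L ≤ Real.exp (2 * w) := by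
      rw [← Real.exp_log (by positivity : 0 < 72 * K * L), Real.exp_le_exp,
        Real.log_mul (by positivity) hL.ne']
      linarith
    calc (72 * K * L) ^ l ≤ Real.exp (2 * w) ^ l := by gcongr
      _ = Real.exp (2 * l * w) := by
        rw [← Real.exp_nat_mul]
        congr 1
        ring
  calc 2 ^ l * (3 * l * P * T ^ (-(1 / 4) : ℝ) + 3 * l / q * (K * T ^ 2) ^ l)
      ≤ 2 ^ l * (6 * l * P * E + 3 * l * P * E) := by gcongr
    _ = 9 * l * (2 ^ l * P) * E := by ring
    _ ≤ 18 ^ l * (2 ^ l * (K * (2 * L)) ^ l) * E := by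
        rw [hP]
        gcongr
        linarith
    _ = (72 * K * L) ^ l * E := by
        rw [← mul_pow, ← mul_pow]
        congr 2
        ring
    _ ≤ Real.exp (2 * l * w) * E := by gcongr
    _ ≤ (q : ℝ) ^ (-(1 / (20 * l * Real.log l))) := by
        rw [hE, ← Real.exp_add, hqL, ← Real.exp_mul, Real.exp_le_exp]
        have h1 := exponent_le hl hL (by linarith) hlw
        rw [mul_neg]
        linarith

/-- Asymptotic for the moments of `C(k)` (Theorem 4.1, equation (4.1)). -/
theorem moments_of_C :
    ∃ A : ℝ, ∀ q : ℕ, q.Prime → Odd q → ∀ l : ℕ, 2 ≤ l →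
      (l : ℝ) ≤ Real.sqrt (Real.log q) / Real.log (Real.log q) →
      |(1 / q : ℝ) * ∑ k ∈ Finset.range q, Cfun q k ^ l - MC q l| ≤
        A * (q : ℝ) ^ (-(1 / (20 * l * Real.log l))) := by
  obtain ⟨K, hK, H⟩ := exists_abs_moment_sub_le
  set W : ℝ := max 200 (Real.log (72 * K)) with hW
  set N : ℕ := ⌈Real.exp (Real.exp W)⌉₊ with hN
  set D : ℕ → ℕ → ℝ := fun q l =>
    |(1 / q : ℝ) * ∑ k ∈ Finset.range q, Cfun q k ^ l - MC q l| with hD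
  set B : ℕ → ℕ → ℝ := fun q l => D q l / (q : ℝ) ^ (-(1 / (20 * l * Real.log l))) with hB
  have hB0 : ∀ q l, 0 ≤ B q l := fun q l => by
    simp only [hB, hD]
    positivity
  set M : ℕ → ℕ := fun q => ⌊Real.sqrt (Real.log q) / Real.log (Real.log q)⌋₊ with hM
  set A₀ : ℝ := ∑ q ∈ Finset.range (N + 1), ∑ l ∈ Finset.range (M q + 1), B q l with hA₀
  have hA₀0 : 0 ≤ A₀ := Finset.sum_nonneg fun q _ => Finset.sum_nonneg fun l _ => hB0 q l
  refine ⟨1 + A₀, fun q hq hodd l hl hlq => ?_⟩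
  have hq0 : (0 : ℝ) < q := by exact_mod_cast hq.pos
  have hpos : 0 < (q : ℝ) ^ (-(1 / (20 * l * Real.log l))) := by positivity
  change D q l ≤ _
  by_cases hw : W ≤ Real.log (Real.log q)
  · obtain ⟨T, hT1, hT2, hT3⟩ := exists_truncation hK hl ((le_max_left _ _).trans hw)
      ((le_max_right _ _).trans hw) hlq
    refine (H q hq hodd l T (by omega) hT1 hT2).trans (hT3.trans ?_)
    exact le_mul_of_one_le_left hpos.le (by linarith)
  · have hqN : q ∈ Finset.range (N + 1) := by
      rw [Finset.mem_range, Nat.lt_succ_iff]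
      by_contra! hcon
      have h1 : Real.exp (Real.exp W) < q := (Nat.le_ceil _).trans_lt (by exact_mod_cast hcon)
      have h2 := (Real.lt_log_iff_exp_lt hq0).mpr h1
      have h3 := (Real.lt_log_iff_exp_lt ((Real.exp_pos _).trans h2)).mpr h2
      exact hw h3.le
    have hlM : l ∈ Finset.range (M q + 1) := by
      rw [Finset.mem_range, Nat.lt_succ_iff]
      exact Nat.le_floor hlq
    have h1 : B q l ≤ A₀ :=
      (Finset.single_le_sum (f := fun l => B q l) (fun l _ => hB0 q l) hlM).trans
        (Finset.single_le_sum (f := fun q => ∑ l ∈ Finset.range (M q + 1), B q l)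
          (fun q _ => Finset.sum_nonneg fun l _ => hB0 q l) hqN)
    rw [← div_le_iff₀ hpos]
    change B q l ≤ _
    linarith
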